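/- arXiv:1801.06089 — 3 statements merged into one kernel-verified Lean document; each statement's English description precedes it below -/
import Mathlib

section
/- Let p and q be distinct primes and s ∈ ℂ with Re s > 5/4. Let a : ℤ≥1 → ℂ satisfy the Hecke relation a(n)·a(p) = a(n·p) + 1_{p|n}·a(n/p) for all n ≥ 1, and suppose that for every ε > 0 there is C_ε with |a(n)| ≤ C_ε·n^ε for all n. Let φ : (0,∞) → ℂ be continuous with |φ(x)| ≤ C·min(x, x^{−2}) for some C > 0. For each positive integer N and each c ≥ 1 coprime to N, let N̄_c denote an integer inverse of N modulo c. Define R = Σ_{m,n≥1} a(m)a(n)(mn)^{−s} Σ_{c≥1, gcd(c,q)=1} S(q̄_c·m, p·n; c)·(c√q)^{−1}·φ(4π√(mnp)/(c√q)), 𝒮 = Σ_{m,n≥1} a(m)a(n)(mn)^{−s} Σ_{c≥1, gcd(c,pq)=1} S(q̄_c·m, p·n; c)·(c√q)^{−1}·φ(4π√(mnp)/(c√q)), T₁ = Σ_{m,n≥1} a(m)a(n)(mn)^{−s} Σ_{c≥1, gcd(c,q)=1} S(q̄_c·m, n; c)·(c√q)^{−1}·φ(4π√(mn)/(c√q)),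 and T₂ = Σ_{m,n≥1} a(m)a(n)(mn)^{−s} Σ_{c≥1, gcd(c,pq)=1} S((pq)̄_c·m, n; c)·(c√(pq))^{−1}·φ(4π√(mn)/(c√(pq))). Then all four sums converge absolutely and (1 + p^{−2s})·R = 𝒮 − p^{−1/2}·T₂ + a(p)·p^{−s}·T₁. -/
/-- The Kloosterman sum `S(m,n;c) = ∑_{d ∈ (ℤ/cℤ)ˣ} e((d̄·m + d·n)/c)`,
where `e(x) = exp(2πi·x)`. -/
noncomputable def Kl (m n : ℤ) (c : ℕ) : ℂ :=
  if h : c = 0 then 0 else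
  haveI : NeZero c := ⟨h⟩
  ∑ d : (ZMod c)ˣ,
    Complex.exp (2 * Real.pi * Complex.I *
      (((((d⁻¹ : (ZMod c)ˣ) : ZMod c).val : ℂ) * (m : ℂ) +
        (((d : ZMod c).val : ℂ) * (n : ℂ))) / (c : ℂ)))

/-- The `(m,n,c)` term (with each index shifted by one, so that `m,n,c ≥ 1`) of the
triple sum `∑_{m,n≥1} a(m)a(n)(mn)^{−s} ∑_{(c,N₁)=1} S(inv(c)·m, μ·n; c)·(c√Q)^{−1}·
φ(4π√(mnμ)/(c√Q))`. -/
noncomputable def Kterm (a : ℕ → ℂ) (s : ℂ) (φ : ℝ → ℂ)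
    (N₁ : ℕ) (inv : ℕ → ℤ) (μ Q : ℕ) (t : ℕ × ℕ × ℕ) : ℂ :=
  if Nat.Coprime (t.2.2 + 1) N₁ then
    a (t.1 + 1) * a (t.2.1 + 1) * (((t.1 + 1) * (t.2.1 + 1) : ℕ) : ℂ) ^ (-s) *
      (Kl (inv (t.2.2 + 1) * (t.1 + 1)) ((μ : ℤ) * (t.2.1 + 1)) (t.2.2 + 1) /
        (((t.2.2 + 1 : ℕ) : ℂ) * (Real.sqrt Q : ℂ))) *
      φ (4 * Real.pi * Real.sqrt (((t.1 + 1) * (t.2.1 + 1) * μ : ℕ)) /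
          ((t.2.2 + 1 : ℕ) * Real.sqrt Q))
  else 0


noncomputable def KZ {c : ℕ} [NeZero c] (x y : ZMod c) : ℂ :=
  ∑ d : (ZMod c)ˣ, ZMod.stdAddChar (((d⁻¹ : (ZMod c)ˣ) : ZMod c) * x + (d : ZMod c) * y)

theorem Kl_eq (c : ℕ) [NeZero c] (m n : ℤ) : Kl m n c = KZ (m : ZMod c) (n : ZMod c) := by
  unfold Kl KZ
  rw [dif_neg (NeZero.ne c)]
  refine Finset.sum_congr rfl fun d _ => ?_
  have h : (((d⁻¹ : (ZMod c)ˣ) : ZMod c) * m + (d : ZMod c) * n) =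
      (((((d⁻¹ : (ZMod c)ˣ) : ZMod c).val : ℤ) * m + ((d : ZMod c).val : ℤ) * n : ℤ) : ZMod c) := by
    push_cast
    rw [ZMod.natCast_zmod_val, ZMod.natCast_zmod_val]
  rw [h, ZMod.stdAddChar_coe]
  congr 1
  push_cast
  ring

theorem KZ_symm {c : ℕ} [NeZero c] (x y : ZMod c) : KZ x y = KZ y x := by
  unfold KZ
  rw [← Equiv.sum_comp (Equiv.inv _)]
  refine Finset.sum_congr rfl fun d _ => ?_
  simp [add_comm]

theorem KZ_unit {c : ℕ} [NeZero c] (u : (ZMod c)ˣ) (x y : ZMod c) :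
    KZ ((u : ZMod c) * x) y = KZ x ((u : ZMod c) * y) := by
  unfold KZ
  rw [← Equiv.sum_comp (Equiv.mulRight u)]
  refine Finset.sum_congr rfl fun d _ => ?_
  congr 1
  simp only [Equiv.coe_mulRight, mul_inv_rev, Units.val_mul]
  have : (u : ZMod c) * (u⁻¹ : (ZMod c)ˣ) = 1 := by simp
  linear_combination ((d⁻¹ : (ZMod c)ˣ) : ZMod c) * x * this

theorem star_char {c : ℕ} [NeZero c] (x : ZMod c) :
    (starRingEnd ℂ) (ZMod.stdAddChar x) = ZMod.stdAddChar (-x) := by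
  rw [AddChar.map_neg_eq_conj]

theorem moment1 {c : ℕ} [NeZero c] {ι : Type*} [Fintype ι] (f : ι → ZMod c) (w : ι → ℂ) :
    ((∑ x : ZMod c, ‖∑ i, w i * ZMod.stdAddChar (f i * x)‖ ^ 2 : ℝ) : ℂ) =
      ∑ i, ∑ j, if f i = f j then (c : ℂ) * (w i * (starRingEnd ℂ) (w j)) else 0 := by
  push_cast
  have : ∀ x : ZMod c, ((‖∑ i, w i * ZMod.stdAddChar (f i * x)‖ : ℂ)) ^ 2 =
      ∑ i, ∑ j, (w i * (starRingEnd ℂ) (w j)) * ZMod.stdAddChar (x * (f i - f j)) := by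
    intro x
    rw [← Complex.mul_conj', map_sum, Finset.sum_mul_sum]
    refine Finset.sum_congr rfl fun i _ => Finset.sum_congr rfl fun j _ => ?_
    rw [map_mul (starRingEnd ℂ), star_char, show x * (f i - f j) = f i * x + - (f j * x) by ring,
      AddChar.map_add_eq_mul]
    ring
  simp_rw [this]
  rw [Finset.sum_comm]
  refine Finset.sum_congr rfl fun i _ => ?_
  rw [Finset.sum_comm]
  refine Finset.sum_congr rfl fun j _ => ?_
  rw [← Finset.mul_sum, AddChar.sum_mulShift _ (ZMod.isPrimitive_stdAddChar c)]
  simp only [sub_eq_zero, ZMod.card]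
  split_ifs <;> simp [mul_comm]

theorem norm_char {c : ℕ} [NeZero c] (x : ZMod c) : ‖ZMod.stdAddChar x‖ = 1 := by
  exact Circle.norm_coe _

theorem second_moment {c : ℕ} [NeZero c] (y : ZMod c) :
    ∑ x : ZMod c, ‖KZ x y‖ ^ 2 ≤ (c : ℝ) ^ 2 := by
  have h := moment1 (c := c) (fun d : (ZMod c)ˣ => ((d⁻¹ : (ZMod c)ˣ) : ZMod c))
    (fun d => ZMod.stdAddChar ((d : ZMod c) * y))
  have e : ∀ x, KZ x y = ∑ d : (ZMod c)ˣ, ZMod.stdAddChar ((d : ZMod c) * y) *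
      ZMod.stdAddChar (((d⁻¹ : (ZMod c)ˣ) : ZMod c) * x) := by
    intro x
    unfold KZ
    refine Finset.sum_congr rfl fun d _ => ?_
    rw [AddChar.map_add_eq_mul, mul_comm]
  simp_rw [← e] at h
  have h2 : ((∑ x : ZMod c, ‖KZ x y‖ ^ 2 : ℝ) : ℂ) = ((c * Fintype.card (ZMod c)ˣ : ℝ) : ℂ) := by
    rw [h]
    have : ∀ i j : (ZMod c)ˣ, ((i⁻¹ : (ZMod c)ˣ) : ZMod c) = ((j⁻¹ : (ZMod c)ˣ) : ZMod c) ↔ i = j := by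
      intro i j
      rw [Units.val_inj, inv_inj]
    simp only [this, Finset.sum_ite_eq, Finset.mem_univ, if_true, Complex.mul_conj', norm_char]
    simp [mul_comm]
  have h3 := Complex.ofReal_injective h2
  rw [h3, sq]
  gcongr
  rw [ZMod.card_units_eq_totient]
  exact Nat.totient_le c

theorem moment2 {c : ℕ} [NeZero c] {ι : Type*} [Fintype ι] [DecidableEq ι] (f g : ι → ZMod c) :
    (∑ x : ZMod c, ∑ y : ZMod c, ‖∑ i, ZMod.stdAddChar (f i * x + g i * y)‖ ^ 2 : ℝ) =
      c ^ 2 * (Finset.univ.filter fun ij : ι × ι => f ij.1 = f ij.2 ∧ g ij.1 = g ij.2).card := by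
  apply Complex.ofReal_injective
  rw [Finset.sum_comm, Complex.ofReal_sum]
  have : ∀ y : ZMod c, ((∑ x : ZMod c, ‖∑ i, ZMod.stdAddChar (f i * x + g i * y)‖ ^ 2 : ℝ) : ℂ) =
      ∑ i, ∑ j, if f i = f j then (c : ℂ) * ZMod.stdAddChar (y * (g i - g j)) else 0 := by
    intro y
    have := moment1 f (fun i => ZMod.stdAddChar (g i * y))
    simp_rw [← AddChar.map_add_eq_mul, star_char, ← AddChar.map_add_eq_mul] at this
    simp_rw [add_comm (f _ * _)]
    rw [this]
    refine Finset.sum_congr rfl fun i _ => Finset.sum_congr rfl fun j _ => ?_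
    congr 3
    ring
  simp_rw [this]
  rw [Finset.sum_comm]
  simp_rw [Finset.sum_comm (s := (Finset.univ : Finset (ZMod c)))]
  rw [Finset.card_filter, ← Finset.univ_product_univ, Finset.sum_product]
  push_cast
  rw [Finset.mul_sum]
  refine Finset.sum_congr rfl fun i _ => ?_
  rw [Finset.mul_sum]
  refine Finset.sum_congr rfl fun j _ => ?_
  by_cases h1 : f i = f j
  · simp only [h1, if_true, true_and]
    rw [← Finset.mul_sum, AddChar.sum_mulShift _ (ZMod.isPrimitive_stdAddChar c)]
    simp only [sub_eq_zero, ZMod.card]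
    split_ifs <;> simp [sq]
  · simp [h1]

theorem gcd_mod_c (a c : ℕ) : Nat.gcd (a % c) c = Nat.gcd a c := by
  rw [← Nat.gcd_rec, Nat.gcd_comm]
theorem fib0 {c : ℕ} [NeZero c] (g : ZMod c) :
    (Finset.univ.filter fun v : ZMod c => g * v = 0).card ≤ Nat.gcd g.val c := by
  have hpos : 0 < Nat.gcd g.val c := Nat.gcd_pos_of_pos_right _ (NeZero.pos c)
  refine le_trans (Finset.card_le_card ?_) (IsAddCyclic.card_nsmul_eq_zero_le (α := ZMod c) hpos)
  intro v hv
  simp only [Finset.mem_filter, Finset.mem_univ, true_and] at hv ⊢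
  rw [← addOrderOf_dvd_iff_nsmul_eq_zero]
  apply Nat.dvd_gcd
  · rw [addOrderOf_dvd_iff_nsmul_eq_zero, nsmul_eq_mul, ZMod.natCast_zmod_val, hv]
  · rw [addOrderOf_dvd_iff_nsmul_eq_zero]; simp

theorem fib {c : ℕ} [NeZero c] (g t : ZMod c) :
    (Finset.univ.filter fun v : ZMod c => g * v = t).card ≤ Nat.gcd g.val c := by
  rcases (Finset.univ.filter fun v : ZMod c => g * v = t).eq_empty_or_nonempty with h | ⟨v0, h⟩
  · rw [h]; simp
  · refine le_trans ?_ (fib0 g)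
    refine Finset.card_le_card_of_injOn (fun v => v - v0) ?_ ?_
    · intro v hv
      simp only [Finset.coe_filter, Finset.mem_univ, true_and, Set.mem_ofPred_eq,
        Finset.mem_filter] at hv h ⊢
      rw [mul_sub, hv, h, sub_self]
    · intro v _ w _ hvw
      simpa using hvw

theorem gcd_two {c : ℕ} [NeZero c] (x y : ZMod c) :
    Nat.gcd (2 * x * y).val c ≤ 2 * (Nat.gcd x.val c * Nat.gcd y.val c) := by
  have hc : 0 < c := NeZero.pos c
  have e : (2 * x * y).val = (2 * (x.val * y.val)) % c := by
    rw [← ZMod.val_natCast]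
    congr 1
    push_cast
    rw [ZMod.natCast_zmod_val, ZMod.natCast_zmod_val]
    ring
  rw [e, gcd_mod_c]
  apply Nat.le_of_dvd
  · have := Nat.gcd_pos_of_pos_right x.val hc
    have := Nat.gcd_pos_of_pos_right y.val hc
    positivity
  refine (Nat.gcd_mul_left_dvd_mul_gcd _ _ _).trans ?_
  refine mul_dvd_mul (Nat.gcd_dvd_left _ _) ?_
  exact Nat.gcd_mul_left_dvd_mul_gcd _ _ _

theorem pillai (c : ℕ) [NeZero c] :
    ∑ x : ZMod c, Nat.gcd x.val c ≤ c * c.divisors.card := by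
  have h1 : ∀ x : ZMod c, Nat.gcd x.val c ≤ ∑ e ∈ c.divisors, if e ∣ x.val then e else 0 := by
    intro x
    refine le_trans ?_ (Finset.single_le_sum (f := fun e => if e ∣ x.val then e else 0)
      (fun _ _ => Nat.zero_le _) (Nat.mem_divisors.2 ⟨Nat.gcd_dvd_right x.val c, NeZero.ne c⟩))
    simp [Nat.gcd_dvd_left]
  refine (Finset.sum_le_sum fun x _ => h1 x).trans ?_
  rw [Finset.sum_comm, mul_comm, ← smul_eq_mul, ← Finset.sum_const]
  refine Finset.sum_le_sum fun e he => ?_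
  obtain ⟨f, hf⟩ := (Nat.mem_divisors.1 he).1
  have hc : 0 < c := NeZero.pos c
  have hf0 : 0 < f := Nat.pos_of_ne_zero (by rintro rfl; simp at hf; omega)
  rw [← Finset.sum_filter, Finset.sum_const, smul_eq_mul]
  have : (Finset.univ.filter fun x : ZMod c => e ∣ x.val).card ≤ f := by
    refine le_trans (Finset.card_le_card ?_) (IsAddCyclic.card_nsmul_eq_zero_le (α := ZMod c) hf0)
    intro v hv
    simp only [Finset.mem_filter, Finset.mem_univ, true_and] at hv ⊢
    obtain ⟨k, hk⟩ := hv
    rw [nsmul_eq_mul, ← ZMod.natCast_zmod_val v, ← Nat.cast_mul, ZMod.natCast_eq_zero_iff, hk]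
    exact ⟨k, by rw [hf]; ring⟩
  calc _ ≤ f * e := Nat.mul_le_mul_right _ this
    _ = c := by rw [hf]; ring

theorem sol_count (c : ℕ) [NeZero c] :
    (Finset.univ.filter fun ij : ((ZMod c)ˣ × (ZMod c)ˣ) × ((ZMod c)ˣ × (ZMod c)ˣ) =>
      ((ij.1.1⁻¹ : (ZMod c)ˣ) : ZMod c) + ((ij.1.2⁻¹ : (ZMod c)ˣ) : ZMod c) =
      ((ij.2.1⁻¹ : (ZMod c)ˣ) : ZMod c) + ((ij.2.2⁻¹ : (ZMod c)ˣ) : ZMod c) ∧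
      (ij.1.1 : ZMod c) + (ij.1.2 : ZMod c) = (ij.2.1 : ZMod c) + (ij.2.2 : ZMod c)).card
      ≤ 2 * (c * c.divisors.card) ^ 2 := by
  have h1 : (Finset.univ.filter fun ij : ((ZMod c)ˣ × (ZMod c)ˣ) × ((ZMod c)ˣ × (ZMod c)ˣ) =>
      ((ij.1.1⁻¹ : (ZMod c)ˣ) : ZMod c) + ((ij.1.2⁻¹ : (ZMod c)ˣ) : ZMod c) =
      ((ij.2.1⁻¹ : (ZMod c)ˣ) : ZMod c) + ((ij.2.2⁻¹ : (ZMod c)ˣ) : ZMod c) ∧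
      (ij.1.1 : ZMod c) + (ij.1.2 : ZMod c) = (ij.2.1 : ZMod c) + (ij.2.2 : ZMod c)).card
      ≤ (Finset.univ.filter fun t : ZMod c × ZMod c × ZMod c =>
        (2 * t.1 * t.2.1) * t.2.2 = - (t.1 * t.2.1 * (t.1 + t.2.1))).card := by
    refine Finset.card_le_card_of_injOn
      (fun ij => ((ij.1.1 : ZMod c) - ij.2.1, (ij.1.2 : ZMod c) - ij.2.1, (ij.2.1 : ZMod c))) ?_ ?_
    · rintro ⟨⟨d1, d2⟩, ⟨d3, d4⟩⟩ h
      simp only [Finset.coe_filter, Finset.mem_univ, true_and, Set.mem_ofPred_eq,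
        Finset.mem_filter] at h ⊢
      obtain ⟨ha, hb⟩ := h
      have e1 : (d1 : ZMod c) * (d1⁻¹ : (ZMod c)ˣ) = 1 := by simp
      have e2 : (d2 : ZMod c) * (d2⁻¹ : (ZMod c)ˣ) = 1 := by simp
      have e3 : (d3 : ZMod c) * (d3⁻¹ : (ZMod c)ˣ) = 1 := by simp
      have e4 : (d4 : ZMod c) * (d4⁻¹ : (ZMod c)ˣ) = 1 := by simp
      generalize ((d1⁻¹ : (ZMod c)ˣ) : ZMod c) = i1 at *
      generalize ((d2⁻¹ : (ZMod c)ˣ) : ZMod c) = i2 at *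
      generalize ((d3⁻¹ : (ZMod c)ˣ) : ZMod c) = i3 at *
      generalize ((d4⁻¹ : (ZMod c)ˣ) : ZMod c) = i4 at *
      generalize (d1 : ZMod c) = x1 at *
      generalize (d2 : ZMod c) = x2 at *
      generalize (d3 : ZMod c) = x3 at *
      generalize (d4 : ZMod c) = x4 at *
      have k1 : x3 * x4 * (x1 + x2) = x1 * x2 * (x3 + x4) := by
        linear_combination (x1 * x2 * x3 * x4) * ha - x2 * x3 * x4 * e1 - x1 * x3 * x4 * e2
          + x1 * x2 * x4 * e3 + x1 * x2 * x3 * e4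
      have hx4 : x4 = x1 + x2 - x3 := by linear_combination -hb
      subst hx4
      linear_combination -k1
    · rintro ⟨⟨d1, d2⟩, ⟨d3, d4⟩⟩ h ⟨⟨d1', d2'⟩, ⟨d3', d4'⟩⟩ h' e
      simp only [Finset.coe_filter, Finset.mem_univ, true_and, Set.mem_ofPred_eq,
        Prod.mk.injEq] at h h' e ⊢
      obtain ⟨e1, e2, e3⟩ := e
      refine ⟨⟨?_, ?_⟩, ?_, ?_⟩ <;> apply Units.ext
      · linear_combination e1 + e3
      · linear_combination e2 + e3
      · exact e3
      · linear_combination -h.2 + h'.2 + e1 + e2 + e3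
  refine h1.trans ?_
  have h2 : (Finset.univ.filter fun t : ZMod c × ZMod c × ZMod c =>
        (2 * t.1 * t.2.1) * t.2.2 = - (t.1 * t.2.1 * (t.1 + t.2.1))).card =
      ∑ x : ZMod c, ∑ y : ZMod c, (Finset.univ.filter fun d : ZMod c =>
        (2 * x * y) * d = - (x * y * (x + y))).card := by
    simp_rw [Finset.card_filter]
    rw [← Finset.univ_product_univ, Finset.sum_product]
    refine Finset.sum_congr rfl fun x _ => ?_
    rw [← Finset.univ_product_univ, Finset.sum_product]
  rw [h2]
  calc _ ≤ ∑ x : ZMod c, ∑ y : ZMod c, 2 * (Nat.gcd x.val c * Nat.gcd y.val c) :=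
        Finset.sum_le_sum fun x _ => Finset.sum_le_sum fun y _ => (fib _ _).trans (gcd_two x y)
    _ = 2 * (∑ x : ZMod c, Nat.gcd x.val c) ^ 2 := by
        simp_rw [← Finset.mul_sum]
        rw [sq, Finset.sum_mul]
    _ ≤ _ := by
        gcongr
        exact pillai c

theorem fourth_moment (c : ℕ) [NeZero c] :
    ∑ x : ZMod c, ∑ y : ZMod c, ‖KZ x y‖ ^ 4 ≤ 2 * (c : ℝ) ^ 4 * (c.divisors.card : ℝ) ^ 2 := by
  classical
  have h := moment2 (c := c) (fun d : (ZMod c)ˣ × (ZMod c)ˣ =>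
    ((d.1⁻¹ : (ZMod c)ˣ) : ZMod c) + ((d.2⁻¹ : (ZMod c)ˣ) : ZMod c))
    (fun d => (d.1 : ZMod c) + (d.2 : ZMod c))
  have e : ∀ x y : ZMod c, ‖KZ x y‖ ^ 4 = ‖∑ d : (ZMod c)ˣ × (ZMod c)ˣ, ZMod.stdAddChar
      ((((d.1⁻¹ : (ZMod c)ˣ) : ZMod c) + ((d.2⁻¹ : (ZMod c)ˣ) : ZMod c)) * x +
        ((d.1 : ZMod c) + (d.2 : ZMod c)) * y)‖ ^ 2 := by
    intro x y
    have : KZ x y ^ 2 = ∑ d : (ZMod c)ˣ × (ZMod c)ˣ, ZMod.stdAddChar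
      ((((d.1⁻¹ : (ZMod c)ˣ) : ZMod c) + ((d.2⁻¹ : (ZMod c)ˣ) : ZMod c)) * x +
        ((d.1 : ZMod c) + (d.2 : ZMod c)) * y) := by
      rw [sq, KZ, Finset.sum_mul_sum, ← Finset.univ_product_univ, Finset.sum_product]
      refine Finset.sum_congr rfl fun i _ => Finset.sum_congr rfl fun j _ => ?_
      rw [← AddChar.map_add_eq_mul]
      congr 1
      ring
    rw [← this, norm_pow]
    ring
  simp_rw [e]
  rw [h]
  have := sol_count c
  have h3 : ((Finset.univ.filter fun ij : ((ZMod c)ˣ × (ZMod c)ˣ) × ((ZMod c)ˣ × (ZMod c)ˣ) =>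
      ((ij.1.1⁻¹ : (ZMod c)ˣ) : ZMod c) + ((ij.1.2⁻¹ : (ZMod c)ˣ) : ZMod c) =
      ((ij.2.1⁻¹ : (ZMod c)ˣ) : ZMod c) + ((ij.2.2⁻¹ : (ZMod c)ˣ) : ZMod c) ∧
      (ij.1.1 : ZMod c) + (ij.1.2 : ZMod c) = (ij.2.1 : ZMod c) + (ij.2.2 : ZMod c)).card : ℝ)
      ≤ 2 * (c * c.divisors.card) ^ 2 := by exact_mod_cast this
  calc _ ≤ (c : ℝ) ^ 2 * (2 * (c * c.divisors.card) ^ 2) := by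
        gcongr
    _ = _ := by ring

theorem tot_tau (c : ℕ) (hc : 0 < c) : c ≤ c.divisors.card * Nat.totient c := by
  conv_lhs => rw [← Nat.sum_totient c]
  rw [← smul_eq_mul]
  refine Finset.sum_le_card_nsmul _ _ _ fun d hd => ?_
  exact Nat.le_of_dvd (Nat.totient_pos.2 hc) (Nat.totient_dvd_of_dvd (Nat.mem_divisors.1 hd).1)

theorem KZ_bound0 (c : ℕ) [NeZero c] (M : ℕ) (hM : 0 < M) (y : ZMod c) :
    (Nat.totient c : ℝ) * ‖KZ (M : ZMod c) y‖ ^ 4 ≤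
      M * (2 * (c : ℝ) ^ 4 * (c.divisors.card : ℝ) ^ 2) := by
  have h1 : (Nat.totient c : ℝ) * ‖KZ (M : ZMod c) y‖ ^ 4 =
      ∑ v : (ZMod c)ˣ, ‖KZ ((M : ZMod c) * (v : ZMod c)) (((v⁻¹ : (ZMod c)ˣ) : ZMod c) * y)‖ ^ 4 := by
    have : ∀ v : (ZMod c)ˣ, KZ ((M : ZMod c) * (v : ZMod c)) (((v⁻¹ : (ZMod c)ˣ) : ZMod c) * y) =
        KZ (M : ZMod c) y := by
      intro v
      rw [← KZ_unit, mul_comm (M : ZMod c), ← mul_assoc]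
      simp
    simp_rw [this]
    rw [Finset.sum_const, Finset.card_univ, ZMod.card_units_eq_totient, nsmul_eq_mul]
  rw [h1]
  have h2 : ∀ v : (ZMod c)ˣ, ‖KZ ((M : ZMod c) * (v : ZMod c)) (((v⁻¹ : (ZMod c)ˣ) : ZMod c) * y)‖ ^ 4 ≤
      ∑ z : ZMod c, ‖KZ ((M : ZMod c) * (v : ZMod c)) z‖ ^ 4 := fun v =>
    Finset.single_le_sum (f := fun z => ‖KZ ((M : ZMod c) * (v : ZMod c)) z‖ ^ 4)
      (fun _ _ => by positivity) (Finset.mem_univ _)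
  refine (Finset.sum_le_sum fun v _ => h2 v).trans ?_
  set G : ZMod c → ℝ := fun x => ∑ z : ZMod c, ‖KZ x z‖ ^ 4 with hG
  have hG0 : ∀ x, 0 ≤ G x := fun x => Finset.sum_nonneg fun _ _ => by positivity
  have h3 : ∑ v : (ZMod c)ˣ, G ((M : ZMod c) * (v : ZMod c)) ≤ ∑ v : ZMod c, G ((M : ZMod c) * (v : ZMod c)) := by
    have : ∑ v : (ZMod c)ˣ, G ((M : ZMod c) * (v : ZMod c)) =
        ∑ v ∈ Finset.univ.map ⟨fun v : (ZMod c)ˣ => (v : ZMod c), Units.val_injective⟩,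
          G ((M : ZMod c) * (v : ZMod c)) := by
      rw [Finset.sum_map]; rfl
    rw [this]
    exact Finset.sum_le_sum_of_subset_of_nonneg (Finset.subset_univ _) fun _ _ _ => hG0 _
  refine h3.trans ?_
  have h4 : ∑ v : ZMod c, G ((M : ZMod c) * (v : ZMod c)) =
      ∑ x : ZMod c, ((Finset.univ.filter fun v : ZMod c => (M : ZMod c) * v = x).card : ℝ) * G x := by
    rw [← Finset.sum_fiberwise (s := Finset.univ) (g := fun v : ZMod c => (M : ZMod c) * v)]
    refine Finset.sum_congr rfl fun x _ => ?_
    rw [← nsmul_eq_mul]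
    refine Finset.sum_eq_card_nsmul fun v hv => ?_
    rw [(Finset.mem_filter.1 hv).2]
  rw [h4]
  have h5 : ∀ x : ZMod c,
      ((Finset.univ.filter fun v : ZMod c => (M : ZMod c) * v = x).card : ℝ) ≤ M := by
    intro x
    have := fib (M : ZMod c) x
    rw [ZMod.val_natCast, gcd_mod_c] at this
    exact_mod_cast this.trans (Nat.gcd_le_left _ hM)
  calc _ ≤ ∑ x : ZMod c, (M : ℝ) * G x :=
        Finset.sum_le_sum fun x _ => mul_le_mul_of_nonneg_right (h5 x) (hG0 x)
    _ = M * ∑ x : ZMod c, G x := by rw [Finset.mul_sum]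
    _ ≤ _ := by
        gcongr
        exact fourth_moment c

theorem KZ_bound (c : ℕ) [NeZero c] (M : ℕ) (hM : 0 < M) (y : ZMod c) :
    ‖KZ (M : ZMod c) y‖ ≤ 2 * M * ((c : ℝ) ^ (3 / 4 : ℝ) * (c.divisors.card : ℝ)) := by
  have hc : 0 < c := NeZero.pos c
  have hcR : (0 : ℝ) < c := by exact_mod_cast hc
  have h0 := KZ_bound0 c M hM y
  have ht : (c : ℝ) ≤ c.divisors.card * Nat.totient c := by exact_mod_cast tot_tau c hc
  have hM1 : (1 : ℝ) ≤ M := by exact_mod_cast hM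
  have htau : (1 : ℝ) ≤ c.divisors.card := by
    exact_mod_cast Finset.card_pos.2 ⟨1, Nat.one_mem_divisors.2 hc.ne'⟩
  set k := ‖KZ (M : ZMod c) y‖
  set τ : ℝ := (c.divisors.card : ℝ)
  have hk : 0 ≤ k := norm_nonneg _
  have h1 : (c : ℝ) * k ^ 4 ≤ c * (2 * M * c ^ 3 * τ ^ 3) := by
    calc (c : ℝ) * k ^ 4 ≤ (τ * Nat.totient c) * k ^ 4 := by gcongr
      _ = τ * (Nat.totient c * k ^ 4) := by ring
      _ ≤ τ * (M * (2 * (c : ℝ) ^ 4 * τ ^ 2)) := by gcongr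
      _ = _ := by ring
  have h2 : k ^ 4 ≤ 2 * M * c ^ 3 * τ ^ 3 := le_of_mul_le_mul_left h1 hcR
  have h3 : (2 * M * ((c : ℝ) ^ (3 / 4 : ℝ) * τ)) ^ 4 = 16 * M ^ 4 * (c ^ 3 * τ ^ 4) := by
    have : ((c : ℝ) ^ (3 / 4 : ℝ)) ^ 4 = c ^ 3 := by
      rw [← Real.rpow_natCast, ← Real.rpow_mul hcR.le]
      norm_num
    rw [mul_pow, mul_pow, mul_pow, this]
    norm_num
  refine le_of_pow_le_pow_left₀ (n := 4) (by norm_num) (by positivity) ?_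
  rw [h3]
  refine h2.trans ?_
  have a1 : (M : ℝ) ≤ M ^ 4 := le_self_pow₀ hM1 (by norm_num)
  have a2 : τ ^ 3 ≤ τ ^ 4 := pow_le_pow_right₀ htau (by norm_num)
  calc 2 * (M : ℝ) * c ^ 3 * τ ^ 3 ≤ 2 * M ^ 4 * c ^ 3 * τ ^ 4 := by gcongr
    _ ≤ 16 * M ^ 4 * (c ^ 3 * τ ^ 4) := by
      rw [mul_assoc (2 * (M : ℝ) ^ 4)]
      gcongr; norm_num

theorem char_mul (p c : ℕ) [NeZero p] [NeZero c] [NeZero (p * c)] (j : ℤ) :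
    ZMod.stdAddChar (((p * j : ℤ)) : ZMod (p * c)) = ZMod.stdAddChar (j : ZMod c) := by
  rw [ZMod.stdAddChar_coe, ZMod.stdAddChar_coe]
  congr 1
  have h1 : (p : ℂ) ≠ 0 := by exact_mod_cast NeZero.ne p
  have h2 : (c : ℂ) ≠ 0 := by exact_mod_cast NeZero.ne c
  push_cast
  field_simp

theorem char_mul' (p c : ℕ) [NeZero p] [NeZero c] [NeZero (p * c)] (j : ℤ) :
    ZMod.stdAddChar (((c * j : ℤ)) : ZMod (p * c)) = ZMod.stdAddChar (j : ZMod p) := by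
  rw [ZMod.stdAddChar_coe, ZMod.stdAddChar_coe]
  congr 1
  have h1 : (p : ℂ) ≠ 0 := by exact_mod_cast NeZero.ne p
  have h2 : (c : ℂ) ≠ 0 := by exact_mod_cast NeZero.ne c
  push_cast
  field_simp

theorem zinv_unique {c : ℕ} (x : ℕ) (h : Nat.Coprime x c) (z : ZMod c) (hz : (x : ZMod c) * z = 1) :
    z = (x : ZMod c)⁻¹ := by
  have := ZMod.coe_mul_inv_eq_one x h
  calc z = z * ((x : ZMod c) * (x : ZMod c)⁻¹) := by rw [this, mul_one]
    _ = (x * z) * (x : ZMod c)⁻¹ := by ring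
    _ = _ := by rw [hz, one_mul]

theorem KZ_range {c : ℕ} [NeZero c] (x y : ZMod c) :
    KZ x y = ∑ r ∈ Finset.range c with Nat.Coprime r c,
      ZMod.stdAddChar ((r : ZMod c) * x) * ZMod.stdAddChar ((r : ZMod c)⁻¹ * y) := by
  rw [KZ_symm]
  unfold KZ
  refine Finset.sum_nbij (fun d => (d : ZMod c).val) ?_ ?_ ?_ ?_
  · intro d _
    simp only [Finset.mem_filter, Finset.mem_range]
    exact ⟨ZMod.val_lt _, ZMod.val_coe_unit_coprime d⟩
  · intro d _ e _ h
    exact Units.ext (ZMod.val_injective c h)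
  · intro r hr
    simp only [Finset.coe_filter, Finset.mem_range, Set.mem_ofPred_eq] at hr
    refine ⟨ZMod.unitOfCoprime r hr.2, by simp, ?_⟩
    simp [ZMod.val_natCast, Nat.mod_eq_of_lt hr.1]
  · intro d _
    rw [ZMod.natCast_zmod_val, ZMod.inv_coe_unit, ← AddChar.map_add_eq_mul, add_comm]

theorem sum_range_blocks (p c : ℕ) (hc : 0 < c) (H : ℕ → ℂ) :
    ∑ x ∈ Finset.range (p * c), H x = ∑ r ∈ Finset.range c, ∑ k ∈ Finset.range p, H (r + c * k) := by
  rw [← Finset.sum_product']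
  symm
  refine Finset.sum_nbij' (fun rk => rk.1 + c * rk.2) (fun x => (x % c, x / c)) ?_ ?_ ?_ ?_ ?_
  · rintro ⟨r, k⟩ h
    simp only [Finset.mem_product, Finset.mem_range] at h ⊢
    have : c * k + c ≤ c * p := by
      rw [← Nat.mul_succ]; exact Nat.mul_le_mul_left _ h.2
    rw [mul_comm p c]; omega
  · intro x h
    simp only [Finset.mem_product, Finset.mem_range] at h ⊢
    exact ⟨Nat.mod_lt _ hc, Nat.div_lt_of_lt_mul (by rwa [mul_comm])⟩
  · rintro ⟨r, k⟩ h
    simp only [Finset.mem_product, Finset.mem_range] at h ⊢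
    simp [Nat.add_mul_mod_self_left, Nat.mod_eq_of_lt h.1, Nat.add_mul_div_left _ _ hc,
      Nat.div_eq_of_lt h.1]
  · intro x h
    exact Nat.mod_add_div x c
  · intro _ _; rfl

theorem sum_char_p (p : ℕ) [NeZero p] (M : ℤ) :
    ∑ k ∈ Finset.range p, ZMod.stdAddChar ((k * M : ℤ) : ZMod p) =
      if (p : ℤ) ∣ M then (p : ℂ) else 0 := by
  have h := AddChar.sum_mulShift (M : ZMod p) (ZMod.isPrimitive_stdAddChar p)
  simp only [ZMod.card, ZMod.intCast_zmod_eq_zero_iff_dvd] at h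
  push_cast at h
  rw [← h]
  refine Finset.sum_nbij' (fun k => (k : ZMod p)) (fun x => x.val) ?_ ?_ ?_ ?_ ?_
  · simp
  · intro x _; simp [ZMod.val_lt]
  · intro k hk; simp [ZMod.val_natCast, Nat.mod_eq_of_lt (Finset.mem_range.1 hk)]
  · intro x _; simp
  · intro k _; push_cast; rfl

theorem Kl_p (p c : ℕ) (hp : p.Prime) (hc : 0 < c) (M n w : ℤ)
    (hw : ¬ p ∣ c → (p : ℤ) * w ≡ 1 [ZMOD c]) :
    Kl M (p * n) (p * c) = (if (p : ℤ) ∣ M then (p : ℂ) * Kl (M / p) n c else 0)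
      - (if p ∣ c then 0 else Kl (w * M) n c) := by
  have : NeZero p := ⟨hp.ne_zero⟩
  have : NeZero c := ⟨hc.ne'⟩
  have : NeZero (p * c) := ⟨mul_ne_zero hp.ne_zero hc.ne'⟩
  simp only [Kl_eq]
  set G : ℕ → ℂ := fun x => ZMod.stdAddChar ((x * M : ℤ) : ZMod (p * c)) *
    ZMod.stdAddChar ((x : ZMod c)⁻¹ * (n : ZMod c)) with hG
  have h1 : KZ (M : ZMod (p * c)) ((p * n : ℤ) : ZMod (p * c)) =
      ∑ x ∈ Finset.range (p * c) with Nat.Coprime x (p * c), G x := by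
    rw [KZ_range]
    refine Finset.sum_congr rfl fun x hx => ?_
    have hx2 := (Finset.mem_filter.1 hx).2
    have hxc : Nat.Coprime x c := Nat.Coprime.coprime_dvd_right (Dvd.intro_left _ rfl) hx2
    simp only [hG]
    congr 1
    · push_cast; rfl
    · have e1 : (x : ZMod (p * c))⁻¹ * ((p * n : ℤ) : ZMod (p * c)) =
          ((p * (((x : ZMod (p * c))⁻¹).val * n) : ℤ) : ZMod (p * c)) := by
        push_cast
        rw [ZMod.natCast_zmod_val]
        push_cast
        ring
      rw [e1, char_mul]
      congr 1
      push_cast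
      congr 1
      apply zinv_unique x hxc
      have e2 := ZMod.coe_mul_inv_eq_one x hx2
      have e3 := congrArg (ZMod.castHom (Dvd.intro_left p rfl : c ∣ p * c) (ZMod c)) e2
      rw [map_mul, map_one, map_natCast] at e3
      rw [← e3]
      congr 1
      rw [ZMod.castHom_apply, ZMod.natCast_val]
  have h2 : ∑ x ∈ Finset.range (p * c) with Nat.Coprime x (p * c), G x =
      ∑ x ∈ Finset.range (p * c), (if Nat.Coprime x c then G x else 0) -
      ∑ x ∈ Finset.range (p * c), (if Nat.Coprime x c ∧ p ∣ x then G x else 0) := by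
    rw [Finset.sum_filter, ← Finset.sum_sub_distrib]
    refine Finset.sum_congr rfl fun x _ => ?_
    have : Nat.Coprime x (p * c) ↔ Nat.Coprime x c ∧ ¬ p ∣ x := by
      rw [Nat.coprime_mul_iff_right, Nat.coprime_comm, Nat.Prime.coprime_iff_not_dvd hp, and_comm]
    by_cases ha : Nat.Coprime x c <;> by_cases hb : p ∣ x <;> simp [this, ha, hb]
  have h3 : ∑ x ∈ Finset.range (p * c), (if Nat.Coprime x c then G x else 0) =
      (if (p : ℤ) ∣ M then (p : ℂ) * KZ ((M / p : ℤ) : ZMod c) (n : ZMod c) else 0) := by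
    rw [sum_range_blocks p c hc]
    have e : ∀ r k : ℕ, (if Nat.Coprime (r + c * k) c then G (r + c * k) else 0) =
        (if Nat.Coprime r c then ZMod.stdAddChar ((r * M : ℤ) : ZMod (p * c)) *
          ZMod.stdAddChar ((r : ZMod c)⁻¹ * (n : ZMod c)) else 0) *
          ZMod.stdAddChar ((k * M : ℤ) : ZMod p) := by
      intro r k
      have a1 : Nat.Coprime (r + c * k) c ↔ Nat.Coprime r c := by simp
      have a2 : ((r + c * k : ℕ) : ZMod c) = r := by simp
      have a3 : (((r + c * k : ℕ) * M : ℤ) : ZMod (p * c)) =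
          ((r * M : ℤ) : ZMod (p * c)) + ((c * (k * M) : ℤ) : ZMod (p * c)) := by
        push_cast; ring
      simp only [a1, hG, a2, a3, AddChar.map_add_eq_mul, char_mul']
      split_ifs <;> ring
    simp_rw [e, ← Finset.mul_sum, sum_char_p]
    by_cases hM : (p : ℤ) ∣ M
    · simp only [hM, if_true]
      rw [← Finset.sum_mul, mul_comm, KZ_range, Finset.sum_filter]
      congr 1
      refine Finset.sum_congr rfl fun r _ => ?_
      obtain ⟨M', rfl⟩ := hM
      have hp0 : (p : ℤ) ≠ 0 := by exact_mod_cast hp.ne_zero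
      rw [Int.mul_ediv_cancel_left _ hp0]
      have : ((r * (p * M') : ℤ) : ZMod (p * c)) = ((p * (r * M') : ℤ) : ZMod (p * c)) := by
        congr 1; ring
      rw [this, char_mul]
      push_cast
      rfl
    · simp [hM]
  have h4 : ∑ x ∈ Finset.range (p * c), (if Nat.Coprime x c ∧ p ∣ x then G x else 0) =
      (if p ∣ c then 0 else KZ ((w * M : ℤ) : ZMod c) (n : ZMod c)) := by
    by_cases hpc : p ∣ c
    · rw [if_pos hpc]
      refine Finset.sum_eq_zero fun x _ => ?_
      rw [if_neg]
      rintro ⟨a, b⟩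
      exact hp.one_lt.ne' (Nat.dvd_one.1 (a ▸ Nat.dvd_gcd b hpc))
    · rw [if_neg hpc]
      have hcop : Nat.Coprime p c := (Nat.Prime.coprime_iff_not_dvd hp).2 hpc
      have hw1 : (p : ZMod c) * (w : ZMod c) = 1 := by
        have := (ZMod.intCast_eq_intCast_iff _ _ _).2 (hw hpc)
        push_cast at this
        exact this
      have hu : ((w * M : ℤ) : ZMod c) =
          (((ZMod.unitOfCoprime p hcop)⁻¹ : (ZMod c)ˣ) : ZMod c) * (M : ZMod c) := by
        push_cast
        congr 1
        rw [← ZMod.inv_coe_unit, ZMod.coe_unitOfCoprime]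
        exact zinv_unique p hcop _ hw1
      rw [hu, KZ_unit, KZ_range, ← Finset.sum_filter]
      symm
      refine Finset.sum_nbij (fun y => p * y) ?_ ?_ ?_ ?_
      · intro y hy
        simp only [Finset.mem_filter, Finset.mem_range] at hy ⊢
        exact ⟨Nat.mul_lt_mul_of_pos_left hy.1 hp.pos, Nat.Coprime.mul_left hcop hy.2,
          Dvd.intro _ rfl⟩
      · intro y _ z _ h
        exact Nat.eq_of_mul_eq_mul_left hp.pos h
      · intro x hx
        simp only [Finset.coe_filter, Finset.mem_range, Set.mem_ofPred_eq] at hx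
        obtain ⟨hx1, hx2, y, rfl⟩ := hx
        refine ⟨y, ?_, rfl⟩
        simp only [Finset.coe_filter, Finset.mem_range, Set.mem_ofPred_eq]
        exact ⟨Nat.lt_of_mul_lt_mul_left hx1, Nat.Coprime.coprime_mul_left hx2⟩
      · intro y hy
        have hy2 := (Finset.mem_filter.1 hy).2
        simp only [hG]
        have : (((p * y : ℕ) * M : ℤ) : ZMod (p * c)) = ((p * (y * M) : ℤ) : ZMod (p * c)) := by
          push_cast; ring
        rw [this, char_mul]
        congr 1
        · push_cast; rfl
        · congr 1
          rw [← mul_assoc]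
          congr 1
          apply zinv_unique (p * y) (Nat.Coprime.mul_left hcop hy2)
          have b1 := ZMod.coe_mul_inv_eq_one y hy2
          have b2 : (p : ZMod c) * (((ZMod.unitOfCoprime p hcop)⁻¹ : (ZMod c)ˣ) : ZMod c) = 1 := by
            rw [← ZMod.coe_unitOfCoprime p hcop]; simp
          push_cast
          linear_combination (p : ZMod c) * (((ZMod.unitOfCoprime p hcop)⁻¹ : (ZMod c)ˣ) : ZMod c) * b1 + b2
  rw [h1, h2, h3, h4]

theorem core_pt (x y z η k τ W : ℝ) (hy : 0 ≤ y) (hyx : y ≤ x) (hz : 0 ≤ z) (hη : 0 < η)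
    (hη8 : η ≤ 1 / 8) (hk : 0 ≤ k) (hτ : 1 ≤ τ) (hkb : k ≤ 2 * Real.exp (x + 3 / 4 * z) * τ)
    (hW0 : 0 ≤ W) (hW1 : x ≤ z → W = 1)
    (hW2 : z < x → Real.exp (-(1 + η) * x) ≤ 4 * (Real.exp (-(1 + η) * z) * W)) :
    Real.exp (-(5 / 4 + 3 * η) * (x + y)) * (k * Real.exp (-z)) *
      min (Real.exp ((x + y) / 2 - z)) (Real.exp ((1 / 2 + 4 * η) * ((x + y) / 2 - z))) ≤
    4 * (Real.exp (-2 * (x + y)) * Real.exp (-(9 / 8) * z) * τ +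
      Real.exp (-(1 + η) * (x + y)) * Real.exp (-(1 + η / 24) * z) +
      Real.exp (-(1 + η) * y) * Real.exp (-(3 + η / 24) * z) * (W * k ^ 2)) := by
  have hx : 0 ≤ x := hy.trans hyx
  set E1 := Real.exp (-2 * (x + y)) * Real.exp (-(9 / 8) * z) * τ with hE1
  set Ea := Real.exp (-(1 + η) * (x + y)) * Real.exp (-(1 + η / 24) * z) with hEa
  set Eb := Real.exp (-(1 + η) * y) * Real.exp (-(3 + η / 24) * z) * (W * k ^ 2) with hEb
  have p1 : 0 ≤ E1 := by positivity
  have pa : 0 ≤ Ea := by positivity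
  have pb : 0 ≤ Eb := by positivity
  have amgm : ∀ l : ℝ, k ≤ (Real.exp l + Real.exp (-l) * k ^ 2) := by
    intro l
    have h1 : Real.exp l * Real.exp (-l) = 1 := by rw [← Real.exp_add]; simp
    have h2 := Real.exp_pos l
    have h3 := Real.exp_pos (-l)
    nlinarith [sq_nonneg (Real.exp (-l) * k - 1), mul_pos h2 h3]
  by_cases c1 : x + y ≤ z / 24
  · have : Real.exp (-(5 / 4 + 3 * η) * (x + y)) * (k * Real.exp (-z)) *
      min (Real.exp ((x + y) / 2 - z)) (Real.exp ((1 / 2 + 4 * η) * ((x + y) / 2 - z))) ≤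
      Real.exp (-(5 / 4 + 3 * η) * (x + y)) * ((2 * Real.exp (x + 3 / 4 * z) * τ) * Real.exp (-z)) *
      Real.exp ((x + y) / 2 - z) := by
      gcongr
      exact min_le_left _ _
    refine this.trans ?_
    have e : Real.exp (-(5 / 4 + 3 * η) * (x + y)) * ((2 * Real.exp (x + 3 / 4 * z) * τ) * Real.exp (-z)) *
      Real.exp ((x + y) / 2 - z) = 2 * (Real.exp (-(5 / 4 + 3 * η) * (x + y) + (x + 3 / 4 * z) + -z +
        ((x + y) / 2 - z)) * τ) := by
      simp only [Real.exp_add]; ring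
    have e2 : Real.exp (-(5 / 4 + 3 * η) * (x + y) + (x + 3 / 4 * z) + -z +
        ((x + y) / 2 - z)) * τ ≤ E1 := by
      rw [hE1, ← Real.exp_add]
      refine mul_le_mul_of_nonneg_right (Real.exp_le_exp.2 ?_) (by positivity)
      nlinarith [mul_nonneg hη.le hx, mul_nonneg hη.le hy]
    rw [e]
    linarith
  · push Not at c1
    by_cases c2 : x ≤ z
    · have hW := hW1 c2
      have : Real.exp (-(5 / 4 + 3 * η) * (x + y)) * (k * Real.exp (-z)) *
        min (Real.exp ((x + y) / 2 - z)) (Real.exp ((1 / 2 + 4 * η) * ((x + y) / 2 - z))) ≤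
        Real.exp (-(5 / 4 + 3 * η) * (x + y)) * ((Real.exp (z - x / 2) +
          Real.exp (-(z - x / 2)) * k ^ 2) * Real.exp (-z)) *
        Real.exp ((x + y) / 2 - z) := by
        gcongr
        · exact amgm _
        · exact min_le_left _ _
      refine this.trans ?_
      have e : Real.exp (-(5 / 4 + 3 * η) * (x + y)) * ((Real.exp (z - x / 2) +
          Real.exp (-(z - x / 2)) * k ^ 2) * Real.exp (-z)) *
          Real.exp ((x + y) / 2 - z) =
          Real.exp (-(5 / 4 + 3 * η) * (x + y) + (z - x / 2) + -z + ((x + y) / 2 - z)) +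
          Real.exp (-(5 / 4 + 3 * η) * (x + y) + -(z - x / 2) + -z + ((x + y) / 2 - z)) * k ^ 2 := by
        simp only [Real.exp_add]; ring
      have e2 : Real.exp (-(5 / 4 + 3 * η) * (x + y) + (z - x / 2) + -z + ((x + y) / 2 - z)) ≤ Ea := by
        rw [hEa, ← Real.exp_add]
        apply Real.exp_le_exp.2
        nlinarith [mul_nonneg hη.le hx, mul_nonneg hη.le hy, mul_pos hη (sub_pos.2 c1)]
      have e3 : Real.exp (-(5 / 4 + 3 * η) * (x + y) + -(z - x / 2) + -z + ((x + y) / 2 - z)) * k ^ 2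
          ≤ Eb := by
        rw [hEb, ← Real.exp_add, hW, one_mul]
        refine mul_le_mul_of_nonneg_right (Real.exp_le_exp.2 ?_) (by positivity)
        nlinarith [mul_nonneg hη.le hx, mul_nonneg hη.le hy, mul_pos hη (sub_pos.2 c1)]
      rw [e]
      linarith
    · push Not at c2
      have hW := hW2 c2
      have : Real.exp (-(5 / 4 + 3 * η) * (x + y)) * (k * Real.exp (-z)) *
        min (Real.exp ((x + y) / 2 - z)) (Real.exp ((1 / 2 + 4 * η) * ((x + y) / 2 - z))) ≤
        Real.exp (-(5 / 4 + 3 * η) * (x + y)) * ((Real.exp (z / 2) +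
          Real.exp (-(z / 2)) * k ^ 2) * Real.exp (-z)) *
        Real.exp ((1 / 2 + 4 * η) * ((x + y) / 2 - z)) := by
        gcongr
        · exact amgm _
        · exact min_le_right _ _
      refine this.trans ?_
      have e : Real.exp (-(5 / 4 + 3 * η) * (x + y)) * ((Real.exp (z / 2) +
          Real.exp (-(z / 2)) * k ^ 2) * Real.exp (-z)) *
          Real.exp ((1 / 2 + 4 * η) * ((x + y) / 2 - z)) =
          Real.exp (-(1 + η) * (x + y) + -(1 + 4 * η) * z) +
          Real.exp (-(1 + η) * x) * (Real.exp (-(1 + η) * y + -(2 + 4 * η) * z) * k ^ 2) := by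
        have a1 : -(1 + η) * (x + y) + -(1 + 4 * η) * z = -(5 / 4 + 3 * η) * (x + y) + z / 2 + -z +
          (1 / 2 + 4 * η) * ((x + y) / 2 - z) := by ring
        have a2 : Real.exp (-(1 + η) * x) * (Real.exp (-(1 + η) * y + -(2 + 4 * η) * z) * k ^ 2) =
          Real.exp (-(5 / 4 + 3 * η) * (x + y) + -(z / 2) + -z +
          (1 / 2 + 4 * η) * ((x + y) / 2 - z)) * k ^ 2 := by
          rw [← mul_assoc, ← Real.exp_add]
          congr 2
          ring
        rw [a1, a2]
        simp only [Real.exp_add]; ring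
      have e2 : Real.exp (-(1 + η) * (x + y) + -(1 + 4 * η) * z) ≤ Ea := by
        rw [hEa, ← Real.exp_add]
        apply Real.exp_le_exp.2
        nlinarith [mul_nonneg hη.le hz]
      have e3 : Real.exp (-(1 + η) * x) * (Real.exp (-(1 + η) * y + -(2 + 4 * η) * z) * k ^ 2)
          ≤ 4 * Eb := by
        calc _ ≤ (4 * (Real.exp (-(1 + η) * z) * W)) *
              (Real.exp (-(1 + η) * y + -(2 + 4 * η) * z) * k ^ 2) := by gcongr
          _ = 4 * (Real.exp (-(1 + η) * z + (-(1 + η) * y + -(2 + 4 * η) * z)) * (W * k ^ 2)) := by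
              rw [Real.exp_add (-(1 + η) * z)]; ring
          _ ≤ _ := by
              rw [hEb, ← Real.exp_add]
              refine mul_le_mul_of_nonneg_left (mul_le_mul_of_nonneg_right (Real.exp_le_exp.2 ?_) (by positivity)) (by norm_num)
              nlinarith [mul_nonneg hη.le hz]
      rw [e]
      linarith

theorem summ_pow (e : ℝ) (he : 1 < e) : Summable fun m : ℕ => ((m : ℝ) + 1) ^ (-e) := by
  have := (summable_nat_add_iff 1).2 (Real.summable_nat_rpow.2 (by linarith : -e < -1))
  simpa using this

theorem summ_tau : Summable fun c : ℕ => ((c : ℝ) + 1) ^ (-(9 / 8 : ℝ)) * ((c + 1).divisors.card : ℝ) := by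
  have hz : LSeriesSummable (fun n => ((ArithmeticFunction.zeta : ArithmeticFunction ℂ)) n) (9 / 8 : ℂ) :=
    ArithmeticFunction.LSeriesSummable_zeta_iff.2 (by norm_num)
  have h := (ArithmeticFunction.LSeriesSummable_mul hz hz).norm
  have h2 := (summable_nat_add_iff 1).2 h
  refine h2.congr fun c => ?_
  rw [LSeries.term_of_ne_zero (by omega), norm_div, ArithmeticFunction.coe_mul_zeta_apply]
  have : ∑ i ∈ (c + 1).divisors, (ArithmeticFunction.zeta : ArithmeticFunction ℂ) i =
      ((c + 1).divisors.card : ℂ) := by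
    rw [← nsmul_one, ← Finset.sum_const]
    refine Finset.sum_congr rfl fun i hi => ?_
    have : i ≠ 0 := (Nat.pos_of_mem_divisors hi).ne'
    simp [this]
  rw [this, Complex.norm_natCast, Complex.norm_natCast_cpow_of_pos (by omega), Real.rpow_neg (by positivity)]
  norm_num
  field_simp

theorem summ3 (f g h : ℕ → ℝ) (hf : Summable f) (hg : Summable g) (hh : Summable h)
    (f0 : ∀ n, 0 ≤ f n) (g0 : ∀ n, 0 ≤ g n) (h0 : ∀ n, 0 ≤ h n) :
    Summable fun t : ℕ × ℕ × ℕ => f t.1 * (g t.2.1 * h t.2.2) :=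
  hf.mul_of_nonneg (hg.mul_of_nonneg hh g0 h0) f0 (fun t => mul_nonneg (g0 _) (h0 _))

noncomputable def kk (u : ∀ c : ℕ, (ZMod (c + 1))ˣ) (m n c : ℕ) : ℝ :=
  ‖KZ (((u c : (ZMod (c + 1))ˣ) : ZMod (c + 1)) * ((m + 1 : ℕ) : ZMod (c + 1)))
    ((n + 1 : ℕ) : ZMod (c + 1))‖

theorem kk_symm (u : ∀ c : ℕ, (ZMod (c + 1))ˣ) (m n c : ℕ) : kk u m n c = kk u n m c := by
  unfold kk
  rw [KZ_unit, KZ_symm]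

theorem kk_bound (u : ∀ c : ℕ, (ZMod (c + 1))ˣ) (m n c : ℕ) :
    kk u m n c ≤ 2 * ((m : ℝ) + 1) * (((c : ℝ) + 1) ^ (3 / 4 : ℝ) * ((c + 1).divisors.card : ℝ)) := by
  unfold kk
  rw [KZ_unit]
  have := KZ_bound (c + 1) (m + 1) (by omega)
    (((u c : (ZMod (c + 1))ˣ) : ZMod (c + 1)) * ((n + 1 : ℕ) : ZMod (c + 1)))
  push_cast at this ⊢
  exact this

theorem kk_second (u : ∀ c : ℕ, (ZMod (c + 1))ˣ) (n c : ℕ) :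
    ∑ r : Fin (c + 1), kk u r n c ^ 2 ≤ ((c : ℝ) + 1) ^ 2 := by
  have h := second_moment (c := c + 1) ((n + 1 : ℕ) : ZMod (c + 1))
  have e : ∑ r : Fin (c + 1), kk u r n c ^ 2 =
      ∑ x : ZMod (c + 1), ‖KZ x ((n + 1 : ℕ) : ZMod (c + 1))‖ ^ 2 := by
    rw [Fin.sum_univ_eq_sum_range (fun r => kk u r n c ^ 2), ← Equiv.sum_comp (Units.mulLeft (u c)),
      ← Equiv.sum_comp (Equiv.addRight (1 : ZMod (c + 1)))]
    refine Finset.sum_nbij' (fun k => (k : ZMod (c + 1))) (fun x => x.val) ?_ ?_ ?_ ?_ ?_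
    · simp
    · intro x _; simp only [Finset.mem_range]; exact ZMod.val_lt x
    · intro k hk; simp only [ZMod.val_natCast]; exact Nat.mod_eq_of_lt (Finset.mem_range.1 hk)
    · intro x _; simp
    · intro k _
      simp [kk]
  rw [e]
  push_cast at h ⊢
  exact h

theorem summ_abs (A : ℕ × ℕ → ℝ) (B : ℕ × ℕ → ℕ → ℝ) (S : ℕ × ℕ → ℝ) (hA : ∀ a, 0 ≤ A a)
    (hB : ∀ a m, 0 ≤ B a m) (h : ∀ a, HasSum (B a) (S a)) (hs : Summable fun a => A a * S a) :
    Summable fun t : ℕ × (ℕ × ℕ) => A t.2 * B t.2 t.1 := by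
  have key : Summable fun t : (ℕ × ℕ) × ℕ => A t.1 * B t.1 t.2 := by
    refine (summable_prod_of_nonneg (fun t => mul_nonneg (hA _) (hB _ _))).2
      ⟨fun a => ((h a).mul_left (A a)).summable, ?_⟩
    refine hs.congr fun a => ?_
    exact ((h a).mul_left (A a)).tsum_eq.symm
  exact (Equiv.prodComm ℕ (ℕ × ℕ)).summable_iff.2 key

theorem summ_b (u : ∀ c : ℕ, (ZMod (c + 1))ˣ) (η : ℝ) (hη : 0 < η) :
    Summable fun t : ℕ × ℕ × ℕ => ((t.2.1 : ℝ) + 1) ^ (-(1 + η)) * ((t.2.2 : ℝ) + 1) ^ (-(3 + η / 24)) *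
      ((((t.1 / (t.2.2 + 1) : ℕ) : ℝ) + 1) ^ (-(1 + η)) * kk u t.1 t.2.1 t.2.2 ^ 2) := by
  set Wf : ℕ → ℝ := fun j => ((j : ℝ) + 1) ^ (-(1 + η)) with hWf
  have hW : Summable Wf := summ_pow _ (by linarith)
  have hW0 : ∀ j, 0 ≤ Wf j := fun j => by positivity
  have inner : ∀ n c : ℕ, HasSum (fun m : ℕ => Wf (m / (c + 1)) * kk u m n c ^ 2)
      ((∑' j, Wf j) * ∑ r : Fin (c + 1), kk u r n c ^ 2) := by
    intro n c
    rw [← (Nat.divModEquiv (c + 1)).symm.hasSum_iff]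
    have h1 : HasSum (fun r : Fin (c + 1) => kk u r n c ^ 2) (∑ r : Fin (c + 1), kk u r n c ^ 2) :=
      hasSum_fintype _
    have h2 := hW.hasSum.mul h1 (hW.mul_of_nonneg h1.summable hW0 (fun _ => by positivity))
    have hfe : (fun m : ℕ => Wf (m / (c + 1)) * kk u m n c ^ 2) ∘ (Nat.divModEquiv (c + 1)).symm =
        fun x : ℕ × Fin (c + 1) => Wf x.1 * kk u x.2 n c ^ 2 := by
     funext x
     obtain ⟨j, r⟩ := x
     simp only [Function.comp, Nat.divModEquiv_symm_apply]
     have a1 : (j * (c + 1) + (r : ℕ)) / (c + 1) = j := by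
       rw [mul_comm, Nat.mul_add_div (by omega), Nat.div_eq_of_lt r.2, add_zero]
     have a2 : (((j * (c + 1) + (r : ℕ)) + 1 : ℕ) : ZMod (c + 1)) = ((r + 1 : ℕ) : ZMod (c + 1)) := by
       have : ((c + 1 : ℕ) : ZMod (c + 1)) = 0 := ZMod.natCast_self _
       rw [add_assoc, Nat.cast_add, Nat.cast_mul, this]; simp
     rw [a1]
     unfold kk
     rw [a2]
    rw [hfe]
    exact h2
  have k1 : Summable fun a : ℕ × ℕ => (((a.1 : ℝ) + 1) ^ (-(1 + η)) * ((a.2 : ℝ) + 1) ^ (-(3 + η / 24))) *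
        ((∑' j, Wf j) * ∑ r : Fin (a.2 + 1), kk u r a.1 a.2 ^ 2) := by
    have hs : Summable fun a : ℕ × ℕ => (∑' j, Wf j) * (((a.1 : ℝ) + 1) ^ (-(1 + η)) *
        ((a.2 : ℝ) + 1) ^ (-(1 + η / 24))) :=
      ((summ_pow (1 + η) (by linarith)).mul_of_nonneg (summ_pow (1 + η / 24) (by linarith))
        (fun _ => by positivity) (fun _ => by positivity)).mul_left _
    have hZ : 0 ≤ ∑' j, Wf j := tsum_nonneg hW0
    refine Summable.of_nonneg_of_le (fun a => ?_) (fun a => ?_) hs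
    · have : 0 ≤ ∑ r : Fin (a.2 + 1), kk u r a.1 a.2 ^ 2 := Finset.sum_nonneg fun _ _ => by positivity
      positivity
    · have hp : ((a.2 : ℝ) + 1) ^ (-(1 + η / 24)) =
          ((a.2 : ℝ) + 1) ^ (-(3 + η / 24)) * ((a.2 : ℝ) + 1) ^ 2 := by
        rw [← Real.rpow_natCast, ← Real.rpow_add (by positivity)]
        congr 1
        push_cast; ring
      rw [hp]
      calc _ ≤ ((a.1 : ℝ) + 1) ^ (-(1 + η)) * ((a.2 : ℝ) + 1) ^ (-(3 + η / 24)) *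
        ((∑' j, Wf j) * ((a.2 : ℝ) + 1) ^ 2) := by
            gcongr
            exact kk_second u a.1 a.2
        _ = _ := by ring
  exact summ_abs (fun a => ((a.1 : ℝ) + 1) ^ (-(1 + η)) * ((a.2 : ℝ) + 1) ^ (-(3 + η / 24)))
    (fun a m => Wf (m / (a.2 + 1)) * kk u m a.1 a.2 ^ 2) _
    (fun a => mul_nonneg (Real.rpow_nonneg (by positivity) _) (Real.rpow_nonneg (by positivity) _))
    (fun a m => mul_nonneg (hW0 _) (sq_nonneg _)) (fun a => inner a.1 a.2) k1

noncomputable def gg (u : ∀ c : ℕ, (ZMod (c + 1))ˣ) (η : ℝ) (t : ℕ × ℕ × ℕ) : ℝ :=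
  (((t.1 : ℝ) + 1) * ((t.2.1 : ℝ) + 1)) ^ (-(5 / 4 + 3 * η)) * (kk u t.1 t.2.1 t.2.2 / ((t.2.2 : ℝ) + 1)) *
    min (Real.sqrt (((t.1 : ℝ) + 1) * ((t.2.1 : ℝ) + 1)) / ((t.2.2 : ℝ) + 1))
      ((Real.sqrt (((t.1 : ℝ) + 1) * ((t.2.1 : ℝ) + 1)) / ((t.2.2 : ℝ) + 1)) ^ (1 / 2 + 4 * η))

theorem gg_half_le (u : ∀ c : ℕ, (ZMod (c + 1))ˣ) (η : ℝ) (hη : 0 < η) (hη8 : η ≤ 1 / 8)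
    (m n c : ℕ) (hnm : n ≤ m) : gg u η (m, n, c) ≤
    4 * (((m : ℝ) + 1) ^ (-2 : ℝ) * (((n : ℝ) + 1) ^ (-2 : ℝ) *
        (((c : ℝ) + 1) ^ (-(9 / 8 : ℝ)) * ((c + 1).divisors.card : ℝ))) +
      ((m : ℝ) + 1) ^ (-(1 + η)) * (((n : ℝ) + 1) ^ (-(1 + η)) * ((c : ℝ) + 1) ^ (-(1 + η / 24))) +
      ((n : ℝ) + 1) ^ (-(1 + η)) * ((c : ℝ) + 1) ^ (-(3 + η / 24)) *
        ((((m / (c + 1) : ℕ) : ℝ) + 1) ^ (-(1 + η)) * kk u m n c ^ 2)) := by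
  have hx : Real.exp (Real.log ((m : ℝ) + 1)) = (m : ℝ) + 1 := Real.exp_log (by positivity)
  have hy : Real.exp (Real.log ((n : ℝ) + 1)) = (n : ℝ) + 1 := Real.exp_log (by positivity)
  have hz : Real.exp (Real.log ((c : ℝ) + 1)) = (c : ℝ) + 1 := Real.exp_log (by positivity)
  have hx0 : 0 ≤ Real.log ((m : ℝ) + 1) := Real.log_nonneg (by simp)
  have hy0 : 0 ≤ Real.log ((n : ℝ) + 1) := Real.log_nonneg (by simp)
  have hz0 : 0 ≤ Real.log ((c : ℝ) + 1) := Real.log_nonneg (by simp)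
  have hyx : Real.log ((n : ℝ) + 1) ≤ Real.log ((m : ℝ) + 1) := by
    apply Real.log_le_log (by positivity)
    have : (n : ℝ) ≤ m := by exact_mod_cast hnm
    linarith
  have hkb := kk_bound u m n c
  have hxz : Real.log ((m : ℝ) + 1) ≤ Real.log ((c : ℝ) + 1) ↔ m ≤ c := by
    rw [Real.log_le_log_iff (by positivity) (by positivity)]
    constructor
    · intro h
      have : (m : ℝ) ≤ c := by linarith
      exact_mod_cast this
    · intro h
      have : (m : ℝ) ≤ c := by exact_mod_cast h
      linarith
  have hMj : ((c : ℝ) + 1) * ((((m / (c + 1) : ℕ) : ℝ)) + 1) ≤ 2 * ((m : ℝ) + 1) ∨ m ≤ c := by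
    by_cases h : m ≤ c
    · exact Or.inr h
    · left
      have h1 : (c + 1) * (m / (c + 1)) ≤ m := Nat.mul_div_le _ _
      have h3 : (c + 1) * (m / (c + 1) + 1) ≤ 2 * (m + 1) := by
        rw [mul_add, mul_one]; omega
      exact_mod_cast h3
  have hjc : m ≤ c → m / (c + 1) = 0 := fun h => Nat.div_eq_of_lt (by omega)
  unfold gg
  simp only
  set X := Real.log ((m : ℝ) + 1)
  set Y := Real.log ((n : ℝ) + 1)
  set Z := Real.log ((c : ℝ) + 1)
  set k := kk u m n c with hkdef
  have hk0 : 0 ≤ k := norm_nonneg _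
  set W : ℝ := (((m / (c + 1) : ℕ) : ℝ) + 1) ^ (-(1 + η)) with hWdef
  have hτ : (1 : ℝ) ≤ ((c + 1).divisors.card : ℝ) := by
    exact_mod_cast Finset.card_pos.2 ⟨1, Nat.one_mem_divisors.2 (by omega)⟩
  have hW1 : X ≤ Z → W = 1 := by
    intro h
    rw [hWdef, hjc (hxz.1 h)]; simp
  have hW2 : Z < X → Real.exp (-(1 + η) * X) ≤ 4 * (Real.exp (-(1 + η) * Z) * W) := by
    intro h
    have hmc : ¬ m ≤ c := fun h' => absurd (hxz.2 h') (not_le.2 h)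
    have h1 := hMj.resolve_right hmc
    have r1 : Real.exp (-(1 + η) * X) = ((m : ℝ) + 1) ^ (-(1 + η)) := by
      rw [mul_comm, Real.exp_mul, hx]
    have r2 : Real.exp (-(1 + η) * Z) = ((c : ℝ) + 1) ^ (-(1 + η)) := by
      rw [mul_comm, Real.exp_mul, hz]
    rw [r1, r2, hWdef, ← Real.mul_rpow (by positivity) (by positivity)]
    have h2 : (2 * ((m : ℝ) + 1)) ^ (-(1 + η)) ≤
        (((c : ℝ) + 1) * ((((m / (c + 1) : ℕ) : ℝ)) + 1)) ^ (-(1 + η)) :=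
      Real.rpow_le_rpow_of_nonpos (by positivity) h1 (by linarith)
    rw [Real.mul_rpow (by norm_num) (by positivity)] at h2
    have h3 : (1 / 4 : ℝ) ≤ 2 ^ (-(1 + η)) := by
      calc (1 / 4 : ℝ) = 2 ^ (-2 : ℝ) := by
            rw [Real.rpow_neg (by norm_num)]; norm_num
        _ ≤ _ := Real.rpow_le_rpow_of_exponent_le (by norm_num) (by linarith)
    have h4 : 0 ≤ ((m : ℝ) + 1) ^ (-(1 + η)) := by positivity
    nlinarith
  have main := core_pt X Y Z η k _ W hy0 hyx hz0 hη hη8 hk0 hτ (by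
    refine hkb.trans (le_of_eq ?_)
    rw [Real.exp_add, mul_comm (3 / 4 : ℝ), Real.exp_mul, hx, hz]
    ring) (by positivity) hW1 hW2
  have q : ∀ a b : ℝ, Real.exp (a * b) = (Real.exp b) ^ a := fun a b => by
    rw [mul_comm, Real.exp_mul]
  have hsq : Real.exp ((X + Y) / 2 - Z) = Real.sqrt (((m : ℝ) + 1) * ((n : ℝ) + 1)) / ((c : ℝ) + 1) := by
    rw [Real.exp_sub, hz, Real.exp_half, Real.exp_add, hx, hy]
  rw [q _ (X + Y), q _ ((X + Y) / 2 - Z), hsq, q _ (X + Y), q _ Z, q _ (X + Y), q _ Z, q _ Y, q _ Z,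
    Real.exp_neg, Real.exp_add, hx, hy, hz] at main
  rw [Real.mul_rpow (by positivity) (by positivity) (z := -2),
    Real.mul_rpow (by positivity) (by positivity) (z := -(1 + η))] at main
  rw [div_eq_mul_inv k]
  refine main.trans (le_of_eq ?_)
  ring

theorem gg_nonneg (u : ∀ c : ℕ, (ZMod (c + 1))ˣ) (η : ℝ) (t) : 0 ≤ gg u η t := by
  have : ∀ m n c, 0 ≤ kk u m n c := fun _ _ _ => norm_nonneg _
  have := this t.1 t.2.1 t.2.2
  unfold gg
  positivity

theorem gg_symm (u : ∀ c : ℕ, (ZMod (c + 1))ˣ) (η : ℝ) (m n c : ℕ) :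
    gg u η (m, n, c) = gg u η (n, m, c) := by
  unfold gg
  simp only
  rw [kk_symm, mul_comm ((m : ℝ) + 1)]

def swapE : ℕ × ℕ × ℕ ≃ ℕ × ℕ × ℕ where
  toFun t := (t.2.1, t.1, t.2.2)
  invFun t := (t.2.1, t.1, t.2.2)
  left_inv _ := rfl
  right_inv _ := rfl

theorem sym_summable (g b : ℕ × ℕ × ℕ → ℝ) (g0 : ∀ t, 0 ≤ g t)
    (gs : ∀ m n c, g (m, n, c) = g (n, m, c)) (hb : ∀ m n c, n ≤ m → g (m, n, c) ≤ b (m, n, c))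
    (b0 : ∀ t, 0 ≤ b t) (sb : Summable b) : Summable g := by
  have hh2 : Summable (b ∘ swapE) := swapE.summable_iff.2 sb
  refine Summable.of_nonneg_of_le g0 (fun t => ?_) (sb.add hh2)
  obtain ⟨m, n, c⟩ := t
  have e : (b ∘ swapE) (m, n, c) = b (n, m, c) := rfl
  rw [e]
  have b1 := b0 (m, n, c)
  have b2 := b0 (n, m, c)
  rcases le_total n m with h | h
  · have := hb m n c h
    linarith
  · have := hb n m c h
    have := gs m n c
    linarith

theorem gg_summable (u : ∀ c : ℕ, (ZMod (c + 1))ˣ) (η : ℝ) (hη : 0 < η) (hη8 : η ≤ 1 / 8) :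
    Summable (gg u η) := by
  have h1 : ∀ (a : ℕ) (b : ℝ), 0 ≤ ((a : ℝ) + 1) ^ b := fun a b => Real.rpow_nonneg (by positivity) _
  have s1 := summ3 (fun m : ℕ => ((m : ℝ) + 1) ^ (-2 : ℝ)) (fun m : ℕ => ((m : ℝ) + 1) ^ (-2 : ℝ))
    (fun c : ℕ => ((c : ℝ) + 1) ^ (-(9 / 8 : ℝ)) * ((c + 1).divisors.card : ℝ))
    (summ_pow 2 (by norm_num)) (summ_pow 2 (by norm_num)) summ_tau
    (fun _ => h1 _ _) (fun _ => h1 _ _) (fun _ => mul_nonneg (h1 _ _) (Nat.cast_nonneg _))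
  have s2 := summ3 (fun m : ℕ => ((m : ℝ) + 1) ^ (-(1 + η))) (fun m : ℕ => ((m : ℝ) + 1) ^ (-(1 + η)))
    (fun m : ℕ => ((m : ℝ) + 1) ^ (-(1 + η / 24)))
    (summ_pow (1 + η) (by linarith)) (summ_pow (1 + η) (by linarith))
    (summ_pow (1 + η / 24) (by linarith))
    (fun _ => h1 _ _) (fun _ => h1 _ _) (fun _ => h1 _ _)
  have s3 := summ_b u η hη
  have s := ((s1.add s2).add s3).mul_left 4
  refine sym_summable (gg u η) _ (gg_nonneg u η) (gg_symm u η) ?_ ?_ s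
  · intro m n c h
    exact gg_half_le u η hη hη8 m n c h
  · intro t
    obtain ⟨m, n, c⟩ := t
    exact mul_nonneg (by norm_num) (add_nonneg (add_nonneg
          (mul_nonneg (h1 _ _) (mul_nonneg (h1 _ _) (mul_nonneg (h1 _ _) (Nat.cast_nonneg _))))
          (mul_nonneg (h1 _ _) (mul_nonneg (h1 _ _) (h1 _ _))))
          (mul_nonneg (mul_nonneg (h1 _ _) (h1 _ _)) (mul_nonneg (h1 _ _) (sq_nonneg _))))

theorem min_lem (X θ : ℝ) (hX : 0 < X) (h1 : -2 ≤ θ) (h2 : θ ≤ 1) : min X (X ^ (-2 : ℝ)) ≤ X ^ θ := by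
  rcases le_total X 1 with h | h
  · refine (min_le_left _ _).trans ?_
    calc X = X ^ (1 : ℝ) := (Real.rpow_one X).symm
      _ ≤ X ^ θ := Real.rpow_le_rpow_of_exponent_ge hX h h2
  · exact (min_le_right _ _).trans (Real.rpow_le_rpow_of_exponent_le h h1)

theorem min_lem2 (κ Y θ : ℝ) (hκ : 0 < κ) (hY : 0 < Y) (h1 : -2 ≤ θ) (h2 : θ ≤ 1) :
    min (κ * Y) ((κ * Y) ^ (-2 : ℝ)) ≤ (κ + κ ^ θ) * min Y (Y ^ θ) := by
  have hk : 0 ≤ κ ^ θ := by positivity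
  have hy : 0 ≤ Y ^ θ := by positivity
  rw [mul_min_of_nonneg _ _ (by positivity)]
  refine le_min ?_ ?_
  · refine (min_le_left _ _).trans ?_
    nlinarith [mul_nonneg hk hY.le]
  · refine (min_lem (κ * Y) θ (by positivity) h1 h2).trans ?_
    rw [Real.mul_rpow hκ.le hY.le]
    nlinarith [mul_nonneg hκ.le hy]

theorem pt_bound (K η σ C k x1 x2 y ph M N μ c Q : ℝ) (hη : 0 < η) (hη8 : η ≤ 1 / 8)
    (hσ : 5 / 4 + 4 * η ≤ σ) (hM : 1 ≤ M) (hN : 1 ≤ N) (hμ : 1 ≤ μ) (hc : 1 ≤ c) (hQ : 1 ≤ Q) (hC : 0 < C)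
    (hK : 0 ≤ K) (hk : 0 ≤ k) (h10 : 0 ≤ x1) (h20 : 0 ≤ x2) (h1 : x1 ≤ K * M ^ η) (h2 : x2 ≤ K * N ^ η)
    (hy : y = (M * N) ^ (-σ)) (hph0 : 0 ≤ ph)
    (hph : ph ≤ C * min (4 * Real.pi * Real.sqrt (M * N * μ) / (c * Real.sqrt Q))
      ((4 * Real.pi * Real.sqrt (M * N * μ) / (c * Real.sqrt Q)) ^ (-2 : ℝ))) :
    x1 * x2 * y * (k / (c * Real.sqrt Q)) * ph ≤
    (K ^ 2 * μ ^ (5 / 4 + 3 * η) / Real.sqrt Q * C *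
      ((4 * Real.pi / Real.sqrt Q) + (4 * Real.pi / Real.sqrt Q) ^ (1 / 2 + 4 * η))) *
    ((M * (μ * N)) ^ (-(5 / 4 + 3 * η)) * (k / c) *
      min (Real.sqrt (M * (μ * N)) / c) ((Real.sqrt (M * (μ * N)) / c) ^ (1 / 2 + 4 * η))) := by
  have hsQ : 0 < Real.sqrt Q := Real.sqrt_pos.2 (by linarith)
  have hMNμ : 0 < M * (μ * N) := by positivity
  have hY : 0 < Real.sqrt (M * (μ * N)) / c := div_pos (Real.sqrt_pos.2 hMNμ) (by linarith)
  have hX : 4 * Real.pi * Real.sqrt (M * N * μ) / (c * Real.sqrt Q) =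
      (4 * Real.pi / Real.sqrt Q) * (Real.sqrt (M * (μ * N)) / c) := by
    rw [show M * N * μ = M * (μ * N) by ring]
    field_simp
  have hκ : 0 < 4 * Real.pi / Real.sqrt Q := by positivity
  rw [hX] at hph
  have hm := min_lem2 _ _ (1 / 2 + 4 * η) hκ hY (by linarith) (by linarith)
  set Y := Real.sqrt (M * (μ * N)) / c with hYd
  set κ := 4 * Real.pi / Real.sqrt Q with hκd
  set mn := min Y (Y ^ (1 / 2 + 4 * η)) with hmn
  have hmn0 : 0 ≤ mn := le_min hY.le (by positivity)
  have hph2 : ph ≤ C * ((κ + κ ^ (1 / 2 + 4 * η)) * mn) :=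
    hph.trans (mul_le_mul_of_nonneg_left hm hC.le)
  have hyy : x1 * x2 * y ≤ K ^ 2 * (μ ^ (5 / 4 + 3 * η) * (M * (μ * N)) ^ (-(5 / 4 + 3 * η))) := by
    have e1 : μ ^ (5 / 4 + 3 * η) * (M * (μ * N)) ^ (-(5 / 4 + 3 * η)) = (M * N) ^ (-(5 / 4 + 3 * η)) := by
      rw [show M * (μ * N) = μ * (M * N) by ring, Real.mul_rpow (by linarith) (by positivity), ← mul_assoc,
        ← Real.rpow_add (by linarith)]
      simp
    rw [e1]
    calc x1 * x2 * y ≤ (K * M ^ η) * (K * N ^ η) * (M * N) ^ (-σ) := by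
          rw [hy]
          gcongr
      _ = K ^ 2 * (M * N) ^ (η + -σ) := by
          rw [Real.rpow_add (by positivity), Real.mul_rpow (by linarith) (by linarith) (z := η)]; ring
      _ ≤ _ := by
          refine mul_le_mul_of_nonneg_left (Real.rpow_le_rpow_of_exponent_le ?_ (by linarith)) (by positivity)
          nlinarith
  have hy0 : 0 ≤ x1 * x2 * y := by rw [hy]; positivity
  calc x1 * x2 * y * (k / (c * Real.sqrt Q)) * ph ≤
      (K ^ 2 * (μ ^ (5 / 4 + 3 * η) * (M * (μ * N)) ^ (-(5 / 4 + 3 * η)))) * (k / (c * Real.sqrt Q)) *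
        (C * ((κ + κ ^ (1 / 2 + 4 * η)) * mn)) := by
        gcongr
    _ = _ := by
        rw [← div_div]
        ring

theorem Kterm_summable (s : ℂ) (hs : 5 / 4 < s.re) (a : ℕ → ℂ)
    (haB : ∀ ε : ℝ, 0 < ε → ∃ Cε : ℝ, ∀ n : ℕ, 1 ≤ n → ‖a n‖ ≤ Cε * (n : ℝ) ^ ε)
    (φ : ℝ → ℂ) (C : ℝ) (hC : 0 < C)
    (hφ : ∀ x : ℝ, 0 < x → ‖φ x‖ ≤ C * min x (x ^ (-2 : ℝ)))
    (N₁ : ℕ) (inv : ℕ → ℤ) (μ Q : ℕ) (hμ : 0 < μ) (hQ : 0 < Q)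
    (hinv : ∀ c : ℕ, 1 ≤ c → Nat.Coprime c N₁ → (N₁ : ℤ) * inv c ≡ 1 [ZMOD (c : ℤ)] ∨
      ∃ N : ℤ, N * inv c ≡ 1 [ZMOD (c : ℤ)]) :
    Summable (fun t : ℕ × ℕ × ℕ => ‖Kterm a s φ N₁ inv μ Q t‖) := by
  obtain ⟨η, hη, hη8, hσ⟩ : ∃ η : ℝ, 0 < η ∧ η ≤ 1 / 8 ∧ 5 / 4 + 4 * η ≤ s.re :=
    ⟨min (1 / 8) ((s.re - 5 / 4) / 4), lt_min (by norm_num) (by linarith), min_le_left _ _, by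
      have := min_le_right (1 / 8 : ℝ) ((s.re - 5 / 4) / 4)
      linarith⟩
  obtain ⟨K, hKa⟩ := haB η hη
  have hK : 0 ≤ K := by
    have := (norm_nonneg _).trans (hKa 1 le_rfl)
    simpa using this
  have hu : ∀ c : ℕ, ∃ v : (ZMod (c + 1))ˣ, Nat.Coprime (c + 1) N₁ →
      (v : ZMod (c + 1)) = ((inv (c + 1) : ℤ) : ZMod (c + 1)) := by
    intro c
    by_cases h : Nat.Coprime (c + 1) N₁
    · have : ∃ N : ℤ, N * inv (c + 1) ≡ 1 [ZMOD ((c + 1 : ℕ) : ℤ)] := by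
        rcases hinv (c + 1) (by omega) h with h | h
        · exact ⟨_, h⟩
        · exact h
      obtain ⟨N, hN⟩ := this
      have h2 := (ZMod.intCast_eq_intCast_iff _ _ (c + 1)).2 hN
      push_cast at h2
      exact ⟨(Units.mkOfMulEqOne _ _ h2)⁻¹, fun _ => rfl⟩
    · exact ⟨1, fun h' => absurd h' h⟩
  choose u hu using hu
  have inj : Function.Injective (fun t : ℕ × ℕ × ℕ => (t.1, μ * (t.2.1 + 1) - 1, t.2.2)) := by
    rintro ⟨m, n, c⟩ ⟨m', n', c'⟩ h
    simp only [Prod.mk.injEq] at h ⊢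
    refine ⟨h.1, ?_, h.2.2⟩
    have p1 : 0 < μ * (n + 1) := by positivity
    have p2 : 0 < μ * (n' + 1) := by positivity
    have : μ * (n + 1) = μ * (n' + 1) := by omega
    have := Nat.eq_of_mul_eq_mul_left hμ this
    omega
  have S := ((gg_summable u η hη hη8).comp_injective inj).mul_left
    (K ^ 2 * (μ : ℝ) ^ (5 / 4 + 3 * η) / Real.sqrt Q * C *
      ((4 * Real.pi / Real.sqrt Q) + (4 * Real.pi / Real.sqrt Q) ^ (1 / 2 + 4 * η)))
  refine Summable.of_nonneg_of_le (fun t => norm_nonneg _) (fun t => ?_) S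
  obtain ⟨m, n, c⟩ := t
  have hgg := gg_nonneg u η (m, μ * (n + 1) - 1, c)
  by_cases h : Nat.Coprime (c + 1) N₁
  · have hcast : ((μ * (n + 1) - 1 : ℕ) : ℝ) + 1 = (μ : ℝ) * ((n : ℝ) + 1) := by
      have p1 : 1 ≤ μ * (n + 1) := Nat.mul_pos hμ (by omega)
      rw [Nat.cast_sub p1]; push_cast; ring
    have hk : ‖Kl (inv (c + 1) * (m + 1)) ((μ : ℤ) * (n + 1)) (c + 1)‖ = kk u m (μ * (n + 1) - 1) c := by
      have p1 : μ * (n + 1) - 1 + 1 = μ * (n + 1) := by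
        have p1 : 1 ≤ μ * (n + 1) := Nat.mul_pos hμ (by omega)
        omega
      rw [Kl_eq, kk, hu c h, p1]
      push_cast
      rfl
    have hpos : (0 : ℝ) < 4 * Real.pi * Real.sqrt (((m + 1) * (n + 1) * μ : ℕ)) /
          ((c + 1 : ℕ) * Real.sqrt Q) := by
      have : (0 : ℝ) < Real.sqrt Q := Real.sqrt_pos.2 (by exact_mod_cast hQ)
      have h2 : (0 : ℝ) < Real.sqrt (((m + 1) * (n + 1) * μ : ℕ)) :=
        Real.sqrt_pos.2 (by positivity)
      positivity
    have hph := hφ _ hpos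
    push_cast at hph
    have b := pt_bound K η s.re C (kk u m (μ * (n + 1) - 1) c) ‖a (m + 1)‖ ‖a (n + 1)‖
      ((((m : ℝ) + 1) * ((n : ℝ) + 1)) ^ (-s.re)) _ ((m : ℝ) + 1) ((n : ℝ) + 1) μ ((c : ℝ) + 1) Q
      hη hη8 hσ (by simp) (by simp) (by exact_mod_cast hμ) (by simp) (by exact_mod_cast hQ) hC hK
      (norm_nonneg _) (norm_nonneg _) (norm_nonneg _)
      (by simpa using hKa (m + 1) (by omega)) (by simpa using hKa (n + 1) (by omega)) rfl (norm_nonneg _)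
      hph
    have e : ‖Kterm a s φ N₁ inv μ Q (m, n, c)‖ = ‖a (m + 1)‖ * ‖a (n + 1)‖ *
        ((((m : ℝ) + 1) * ((n : ℝ) + 1)) ^ (-s.re)) *
        (kk u m (μ * (n + 1) - 1) c / (((c : ℝ) + 1) * Real.sqrt Q)) *
        ‖φ (4 * Real.pi * Real.sqrt (((m + 1) * (n + 1) * μ : ℕ)) /
          ((c + 1 : ℕ) * Real.sqrt Q))‖ := by
      unfold Kterm
      simp only
      rw [if_pos h, norm_mul, norm_mul, norm_mul, norm_mul, norm_div, hk,
        Complex.norm_natCast_cpow_of_pos (by positivity), norm_mul, Complex.norm_natCast, Complex.norm_real,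
        Real.norm_of_nonneg (Real.sqrt_nonneg _)]
      push_cast
      rfl
    rw [e]
    simp only [Function.comp, gg, hcast]
    push_cast at b ⊢
    exact b
  · have : Kterm a s φ N₁ inv μ Q (m, n, c) = 0 := by
      unfold Kterm
      exact if_neg h
    rw [this, norm_zero]
    exact mul_nonneg (by positivity) hgg

noncomputable def Gt (s : ℂ) (φ : ℝ → ℂ) (α : ℂ) (M N c : ℕ) (k : ℂ) (μ Q : ℕ) : ℂ :=
  α * ((M * N : ℕ) : ℂ) ^ (-s) * (k / ((c : ℂ) * (Real.sqrt Q : ℂ))) *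
    φ (4 * Real.pi * Real.sqrt ((M * N * μ : ℕ)) / (c * Real.sqrt Q))

theorem Kterm_Gt (a : ℕ → ℂ) (s : ℂ) (φ : ℝ → ℂ) (N₁ : ℕ) (inv : ℕ → ℤ) (μ Q : ℕ) (m n c : ℕ) :
    Kterm a s φ N₁ inv μ Q (m, n, c) = if Nat.Coprime (c + 1) N₁ then
      Gt s φ (a (m + 1) * a (n + 1)) (m + 1) (n + 1) (c + 1)
        (Kl (inv (c + 1) * ((m + 1 : ℕ) : ℤ)) ((μ : ℤ) * ((n + 1 : ℕ) : ℤ)) (c + 1)) μ Q else 0 := by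
  unfold Kterm Gt
  simp only
  push_cast
  rfl

theorem Gt_symm (s : ℂ) (φ : ℝ → ℂ) (α : ℂ) (M N c : ℕ) (k : ℂ) (μ Q : ℕ) :
    Gt s φ α M N c k μ Q = Gt s φ α N M c k μ Q := by
  unfold Gt
  rw [mul_comm M N]

theorem Gt_add (s : ℂ) (φ : ℝ → ℂ) (α β : ℂ) (M N c : ℕ) (k : ℂ) (μ Q : ℕ) :
    Gt s φ (α + β) M N c k μ Q = Gt s φ α M N c k μ Q + Gt s φ β M N c k μ Q := by
  unfold Gt
  ring

theorem Gt_smul (s : ℂ) (φ : ℝ → ℂ) (x α : ℂ) (M N c : ℕ) (k : ℂ) (μ Q : ℕ) :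
    Gt s φ (x * α) M N c k μ Q = x * Gt s φ α M N c k μ Q := by
  unfold Gt
  ring

theorem Gt_kadd (s : ℂ) (φ : ℝ → ℂ) (α : ℂ) (M N c : ℕ) (k l : ℂ) (μ Q : ℕ) :
    Gt s φ α M N c (k + l) μ Q = Gt s φ α M N c k μ Q + Gt s φ α M N c l μ Q := by
  unfold Gt
  ring

theorem Gt_k0 (s : ℂ) (φ : ℝ → ℂ) (α : ℂ) (M N c : ℕ) (μ Q : ℕ) :
    Gt s φ α M N c 0 μ Q = 0 := by
  unfold Gt
  ring

theorem Gt_1 (s : ℂ) (φ : ℝ → ℂ) (α : ℂ) (M N c : ℕ) (k : ℂ) (p Q : ℕ) :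
    Gt s φ α (p * M) N c k 1 Q = (p : ℂ) ^ (-s) * Gt s φ α M N c k p Q := by
  unfold Gt
  rw [show p * M * N * 1 = M * N * p by ring, show p * M * N = p * (M * N) by ring, Nat.cast_mul p,
    Complex.natCast_mul_natCast_cpow]
  ring

theorem Gt_2 (s : ℂ) (φ : ℝ → ℂ) (α : ℂ) (M N c : ℕ) (k : ℂ) (p q : ℕ) (hp : 0 < p) :
    Gt s φ α M N (p * c) k p q = ((Real.sqrt p : ℝ) : ℂ)⁻¹ * Gt s φ α M N c k 1 (p * q) := by
  unfold Gt
  have hp0 : (0 : ℝ) < Real.sqrt p := Real.sqrt_pos.2 (by exact_mod_cast hp)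
  have hpp : (p : ℝ) = Real.sqrt p * Real.sqrt p := (Real.mul_self_sqrt (by positivity)).symm
  have hpc : (p : ℂ) = ((Real.sqrt p : ℝ) : ℂ) * ((Real.sqrt p : ℝ) : ℂ) := by exact_mod_cast hpp
  have e : 4 * Real.pi * Real.sqrt ((M * N * p : ℕ)) / ((p * c : ℕ) * Real.sqrt q) =
      4 * Real.pi * Real.sqrt ((M * N * 1 : ℕ)) / (c * Real.sqrt ((p * q : ℕ))) := by
    rw [mul_one, Nat.cast_mul (M * N), Real.sqrt_mul (by positivity), Nat.cast_mul p q,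
      Real.sqrt_mul (by positivity), Nat.cast_mul p c]
    have : (p : ℝ) * c * Real.sqrt q = Real.sqrt p * (c * (Real.sqrt p * Real.sqrt q)) := by
      linear_combination (c * Real.sqrt q) * hpp
    rw [this, show 4 * Real.pi * (Real.sqrt ((M * N : ℕ)) * Real.sqrt p) =
      Real.sqrt p * (4 * Real.pi * Real.sqrt ((M * N : ℕ))) by ring, mul_div_mul_left _ _ hp0.ne']
  rw [e, Nat.cast_mul p q, Real.sqrt_mul (by positivity), Nat.cast_mul p c]
  have : (p : ℂ) * c * ((Real.sqrt q : ℝ) : ℂ) =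
      ((Real.sqrt p : ℝ) : ℂ) * ((c : ℂ) * ((Real.sqrt p * Real.sqrt q : ℝ) : ℂ)) := by
    push_cast
    linear_combination (c * ((Real.sqrt q : ℝ) : ℂ)) * hpc
  rw [this]
  rw [show ∀ x y : ℂ, k / (x * y) = x⁻¹ * (k / y) from fun x y => by
    rw [div_eq_mul_inv, div_eq_mul_inv, mul_inv]; ring]
  ring

theorem Gt_3 (s : ℂ) (φ : ℝ → ℂ) (α : ℂ) (M N c : ℕ) (k : ℂ) (p q : ℕ) (hp : 0 < p) :
    ((Real.sqrt p : ℝ) : ℂ)⁻¹ * Gt s φ α (p * M) N c (p * k) 1 (p * q) =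
    (p : ℂ) ^ (-s) * Gt s φ α M N c k 1 q := by
  rw [Gt_1]
  unfold Gt
  have hp0 : (0 : ℝ) < Real.sqrt p := Real.sqrt_pos.2 (by exact_mod_cast hp)
  have hpp : (p : ℝ) = Real.sqrt p * Real.sqrt p := (Real.mul_self_sqrt (by positivity)).symm
  have hpc : (p : ℂ) = ((Real.sqrt p : ℝ) : ℂ) * ((Real.sqrt p : ℝ) : ℂ) := by exact_mod_cast hpp
  have e : 4 * Real.pi * Real.sqrt ((M * N * p : ℕ)) / (c * Real.sqrt ((p * q : ℕ))) =
      4 * Real.pi * Real.sqrt ((M * N * 1 : ℕ)) / (c * Real.sqrt q) := by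
    rw [mul_one, Nat.cast_mul (M * N), Real.sqrt_mul (by positivity), Nat.cast_mul p q,
      Real.sqrt_mul (by positivity)]
    rw [show 4 * Real.pi * (Real.sqrt ((M * N : ℕ)) * Real.sqrt p) =
      Real.sqrt p * (4 * Real.pi * Real.sqrt ((M * N : ℕ))) by ring,
      show (c : ℝ) * (Real.sqrt p * Real.sqrt q) = Real.sqrt p * (c * Real.sqrt q) by ring,
      mul_div_mul_left _ _ hp0.ne']
  have hne : ((Real.sqrt p : ℝ) : ℂ) ≠ 0 := by exact_mod_cast hp0.ne'
  have e2 : ((Real.sqrt p : ℝ) : ℂ)⁻¹ * ((p * k) / ((c : ℂ) * ((Real.sqrt ((p * q : ℕ)) : ℝ) : ℂ))) =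
      k / (c * ((Real.sqrt q : ℝ) : ℂ)) := by
    rw [Nat.cast_mul p q, Real.sqrt_mul (by positivity), hpc, Complex.ofReal_mul]
    rw [show ((Real.sqrt p : ℝ) : ℂ) * ((Real.sqrt p : ℝ) : ℂ) * k =
        ((Real.sqrt p : ℝ) : ℂ) * (((Real.sqrt p : ℝ) : ℂ) * k) by ring,
      show (c : ℂ) * (((Real.sqrt p : ℝ) : ℂ) * ((Real.sqrt q : ℝ) : ℂ)) =
        ((Real.sqrt p : ℝ) : ℂ) * (c * ((Real.sqrt q : ℝ) : ℂ)) by ring, mul_div_mul_left _ _ hne,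
      mul_div_assoc, inv_mul_cancel_left₀ hne]
  rw [e, ← e2]
  ring

theorem Kl_congr (c : ℕ) (hc : 0 < c) (x x' n : ℤ) (h : x ≡ x' [ZMOD c]) : Kl x n c = Kl x' n c := by
  have : NeZero c := ⟨hc.ne'⟩
  rw [Kl_eq, Kl_eq, (ZMod.intCast_eq_intCast_iff _ _ c).2 h]

theorem Kl_flip (c : ℕ) (hc : 0 < c) (p M n i N : ℤ) (h : N * i ≡ 1 [ZMOD c]) :
    Kl (i * (p * M)) n c = Kl (i * n) (p * M) c := by
  have : NeZero c := ⟨hc.ne'⟩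
  have h2 := (ZMod.intCast_eq_intCast_iff _ _ c).2 h
  push_cast at h2
  rw [Kl_eq, Kl_eq]
  push_cast
  have e : ((i : ℤ) : ZMod c) = (((Units.mkOfMulEqOne _ _ h2)⁻¹ : (ZMod c)ˣ) : ZMod c) := rfl
  rw [e, KZ_unit, KZ_symm]

theorem zcong_unique (c N x y : ℤ) (hx : N * x ≡ 1 [ZMOD c]) (hy : N * y ≡ 1 [ZMOD c]) :
    x ≡ y [ZMOD c] := by
  have h1 := (hx.mul_right y).symm
  have h2 := hy.mul_right x
  have e : N * x * y = N * y * x := by ring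
  rw [e] at h1
  have := (h1.trans h2).symm
  simpa using this

theorem D_pt (p q : ℕ) (hp : p.Prime) (hq : q.Prime) (hpq : p ≠ q) (s : ℂ) (φ : ℝ → ℂ)
    (qinv pqinv : ℕ → ℤ)
    (hqinv : ∀ c : ℕ, 1 ≤ c → Nat.Coprime c q → (q : ℤ) * qinv c ≡ 1 [ZMOD (c : ℤ)])
    (hpqinv : ∀ c : ℕ, 1 ≤ c → Nat.Coprime c (p * q) →
      ((p * q : ℕ) : ℤ) * pqinv c ≡ 1 [ZMOD (c : ℤ)])
    (α : ℂ) (M N c : ℕ) (hc : 1 ≤ c) (hcq : Nat.Coprime c q) :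
    Gt s φ α M N (p * c) (Kl (qinv (p * c) * (M : ℤ)) ((p : ℤ) * (N : ℤ)) (p * c)) p q +
      ((Real.sqrt p : ℝ) : ℂ)⁻¹ * (if Nat.Coprime c (p * q) then
        Gt s φ α M N c (Kl (pqinv c * (M : ℤ)) (((1 : ℕ) : ℤ) * (N : ℤ)) c) 1 (p * q) else 0) =
    if p ∣ M then (p : ℂ) ^ (-s) * Gt s φ α (M / p) N c
      (Kl (qinv c * ((M / p : ℕ) : ℤ)) (((1 : ℕ) : ℤ) * (N : ℤ)) c) 1 q else 0 := by
  have hpcq : Nat.Coprime (p * c) q := Nat.Coprime.mul_left ((Nat.coprime_primes hp hq).2 hpq) hcq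
  have hpc1 : 1 ≤ p * c := Nat.mul_pos hp.pos hc
  have hi := hqinv (p * c) hpc1 hpcq
  have hic : (q : ℤ) * qinv (p * c) ≡ 1 [ZMOD (c : ℤ)] :=
    hi.of_dvd (by push_cast; exact Dvd.intro_left _ rfl)
  have hip : (q : ℤ) * qinv (p * c) ≡ 1 [ZMOD (p : ℤ)] :=
    hi.of_dvd (by push_cast; exact Dvd.intro _ rfl)
  obtain ⟨w, hw⟩ : ∃ w : ℤ, ¬ p ∣ c → (p : ℤ) * w ≡ 1 [ZMOD c] := by
    by_cases h : p ∣ c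
    · exact ⟨0, fun h' => absurd h h'⟩
    · obtain ⟨w, hw⟩ := Int.mod_coprime ((Nat.Prime.coprime_iff_not_dvd hp).2 h)
      exact ⟨w, fun _ => hw⟩
  have hdvd : (p : ℤ) ∣ qinv (p * c) * (M : ℤ) ↔ p ∣ M := by
    constructor
    · intro h
      have h1 : (p : ℤ) ∣ (q : ℤ) * qinv (p * c) * M := by
        rw [mul_assoc]; exact h.mul_left _
      have h2 := hip.mul_right (M : ℤ)
      have h3 := (Int.modEq_zero_iff_dvd.2 h1).symm.trans h2
      rw [one_mul] at h3
      exact Int.natCast_dvd_natCast.1 (Int.modEq_zero_iff_dvd.1 h3.symm)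
    · intro h
      exact (Int.natCast_dvd_natCast.2 h).mul_left _
  rw [Gt_2 s φ α M N c _ p q hp.pos, ← mul_add, Kl_p p c hp hc _ _ w hw, sub_eq_add_neg, Gt_kadd]
  have hT : Gt s φ α M N c (-(if p ∣ c then 0 else Kl (w * (qinv (p * c) * (M : ℤ))) N c)) 1 (p * q) +
      (if Nat.Coprime c (p * q) then
        Gt s φ α M N c (Kl (pqinv c * (M : ℤ)) (((1 : ℕ) : ℤ) * (N : ℤ)) c) 1 (p * q) else 0) = 0 := by
    by_cases h : p ∣ c
    · have hn : ¬ Nat.Coprime c (p * q) := fun h' =>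
        absurd (Nat.Coprime.coprime_mul_right_right h') (fun h'' =>
          (Nat.Prime.coprime_iff_not_dvd hp).1 h''.symm h)
      rw [if_pos h, if_neg hn, neg_zero, Gt_k0, add_zero]
    · have hn : Nat.Coprime c (p * q) :=
        Nat.Coprime.mul_right ((Nat.Prime.coprime_iff_not_dvd hp).2 h).symm hcq
      have hcong : w * qinv (p * c) ≡ pqinv c [ZMOD c] := by
        refine zcong_unique c ((p * q : ℕ) : ℤ) _ _ ?_ (hpqinv c hc hn)
        have := (hw h).mul hic
        push_cast
        have e : (p : ℤ) * w * (q * qinv (p * c)) = p * q * (w * qinv (p * c)) := by ring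
        rw [e] at this
        simpa using this
      rw [if_neg h, if_pos hn, ← Gt_kadd, ← mul_assoc,
        Kl_congr c hc _ _ N (hcong.mul_right (M : ℤ)), Nat.cast_one, one_mul, neg_add_cancel, Gt_k0]
  rw [add_assoc, hT, add_zero]
  by_cases h : p ∣ M
  · rw [if_pos h, if_pos (hdvd.2 h)]
    obtain ⟨M', rfl⟩ := h
    have e1 : qinv (p * c) * ((p * M' : ℕ) : ℤ) / (p : ℤ) = qinv (p * c) * (M' : ℤ) := by
      push_cast
      rw [show qinv (p * c) * ((p : ℤ) * M') = p * (qinv (p * c) * M') by ring]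
      exact Int.mul_ediv_cancel_left _ (by exact_mod_cast hp.ne_zero)
    rw [e1, Nat.mul_div_cancel_left _ hp.pos, Gt_3 s φ α M' N c _ p q hp.pos, Nat.cast_one, one_mul,
      Kl_congr c hc _ _ N ((zcong_unique c q _ _ hic (hqinv c hc hcq)).mul_right (M' : ℤ))]
  · rw [if_neg h, if_neg (fun h' => h (hdvd.1 h')), Gt_k0, mul_zero]

theorem shift_inj (p : ℕ) (hp : 0 < p) {x y : ℕ} (h : p * (x + 1) - 1 = p * (y + 1) - 1) : x = y := by
  have p1 : 0 < p * (x + 1) := by positivity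
  have p2 : 0 < p * (y + 1) := by positivity
  have : p * (x + 1) = p * (y + 1) := by omega
  have := Nat.eq_of_mul_eq_mul_left hp this
  omega

theorem shift_eq (p : ℕ) (hp : 0 < p) (x : ℕ) : p * (x + 1) - 1 + 1 = p * (x + 1) := by
  have p1 : 0 < p * (x + 1) := by positivity
  omega

theorem shift_surj (p : ℕ) {x : ℕ} (h : p ∣ x + 1) : ∃ y, p * (y + 1) - 1 = x := by
  obtain ⟨k, hk⟩ := h
  cases k with
  | zero => omega
  | succ k => exact ⟨k, by omega⟩

theorem trip (F : ℕ → ℕ → ℕ → ℂ) : ∃ A : ℕ × ℕ × ℕ → ℂ, ∀ m n c, A (m, n, c) = F m n c :=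
  ⟨fun t => F t.1 t.2.1 t.2.2, fun _ _ _ => rfl⟩

/-- Sieving identity: `(1 + p^{−2s})·R = 𝒮 − p^{−1/2}·T₂ + a(p)·p^{−s}·T₁`, where
`R, 𝒮, T₁, T₂` are the four absolutely convergent triple sums of Kloosterman sums. -/
theorem stmt_7 (p q : ℕ) (hp : p.Prime) (hq : q.Prime) (hpq : p ≠ q)
    (s : ℂ) (hs : 5 / 4 < s.re)
    (a : ℕ → ℂ)
    (ha : ∀ n : ℕ, 1 ≤ n → a n * a p = a (n * p) + (if p ∣ n then a (n / p) else 0))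
    (haB : ∀ ε : ℝ, 0 < ε → ∃ Cε : ℝ, ∀ n : ℕ, 1 ≤ n → ‖a n‖ ≤ Cε * (n : ℝ) ^ ε)
    (φ : ℝ → ℂ) (hφc : ContinuousOn φ (Set.Ioi 0))
    (C : ℝ) (hC : 0 < C)
    (hφ : ∀ x : ℝ, 0 < x → ‖φ x‖ ≤ C * min x (x ^ (-2 : ℝ)))
    (qinv pqinv : ℕ → ℤ)
    (hqinv : ∀ c : ℕ, 1 ≤ c → Nat.Coprime c q → (q : ℤ) * qinv c ≡ 1 [ZMOD (c : ℤ)])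
    (hpqinv : ∀ c : ℕ, 1 ≤ c → Nat.Coprime c (p * q) →
      ((p * q : ℕ) : ℤ) * pqinv c ≡ 1 [ZMOD (c : ℤ)]) :
    Summable (fun t : ℕ × ℕ × ℕ => ‖Kterm a s φ q qinv p q t‖) ∧
    Summable (fun t : ℕ × ℕ × ℕ => ‖Kterm a s φ (p * q) qinv p q t‖) ∧
    Summable (fun t : ℕ × ℕ × ℕ => ‖Kterm a s φ q qinv 1 q t‖) ∧
    Summable (fun t : ℕ × ℕ × ℕ => ‖Kterm a s φ (p * q) pqinv 1 (p * q) t‖) ∧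
    (1 + (p : ℂ) ^ (-(2 * s))) * ∑' t : ℕ × ℕ × ℕ, Kterm a s φ q qinv p q t
      = (∑' t : ℕ × ℕ × ℕ, Kterm a s φ (p * q) qinv p q t)
        - ((Real.sqrt p : ℂ))⁻¹ * ∑' t : ℕ × ℕ × ℕ, Kterm a s φ (p * q) pqinv 1 (p * q) t
        + a p * (p : ℂ) ^ (-s) * ∑' t : ℕ × ℕ × ℕ, Kterm a s φ q qinv 1 q t := by

  have hp0 := hp.pos
  have hq0 := hq.pos
  have sR : Summable (fun t : ℕ × ℕ × ℕ => ‖Kterm a s φ q qinv p q t‖) :=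
    Kterm_summable s hs a haB φ C hC hφ q qinv p q hp0 hq0 (fun c h1 h2 => Or.inl (hqinv c h1 h2))
  have sS : Summable (fun t : ℕ × ℕ × ℕ => ‖Kterm a s φ (p * q) qinv p q t‖) :=
    Kterm_summable s hs a haB φ C hC hφ (p * q) qinv p q hp0 hq0
      (fun c h1 h2 => Or.inr ⟨q, hqinv c h1 h2.coprime_mul_left_right⟩)
  have sT1 : Summable (fun t : ℕ × ℕ × ℕ => ‖Kterm a s φ q qinv 1 q t‖) :=
    Kterm_summable s hs a haB φ C hC hφ q qinv 1 q one_pos hq0 (fun c h1 h2 => Or.inl (hqinv c h1 h2))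
  have sT2 : Summable (fun t : ℕ × ℕ × ℕ => ‖Kterm a s φ (p * q) pqinv 1 (p * q) t‖) :=
    Kterm_summable s hs a haB φ C hC hφ (p * q) pqinv 1 (p * q) one_pos (Nat.mul_pos hp0 hq0)
      (fun c h1 h2 => Or.inl (hpqinv c h1 h2))
  refine ⟨sR, sS, sT1, sT2, ?_⟩
  replace sR := sR.of_norm
  replace sS := sS.of_norm
  replace sT1 := sT1.of_norm
  replace sT2 := sT2.of_norm
  -- the two Hecke pieces
  obtain ⟨A, hA⟩ : ∃ A : ℕ × ℕ × ℕ → ℂ, ∀ m n c, A (m, n, c) = if Nat.Coprime (c + 1) q then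
      (p : ℂ) ^ (-s) * Gt s φ (a ((m + 1) * p) * a (n + 1)) (m + 1) (n + 1) (c + 1)
        (Kl (qinv (c + 1) * ((m + 1 : ℕ) : ℤ)) (((1 : ℕ) : ℤ) * ((n + 1 : ℕ) : ℤ)) (c + 1)) 1 q else 0 :=
    trip _
  obtain ⟨B, hB⟩ : ∃ B : ℕ × ℕ × ℕ → ℂ, ∀ m n c, B (m, n, c) = if Nat.Coprime (c + 1) q then
      (p : ℂ) ^ (-s) * Gt s φ ((if p ∣ m + 1 then a ((m + 1) / p) else 0) * a (n + 1))
        (m + 1) (n + 1) (c + 1)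
        (Kl (qinv (c + 1) * ((m + 1 : ℕ) : ℤ)) (((1 : ℕ) : ℤ) * ((n + 1 : ℕ) : ℤ)) (c + 1)) 1 q else 0 :=
    trip _
  have hAB : ∀ t, a p * (p : ℂ) ^ (-s) * Kterm a s φ q qinv 1 q t = A t + B t := by
    rintro ⟨m, n, c⟩
    rw [hA, hB, Kterm_Gt]
    by_cases h : Nat.Coprime (c + 1) q
    · rw [if_pos h, if_pos h, if_pos h, ← mul_add, ← Gt_add, ← add_mul, ← ha (m + 1) (by omega),
        show a (m + 1) * a p * a (n + 1) = a p * (a (m + 1) * a (n + 1)) by ring, Gt_smul s φ (a p)]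
      ring
    · rw [if_neg h, if_neg h, if_neg h]; ring
  -- the B sum
  have iB : Function.Injective (fun t : ℕ × ℕ × ℕ => (p * (t.2.1 + 1) - 1, t.1, t.2.2)) := by
    rintro ⟨m, n, c⟩ ⟨m', n', c'⟩ h
    simp only [Prod.mk.injEq] at h ⊢
    exact ⟨h.2.1, shift_inj p hp0 h.1, h.2.2⟩
  have rB : ∀ t, t ∉ Set.range (fun t : ℕ × ℕ × ℕ => (p * (t.2.1 + 1) - 1, t.1, t.2.2)) → B t = 0 := by
    rintro ⟨m, n, c⟩ h
    have hn : ¬ p ∣ m + 1 := by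
      intro hd
      obtain ⟨y, hy⟩ := shift_surj p hd
      exact h ⟨(n, y, c), by simp only [hy]⟩
    rw [hB, if_neg hn, zero_mul]
    unfold Gt
    simp
  have vB : ∀ t : ℕ × ℕ × ℕ, B (p * (t.2.1 + 1) - 1, t.1, t.2.2) =
      (p : ℂ) ^ (-(2 * s)) * Kterm a s φ q qinv p q t := by
    rintro ⟨m, n, c⟩
    rw [hB, Kterm_Gt]
    simp only
    by_cases h : Nat.Coprime (c + 1) q
    · rw [if_pos h, if_pos h, shift_eq p hp0, if_pos (Dvd.intro _ rfl), Nat.mul_div_cancel_left _ hp0, Gt_1,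
        Gt_symm, mul_comm (a (n + 1)), ← mul_assoc, ← Complex.cpow_add _ _ (by exact_mod_cast hp0.ne'),
        show -s + -s = -(2 * s) by ring, Nat.cast_one, one_mul, Nat.cast_mul p (n + 1),
        Kl_flip (c + 1) (by omega) p _ _ _ q (hqinv (c + 1) (by omega) h)]
    · rw [if_neg h, if_neg h, mul_zero]
  have sB : Summable B := by
    rw [← iB.summable_iff rB]
    exact (sR.mul_left ((p : ℂ) ^ (-(2 * s)))).congr fun t => (vB t).symm
  have tB : ∑' t, B t = (p : ℂ) ^ (-(2 * s)) * ∑' t, Kterm a s φ q qinv p q t := by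
    rw [← iB.tsum_eq (Function.support_subset_iff'.2 rB), ← tsum_mul_left]
    exact tsum_congr vB
  have sA : Summable A := by
    have := (sT1.mul_left (a p * (p : ℂ) ^ (-s))).sub sB
    exact this.congr fun t => by rw [hAB]; ring
  have tAB : a p * (p : ℂ) ^ (-s) * ∑' t, Kterm a s φ q qinv 1 q t = ∑' t, A t + ∑' t, B t := by
    rw [← tsum_mul_left, ← sA.tsum_add sB]
    exact tsum_congr hAB
  -- the moduli divisible by p
  have iC : Function.Injective (fun t : ℕ × ℕ × ℕ => (t.1, t.2.1, p * (t.2.2 + 1) - 1)) := by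
    rintro ⟨m, n, c⟩ ⟨m', n', c'⟩ h
    simp only [Prod.mk.injEq] at h ⊢
    exact ⟨h.1, h.2.1, shift_inj p hp0 h.2.2⟩
  have dC : ∀ m n c, p ∣ c + 1 → Kterm a s φ (p * q) qinv p q (m, n, c) = 0 := by
    intro m n c h
    rw [Kterm_Gt, if_neg]
    exact fun h' => (Nat.Prime.coprime_iff_not_dvd hp).1 h'.coprime_mul_right_right.symm h
  have rC : ∀ t, t ∉ Set.range (fun t : ℕ × ℕ × ℕ => (t.1, t.2.1, p * (t.2.2 + 1) - 1)) →
      Kterm a s φ q qinv p q t - Kterm a s φ (p * q) qinv p q t = 0 := by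
    rintro ⟨m, n, c⟩ h
    have hn : ¬ p ∣ c + 1 := by
      intro hd
      obtain ⟨y, hy⟩ := shift_surj p hd
      exact h ⟨(m, n, y), by simp only [hy]⟩
    have : Nat.Coprime (c + 1) (p * q) ↔ Nat.Coprime (c + 1) q :=
      ⟨fun h => h.coprime_mul_left_right, fun h =>
        Nat.Coprime.mul_right ((Nat.Prime.coprime_iff_not_dvd hp).2 hn).symm h⟩
    rw [Kterm_Gt, Kterm_Gt]
    simp only [this, sub_self]
  have vC : ∀ t : ℕ × ℕ × ℕ, Kterm a s φ q qinv p q (t.1, t.2.1, p * (t.2.2 + 1) - 1) -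
      Kterm a s φ (p * q) qinv p q (t.1, t.2.1, p * (t.2.2 + 1) - 1) =
      Kterm a s φ q qinv p q (t.1, t.2.1, p * (t.2.2 + 1) - 1) := by
    intro t
    rw [dC _ _ _ (by rw [shift_eq p hp0]; exact Dvd.intro _ rfl), sub_zero]
  have sC : Summable fun t : ℕ × ℕ × ℕ => Kterm a s φ q qinv p q (t.1, t.2.1, p * (t.2.2 + 1) - 1) :=
    sR.comp_injective iC
  have tC : ∑' t, Kterm a s φ q qinv p q t - ∑' t, Kterm a s φ (p * q) qinv p q t =
      ∑' t : ℕ × ℕ × ℕ, Kterm a s φ q qinv p q (t.1, t.2.1, p * (t.2.2 + 1) - 1) := by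
    rw [← sR.tsum_sub sS, ← iC.tsum_eq (f := fun t => Kterm a s φ q qinv p q t -
      Kterm a s φ (p * q) qinv p q t) (Function.support_subset_iff'.2 rC)]
    exact tsum_congr vC
  -- the D sum
  have hD : ∀ m n c, Kterm a s φ q qinv p q (m, n, p * (c + 1) - 1) +
      ((Real.sqrt p : ℝ) : ℂ)⁻¹ * Kterm a s φ (p * q) pqinv 1 (p * q) (m, n, c) =
      if p ∣ m + 1 then A ((m + 1) / p - 1, n, c) else 0 := by
    intro m n c
    rw [Kterm_Gt, Kterm_Gt, shift_eq p hp0, hA]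
    by_cases h : Nat.Coprime (c + 1) q
    · have h2 : Nat.Coprime (p * (c + 1)) q :=
        Nat.Coprime.mul_left ((Nat.coprime_primes hp hq).2 hpq) h
      rw [if_pos h2, if_pos h, D_pt p q hp hq hpq s φ qinv pqinv hqinv hpqinv _ _ _ (c + 1) (by omega) h]
      by_cases hm : p ∣ m + 1
      · rw [if_pos hm, if_pos hm]
        obtain ⟨y, rfl⟩ := shift_surj p hm
        rw [shift_eq p hp0, Nat.mul_div_cancel_left _ hp0, Nat.add_sub_cancel, mul_comm p (y + 1)]
      · rw [if_neg hm, if_neg hm]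
    · have h2 : ¬ Nat.Coprime (p * (c + 1)) q := fun h' => h h'.coprime_mul_left
      have h3 : ¬ Nat.Coprime (c + 1) (p * q) := fun h' => h h'.coprime_mul_left_right
      rw [if_neg h2, if_neg h3, if_neg h]
      simp
  have iD : Function.Injective (fun t : ℕ × ℕ × ℕ => (p * (t.1 + 1) - 1, t.2.1, t.2.2)) := by
    rintro ⟨m, n, c⟩ ⟨m', n', c'⟩ h
    simp only [Prod.mk.injEq] at h ⊢
    exact ⟨shift_inj p hp0 h.1, h.2.1, h.2.2⟩
  have rD : ∀ t, t ∉ Set.range (fun t : ℕ × ℕ × ℕ => (p * (t.1 + 1) - 1, t.2.1, t.2.2)) →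
      Kterm a s φ q qinv p q (t.1, t.2.1, p * (t.2.2 + 1) - 1) +
      ((Real.sqrt p : ℝ) : ℂ)⁻¹ * Kterm a s φ (p * q) pqinv 1 (p * q) t = 0 := by
    rintro ⟨m, n, c⟩ h
    have hn : ¬ p ∣ m + 1 := by
      intro hd
      obtain ⟨y, hy⟩ := shift_surj p hd
      exact h ⟨(y, n, c), by simp only [hy]⟩
    have := hD m n c
    rw [if_neg hn] at this
    exact this
  have vD : ∀ t : ℕ × ℕ × ℕ, Kterm a s φ q qinv p q (p * (t.1 + 1) - 1, t.2.1, p * (t.2.2 + 1) - 1) +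
      ((Real.sqrt p : ℝ) : ℂ)⁻¹ * Kterm a s φ (p * q) pqinv 1 (p * q) (p * (t.1 + 1) - 1, t.2.1, t.2.2) =
      A t := by
    rintro ⟨m, n, c⟩
    have := hD (p * (m + 1) - 1) n c
    rw [shift_eq p hp0, if_pos (Dvd.intro _ rfl), Nat.mul_div_cancel_left _ hp0, Nat.add_sub_cancel] at this
    exact this
  have tD : ∑' t : ℕ × ℕ × ℕ, Kterm a s φ q qinv p q (t.1, t.2.1, p * (t.2.2 + 1) - 1) +
      ((Real.sqrt p : ℝ) : ℂ)⁻¹ * ∑' t, Kterm a s φ (p * q) pqinv 1 (p * q) t = ∑' t, A t := by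
    rw [← tsum_mul_left, ← sC.tsum_add (sT2.mul_left _),
      ← iD.tsum_eq (f := fun t : ℕ × ℕ × ℕ => Kterm a s φ q qinv p q (t.1, t.2.1, p * (t.2.2 + 1) - 1) +
      ((Real.sqrt p : ℝ) : ℂ)⁻¹ * Kterm a s φ (p * q) pqinv 1 (p * q) t)
      (Function.support_subset_iff'.2 rD)]
    exact tsum_congr vD
  linear_combination tC + tD - tAB - tB
end

section
/- Let c be a positive integer. There exists a family (D_{a,b}), indexed by pairs of residues a, b ∈ (ℤ/cℤ)ˣ, of entire functions ℂ → ℂ with the following properties: (1) for all a, b coprime to c and all s with Re s > 1, D_{a,b}(s) = Σ_{m,n≥1} λ_g(m)λ_g(n)·S(a·m, b·n; c)·(mn)^{−s} (the double series converging absolutely); (2) for all a, b coprime to c and all s ∈ ℂ at which the Gamma factor below has no pole, D_{a,b}(s) = (2π/c)^{4s−2}·[Γ((κ+1)/2 − s)/Γ((κ−1)/2 + s)]²·D_{ā,b̄}(1−s), where ā, b̄ denote the inverses of a, b modulo c. -/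
namespace St9

open Complex Set Filter Asymptotics

/-- restriction of the form to a vertical line -/
noncomputable def F (g : ℂ → ℂ) (c : ℕ) (d : (ZMod c)ˣ) (y : ℝ) : ℂ :=
  g ((((d : ZMod c).val : ℂ) + I * (y : ℂ)) / (c : ℂ))

lemma im_pos {c : ℕ} (hc : 0 < c) (k : ℕ) {y : ℝ} (hy : 0 < y) :
    0 < (((k : ℂ) + I * (y : ℂ)) / (c : ℂ)).im := by
  rw [div_natCast_im]
  simp
  positivity

lemma F_feq {κ : ℕ} {g : ℂ → ℂ}
    (hg_mod : ∀ A : Matrix.SpecialLinearGroup (Fin 2) ℤ, ∀ z : ℂ, 0 < z.im →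
      g ((((A.1 0 0 : ℤ) : ℂ) * z + ((A.1 0 1 : ℤ) : ℂ)) /
          (((A.1 1 0 : ℤ) : ℂ) * z + ((A.1 1 1 : ℤ) : ℂ)))
        = (((A.1 1 0 : ℤ) : ℂ) * z + ((A.1 1 1 : ℤ) : ℂ)) ^ κ * g z)
    {c : ℕ} [NeZero c] (d : (ZMod c)ˣ) (y : ℝ) (hy : 0 < y) :
    F g c d (1 / y) = I ^ κ * (y : ℂ) ^ κ * F g c (-d⁻¹) y := by
  have hc : 0 < c := Nat.pos_of_ne_zero (NeZero.ne c)
  set α : ℕ := (d : ZMod c).val with hα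
  set δ : ℕ := ((-d⁻¹ : (ZMod c)ˣ) : ZMod c).val with hδ
  have hdvd : (c : ℤ) ∣ (α : ℤ) * δ + 1 := by
    rw [← ZMod.intCast_zmod_eq_zero_iff_dvd]
    push_cast
    rw [hα, hδ, ZMod.natCast_zmod_val, ZMod.natCast_zmod_val]
    simp
  obtain ⟨β, hβ⟩ := hdvd
  let A : Matrix.SpecialLinearGroup (Fin 2) ℤ :=
    ⟨!![(α : ℤ), -β; (c : ℤ), -(δ : ℤ)], by
      rw [Matrix.det_fin_two_of]; linarith⟩
  have h := hg_mod A ((((δ : ℕ) : ℂ) + I * (y : ℂ)) / (c : ℂ)) (im_pos hc δ hy)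
  have hc' : (c : ℂ) ≠ 0 := by exact_mod_cast hc.ne'
  have hy' : (y : ℂ) ≠ 0 := by exact_mod_cast hy.ne'
  have hβ' : (α : ℂ) * δ + 1 = c * β := by exact_mod_cast hβ
  have e0 : (((A.1 1 0 : ℤ) : ℂ) * ((((δ : ℕ) : ℂ) + I * (y : ℂ)) / (c : ℂ)) +
      ((A.1 1 1 : ℤ) : ℂ)) = I * y := by
    simp [A]; field_simp; ring
  have e1 : (((A.1 0 0 : ℤ) : ℂ) * ((((δ : ℕ) : ℂ) + I * (y : ℂ)) / (c : ℂ)) +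
      ((A.1 0 1 : ℤ) : ℂ)) / (I * y) = ((α : ℂ) + I * ((1 / y : ℝ) : ℂ)) / c := by
    simp only [A, Matrix.of_apply, Matrix.cons_val', Matrix.cons_val_zero, Matrix.cons_val_one,
      Matrix.cons_val_fin_one]
    push_cast
    field_simp
    linear_combination hβ' - I_sq
  rw [e0, e1, mul_pow] at h
  exact h

lemma F_hasSum {g : ℂ → ℂ} {cg : ℕ → ℂ}
    (hg_four : ∀ z : ℂ, 0 < z.im →
      HasSum (fun n : ℕ => cg n * Complex.exp (2 * Real.pi * Complex.I * (n : ℂ) * z)) (g z))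
    {c : ℕ} [NeZero c] (d : (ZMod c)ˣ) (y : ℝ) (hy : 0 < y) :
    HasSum (fun n : ℕ => (cg n * ZMod.stdAddChar ((d : ZMod c) * (n : ZMod c))) *
      (Real.exp (-(2 * Real.pi / c * n) * y) : ℂ)) (F g c d y) := by
  have hc : 0 < c := Nat.pos_of_ne_zero (NeZero.ne c)
  have hc' : (c : ℂ) ≠ 0 := by exact_mod_cast hc.ne'
  refine (hg_four _ (im_pos hc (d : ZMod c).val hy)).congr_fun ?_
  intro n
  have : (d : ZMod c) * (n : ZMod c) = (((d : ZMod c).val * n : ℤ) : ZMod c) := by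
    push_cast
    rw [ZMod.natCast_zmod_val]
  rw [this, ZMod.stdAddChar_coe, mul_assoc, ofReal_exp, ← Complex.exp_add]
  congr 2
  push_cast
  field_simp
  ring_nf
  rw [I_sq]; ring

lemma F_decay {g : ℂ → ℂ} {cg : ℕ → ℂ} (hcg0 : cg 0 = 0)
    (hg_four : ∀ z : ℂ, 0 < z.im →
      HasSum (fun n : ℕ => cg n * Complex.exp (2 * Real.pi * Complex.I * (n : ℂ) * z)) (g z))
    {c : ℕ} [NeZero c] (d : (ZMod c)ˣ) (r : ℝ) :
    F g c d =O[atTop] (fun y : ℝ => y ^ r) := by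
  have hc : 0 < c := Nat.pos_of_ne_zero (NeZero.ne c)
  set b : ℝ := 2 * Real.pi / c with hb
  have hbpos : 0 < b := by positivity
  have h1 : F g c d =O[atTop] (fun y : ℝ => Real.exp (-b * y)) := by
    have hs1 := (F_hasSum hg_four d 1 one_pos).summable.norm
    refine IsBigO.of_bound ((∑' n : ℕ, ‖(cg n * ZMod.stdAddChar ((d : ZMod c) * (n : ZMod c))) *
      (Real.exp (-(2 * Real.pi / c * n) * (1 : ℝ)) : ℂ)‖) * Real.exp b) ?_
    filter_upwards [eventually_ge_atTop 1] with y hy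
    have hs := F_hasSum hg_four d y (by linarith)
    rw [mul_assoc, ← tsum_mul_right]
    refine hs.tsum_eq ▸ tsum_of_norm_bounded (hs1.mul_right _).hasSum ?_
    intro n
    rcases Nat.eq_zero_or_pos n with rfl | hn
    · simp [hcg0]
    · rw [norm_mul, norm_mul _ (Real.exp _ : ℂ), mul_assoc]
      gcongr
      rw [norm_real, norm_real, Real.norm_of_nonneg (Real.exp_pos _).le,
        Real.norm_of_nonneg (Real.exp_pos _).le, Real.norm_of_nonneg (Real.exp_pos _).le,
        ← Real.exp_add, ← Real.exp_add]
      apply Real.exp_le_exp.mpr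
      have hn' : (1 : ℝ) ≤ n := by exact_mod_cast hn
      rw [← hb]
      nlinarith [mul_nonneg hbpos.le (mul_nonneg (sub_nonneg.2 hn') (sub_nonneg.2 hy))]
  exact h1.trans (isLittleO_exp_neg_mul_rpow_atTop hbpos r).isBigO

lemma F_cont {g : ℂ → ℂ} (hg_hol : DifferentiableOn ℂ g {z : ℂ | 0 < z.im})
    {c : ℕ} [NeZero c] (d : (ZMod c)ˣ) : ContinuousOn (F g c d) (Ioi 0) := by
  have hc : 0 < c := Nat.pos_of_ne_zero (NeZero.ne c)
  refine hg_hol.continuousOn.comp (by fun_prop) ?_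
  intro y hy
  exact im_pos hc _ hy

/-- the pair -/
noncomputable def P {κ : ℕ} (hκ : 12 ≤ κ) {g : ℂ → ℂ} {cg : ℕ → ℂ}
    (hg_hol : DifferentiableOn ℂ g {z : ℂ | 0 < z.im})
    (hg_mod : ∀ A : Matrix.SpecialLinearGroup (Fin 2) ℤ, ∀ z : ℂ, 0 < z.im →
      g ((((A.1 0 0 : ℤ) : ℂ) * z + ((A.1 0 1 : ℤ) : ℂ)) /
          (((A.1 1 0 : ℤ) : ℂ) * z + ((A.1 1 1 : ℤ) : ℂ)))
        = (((A.1 1 0 : ℤ) : ℂ) * z + ((A.1 1 1 : ℤ) : ℂ)) ^ κ * g z)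
    (hcg0 : cg 0 = 0)
    (hg_four : ∀ z : ℂ, 0 < z.im →
      HasSum (fun n : ℕ => cg n * Complex.exp (2 * Real.pi * Complex.I * (n : ℂ) * z)) (g z))
    {c : ℕ} [NeZero c] (d : (ZMod c)ˣ) : WeakFEPair ℂ where
  f := F g c d
  g := F g c (-d⁻¹)
  k := κ
  ε := I ^ κ
  f₀ := 0
  g₀ := 0
  hf_int := (F_cont hg_hol d).locallyIntegrableOn measurableSet_Ioi
  hg_int := (F_cont hg_hol _).locallyIntegrableOn measurableSet_Ioi
  hk := by positivity
  hε := by simp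
  h_feq := fun x hx => by
    rw [F_feq hg_mod d x hx]; simp
  hf_top := fun r => by simpa using F_decay hcg0 hg_four d r
  hg_top := fun r => by simpa using F_decay hcg0 hg_four _ r

lemma summable_lam {lamg : ℕ → ℂ}
    (hdeligne : ∀ n : ℕ, 1 ≤ n → ‖lamg n‖ ≤ ((n.divisors.card : ℝ))) {s : ℂ} (hs : 1 < s.re) :
    Summable (fun n : ℕ => ‖lamg (n + 1)‖ * ((n + 1 : ℕ) : ℝ) ^ (-s.re)) := by
  have h0 := (LSeriesSummable_one_iff.2 hs)
  have h := (h0.convolution h0).norm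
  have h' := (summable_nat_add_iff 1).2 h
  refine Summable.of_nonneg_of_le (fun n => by positivity) (fun n => ?_) h'
  rw [LSeries.norm_term_eq, if_neg (by omega), LSeries.convolution_def, Real.rpow_neg (by positivity),
    div_eq_mul_inv]
  gcongr
  refine (hdeligne _ (by omega)).trans ?_
  simp [← Nat.map_div_right_divisors]


lemma psi_norm {c : ℕ} [NeZero c] (x : ZMod c) : ‖ZMod.stdAddChar x‖ = 1 :=
  Circle.norm_coe _

/-- the summand -/
noncomputable def T (lamg : ℕ → ℂ) {c : ℕ} [NeZero c] (d : ZMod c) (s : ℂ) (n : ℕ) : ℂ :=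
  lamg (n + 1) * ZMod.stdAddChar (d * ((n + 1 : ℕ) : ZMod c)) * ((n + 1 : ℕ) : ℂ) ^ (-s)

/-- the additively twisted L-function -/
noncomputable def L (κ : ℕ) (g : ℂ → ℂ) (c : ℕ) (d : (ZMod c)ˣ) (s : ℂ) : ℂ :=
  ((2 * Real.pi / c : ℝ) : ℂ) ^ (s + ((κ : ℂ) - 1) / 2) *
    (mellin (F g c d) (s + ((κ : ℂ) - 1) / 2) * (Gamma (s + ((κ : ℂ) - 1) / 2))⁻¹)

section

variable {κ : ℕ} (hκ : 12 ≤ κ) {g : ℂ → ℂ} {cg : ℕ → ℂ}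
    (hg_hol : DifferentiableOn ℂ g {z : ℂ | 0 < z.im})
    (hg_mod : ∀ A : Matrix.SpecialLinearGroup (Fin 2) ℤ, ∀ z : ℂ, 0 < z.im →
      g ((((A.1 0 0 : ℤ) : ℂ) * z + ((A.1 0 1 : ℤ) : ℂ)) /
          (((A.1 1 0 : ℤ) : ℂ) * z + ((A.1 1 1 : ℤ) : ℂ)))
        = (((A.1 1 0 : ℤ) : ℂ) * z + ((A.1 1 1 : ℤ) : ℂ)) ^ κ * g z)
    (hcg0 : cg 0 = 0)
    (hg_four : ∀ z : ℂ, 0 < z.im →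
      HasSum (fun n : ℕ => cg n * Complex.exp (2 * Real.pi * Complex.I * (n : ℂ) * z)) (g z))
    {c : ℕ} [NeZero c] (d : (ZMod c)ˣ)

include hκ hg_hol hg_mod hcg0 hg_four

lemma mellin_diff : Differentiable ℂ (mellin (F g c d)) := by
  have hP : IsStrongFEPair (P hκ hg_hol hg_mod hcg0 hg_four d) := ⟨rfl, rfl⟩
  have := hP.differentiable_Λ
  rwa [hP.Λ_eq] at this

lemma mellin_fe (w : ℂ) : mellin (F g c d) (κ - w) = I ^ κ * mellin (F g c (-d⁻¹)) w := by
  have hP : IsStrongFEPair (P hκ hg_hol hg_mod hcg0 hg_four d) := ⟨rfl, rfl⟩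
  have := (P hκ hg_hol hg_mod hcg0 hg_four d).functional_equation w
  rw [hP.Λ_eq, hP.symm.Λ_eq] at this
  have e : (P hκ hg_hol hg_mod hcg0 hg_four d).symm.f = F g c (-d⁻¹) := rfl
  rw [e] at this
  simpa [P] using this

lemma L_diff : Differentiable ℂ (L κ g c d) := by
  have hc : (c : ℝ) ≠ 0 := by exact_mod_cast NeZero.ne c
  have h0 : ((2 * Real.pi / c : ℝ) : ℂ) ≠ 0 := by
    rw [ofReal_ne_zero]; positivity
  have hw : Differentiable ℂ (fun s : ℂ => s + ((κ : ℂ) - 1) / 2) := by fun_prop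
  refine (hw.const_cpow (Or.inl h0)).mul
    (((mellin_diff hκ hg_hol hg_mod hcg0 hg_four d).comp hw).mul
      (differentiable_one_div_Gamma.comp hw))

lemma L_fe (s : ℂ) (hs : ∀ n : ℕ, ((κ : ℂ) + 1) / 2 - s ≠ -(n : ℂ)) :
    L κ g c d s = I ^ κ * ((2 * Real.pi / c : ℝ) : ℂ) ^ (2 * s - 1) *
      (Gamma (((κ : ℂ) + 1) / 2 - s) / Gamma (((κ : ℂ) - 1) / 2 + s)) *
      L κ g c (-d⁻¹) (1 - s) := by
  have hc : (c : ℝ) ≠ 0 := by exact_mod_cast NeZero.ne c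
  have h0 : ((2 * Real.pi / c : ℝ) : ℂ) ≠ 0 := by
    rw [ofReal_ne_zero]; positivity
  have hG := Gamma_ne_zero hs
  have e1 : s + ((κ : ℂ) - 1) / 2 = κ - (((κ : ℂ) + 1) / 2 - s) := by ring
  have e2 : (1 - s) + ((κ : ℂ) - 1) / 2 = ((κ : ℂ) + 1) / 2 - s := by ring
  have e3 : ((κ : ℂ) - 1) / 2 + s = s + ((κ : ℂ) - 1) / 2 := by ring
  have e4 : s + ((κ : ℂ) - 1) / 2 = (2 * s - 1) + (((κ : ℂ) + 1) / 2 - s) := by ring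
  have hm := mellin_fe hκ hg_hol hg_mod hcg0 hg_four d (((κ : ℂ) + 1) / 2 - s)
  rw [← e1] at hm
  unfold L
  rw [e2, e3, hm]
  nth_rw 1 [e4]
  rw [cpow_add _ _ h0]
  generalize ((κ : ℂ) + 1) / 2 - s = u at *
  generalize s + ((κ : ℂ) - 1) / 2 = v at *
  field_simp

omit hκ hg_hol hg_mod in
include hκ in
lemma L_hasSum {lamg : ℕ → ℂ}
    (hlam : ∀ n : ℕ, lamg n = cg n * ((n : ℂ)) ^ (-(((κ : ℂ) - 1) / 2)))
    (hdeligne : ∀ n : ℕ, 1 ≤ n → ‖lamg n‖ ≤ ((n.divisors.card : ℝ))) {s : ℂ} (hs : 1 < s.re) :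
    HasSum (T lamg (d : ZMod c) s) (L κ g c d s) := by
  have hc : 0 < c := Nat.pos_of_ne_zero (NeZero.ne c)
  set w : ℂ := s + ((κ : ℂ) - 1) / 2 with hw
  set b : ℝ := 2 * Real.pi / c with hb
  have hbpos : 0 < b := by positivity
  have hκ' : (12 : ℝ) ≤ κ := by exact_mod_cast hκ
  have hwre : w.re = s.re + ((κ : ℝ) - 1) / 2 := by
    rw [hw, add_re]
    congr 1
    have : ((κ : ℂ) - 1) / 2 = (((κ : ℝ) - 1) / 2 : ℝ) := by push_cast; rfl
    rw [this, ofReal_re]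
  have hwpos : 0 < w.re := by rw [hwre]; linarith
  have hnn : ∀ n : ℕ, ((n + 1 : ℕ) : ℂ) ≠ 0 := fun n => by exact_mod_cast Nat.succ_ne_zero n
  have hcgn : ∀ n : ℕ, cg (n + 1) = lamg (n + 1) * ((n + 1 : ℕ) : ℂ) ^ (((κ : ℂ) - 1) / 2) := by
    intro n
    rw [hlam, mul_assoc, ← cpow_add _ _ (hnn n)]
    simp
  have hψ : ∀ x : ZMod c, ‖ZMod.stdAddChar x‖ = 1 := psi_norm
  have key := hasSum_mellin (s := w) (F := F g c d)
    (a := fun n : ℕ => cg (n + 1) * ZMod.stdAddChar ((d : ZMod c) * ((n + 1 : ℕ) : ZMod c)))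
    (p := fun n : ℕ => b * ((n + 1 : ℕ) : ℝ)) (fun n => Or.inr (by positivity)) hwpos ?_ ?_
  · have h2 := (key.mul_right (Gamma w)⁻¹).mul_left ((b : ℂ) ^ w)
    refine h2.congr_fun ?_
    intro n
    rw [T]
    have hG : Gamma w ≠ 0 := Gamma_ne_zero_of_re_pos hwpos
    have hbw : (b : ℂ) ^ w ≠ 0 := by
      rw [Ne, cpow_eq_zero_iff, not_and_or]; left; exact_mod_cast hbpos.ne'
    have hn1 : ((n + 1 : ℕ) : ℂ) ^ s ≠ 0 := by
      rw [Ne, cpow_eq_zero_iff, not_and_or]; left; exact hnn n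
    have hn2 : ((n + 1 : ℕ) : ℂ) ^ (((κ : ℂ) - 1) / 2) ≠ 0 := by
      rw [Ne, cpow_eq_zero_iff, not_and_or]; left; exact hnn n
    rw [ofReal_mul, mul_cpow_ofReal_nonneg hbpos.le (by positivity), hcgn, ofReal_natCast,
      cpow_neg]
    nth_rw 4 [hw]
    rw [cpow_add _ _ (hnn n)]
    field_simp
  · intro t ht
    have := F_hasSum hg_four d t ht
    have h3 := (hasSum_nat_add_iff' 1).2 this
    simp only [Finset.range_one, Finset.sum_singleton, hcg0, zero_mul, sub_zero] at h3
    exact h3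
  · have h4 := (summable_lam hdeligne hs).mul_right (b ^ (-w.re))
    refine h4.congr ?_
    intro n
    have hpos : (0 : ℝ) < ((n + 1 : ℕ) : ℝ) := by positivity
    rw [norm_mul, hψ, mul_one, hcgn, norm_mul, norm_natCast_cpow_of_pos (Nat.succ_pos n),
      Real.mul_rpow hbpos.le hpos.le, Real.rpow_neg hbpos.le]
    have : (((κ : ℂ) - 1) / 2).re = w.re - s.re := by rw [hw, add_re]; ring
    rw [this, Real.rpow_sub hpos, Real.rpow_neg hpos.le]
    have := (Real.rpow_pos_of_pos hpos w.re).ne'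
    have := (Real.rpow_pos_of_pos hbpos w.re).ne'
    field_simp

end

lemma L_norm {lamg : ℕ → ℂ} {c : ℕ} [NeZero c] (d : ZMod c)
    (hdeligne : ∀ n : ℕ, 1 ≤ n → ‖lamg n‖ ≤ ((n.divisors.card : ℝ))) {s : ℂ} (hs : 1 < s.re) :
    Summable (fun n : ℕ => ‖T lamg d s n‖) := by
  refine (summable_lam hdeligne hs).congr ?_
  intro n
  rw [T, norm_mul, norm_mul, norm_natCast_cpow_of_pos (Nat.succ_pos n), psi_norm, mul_one]
  simp

lemma Kl_eq {c : ℕ} [NeZero c] (a b : (ZMod c)ˣ) (m n : ℕ) :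
    Kl ((((a : ZMod c).val : ℤ)) * (m + 1)) ((((b : ZMod c).val : ℤ)) * (n + 1)) c =
    ∑ d : (ZMod c)ˣ, ZMod.stdAddChar (((d⁻¹ * a : (ZMod c)ˣ) : ZMod c) * ((m + 1 : ℕ) : ZMod c)) *
      ZMod.stdAddChar (((d * b : (ZMod c)ˣ) : ZMod c) * ((n + 1 : ℕ) : ZMod c)) := by
  have hc' : (c : ℂ) ≠ 0 := by exact_mod_cast NeZero.ne c
  rw [Kl, dif_neg (NeZero.ne c)]
  refine Finset.sum_congr (by congr!) fun d _ => ?_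
  have e1 : ((d⁻¹ * a : (ZMod c)ˣ) : ZMod c) * ((m + 1 : ℕ) : ZMod c) =
      ((((d⁻¹ : (ZMod c)ˣ) : ZMod c).val * ((a : ZMod c).val * (m + 1)) : ℤ) : ZMod c) := by
    push_cast
    simp only [ZMod.natCast_zmod_val]
    ring
  have e2 : ((d * b : (ZMod c)ˣ) : ZMod c) * ((n + 1 : ℕ) : ZMod c) =
      ((((d : (ZMod c)ˣ) : ZMod c).val * ((b : ZMod c).val * (n + 1)) : ℤ) : ZMod c) := by
    push_cast
    simp only [ZMod.natCast_zmod_val]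
    ring
  rw [e1, e2, ZMod.stdAddChar_coe, ZMod.stdAddChar_coe, ← Complex.exp_add]
  congr 1
  push_cast
  ring

end St9

/-- For a holomorphic cusp form `g` of even weight `κ ≥ 12` for `SL₂(ℤ)` (with
normalized coefficients `λ_g` satisfying Deligne's bound), there is a family of
entire functions `D_{a,b}`, indexed by `a,b ∈ (ℤ/cℤ)ˣ`, agreeing for `Re s > 1`
with the absolutely convergent series `∑_{m,n≥1} λ_g(m)λ_g(n)S(am,bn;c)(mn)^{−s}`
and satisfying the functional equation
`D_{a,b}(s) = (2π/c)^{4s−2}·[Γ((κ+1)/2−s)/Γ((κ−1)/2+s)]²·D_{ā,b̄}(1−s)`. -/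
theorem stmt_9
    (κ : ℕ) (hκeven : Even κ) (hκ12 : 12 ≤ κ)
    (g : ℂ → ℂ) (cg lamg : ℕ → ℂ)
    (hg_hol : DifferentiableOn ℂ g {z : ℂ | 0 < z.im})
    (hg_mod : ∀ A : Matrix.SpecialLinearGroup (Fin 2) ℤ, ∀ z : ℂ, 0 < z.im →
      g ((((A.1 0 0 : ℤ) : ℂ) * z + ((A.1 0 1 : ℤ) : ℂ)) /
          (((A.1 1 0 : ℤ) : ℂ) * z + ((A.1 1 1 : ℤ) : ℂ)))
        = (((A.1 1 0 : ℤ) : ℂ) * z + ((A.1 1 1 : ℤ) : ℂ)) ^ κ * g z)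
    (hcg0 : cg 0 = 0)
    (hg_four : ∀ z : ℂ, 0 < z.im →
      HasSum (fun n : ℕ => cg n * Complex.exp (2 * Real.pi * Complex.I * (n : ℂ) * z)) (g z))
    (hlam : ∀ n : ℕ, lamg n = cg n * ((n : ℂ)) ^ (-(((κ : ℂ) - 1) / 2)))
    (hdeligne : ∀ n : ℕ, 1 ≤ n → ‖lamg n‖ ≤ ((n.divisors.card : ℝ)))
    (c : ℕ) (hc : 0 < c) :
    ∃ D : (ZMod c)ˣ → (ZMod c)ˣ → ℂ → ℂ,
      (∀ a b : (ZMod c)ˣ, Differentiable ℂ (D a b)) ∧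
      (∀ a b : (ZMod c)ˣ, ∀ s : ℂ, 1 < s.re →
        Summable (fun mn : ℕ × ℕ =>
          ‖lamg (mn.1 + 1) * lamg (mn.2 + 1) *
            Kl ((((a : ZMod c).val : ℤ)) * (mn.1 + 1)) ((((b : ZMod c).val : ℤ)) * (mn.2 + 1)) c *
            ((((mn.1 + 1) * (mn.2 + 1) : ℕ) : ℂ)) ^ (-s)‖) ∧
        HasSum (fun mn : ℕ × ℕ =>
          lamg (mn.1 + 1) * lamg (mn.2 + 1) *
            Kl ((((a : ZMod c).val : ℤ)) * (mn.1 + 1)) ((((b : ZMod c).val : ℤ)) * (mn.2 + 1)) c *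
            ((((mn.1 + 1) * (mn.2 + 1) : ℕ) : ℂ)) ^ (-s)) (D a b s)) ∧
      (∀ a b : (ZMod c)ˣ, ∀ s : ℂ, (∀ n : ℕ, ((κ : ℂ) + 1) / 2 - s ≠ -(n : ℂ)) →
        D a b s = (((2 * Real.pi / c : ℝ)) : ℂ) ^ (4 * s - 2) *
          (Complex.Gamma (((κ : ℂ) + 1) / 2 - s) / Complex.Gamma (((κ : ℂ) - 1) / 2 + s)) ^ 2 *
          D a⁻¹ b⁻¹ (1 - s)) := by
  have : NeZero c := ⟨hc.ne'⟩
  have main : ∀ a b : (ZMod c)ˣ, ∀ s : ℂ, 1 < s.re → ∀ d : (ZMod c)ˣ,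
      Summable (fun mn : ℕ × ℕ =>
        ‖St9.T lamg ((d⁻¹ * a : (ZMod c)ˣ) : ZMod c) s mn.1 *
        St9.T lamg ((d * b : (ZMod c)ˣ) : ZMod c) s mn.2‖) ∧
      HasSum (fun mn : ℕ × ℕ =>
        St9.T lamg ((d⁻¹ * a : (ZMod c)ˣ) : ZMod c) s mn.1 *
        St9.T lamg ((d * b : (ZMod c)ˣ) : ZMod c) s mn.2)
        (St9.L κ g c (d⁻¹ * a) s * St9.L κ g c (d * b) s) := by
    intro a b s hs d
    have n1 := St9.L_norm (c := c) ((d⁻¹ * a : (ZMod c)ˣ) : ZMod c) hdeligne hs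
    have n2 := St9.L_norm (c := c) ((d * b : (ZMod c)ˣ) : ZMod c) hdeligne hs
    have n3 := Summable.mul_norm n1 n2
    exact ⟨n3, HasSum.mul (St9.L_hasSum hκ12 hcg0 hg_four (d⁻¹ * a) hlam hdeligne hs)
      (St9.L_hasSum hκ12 hcg0 hg_four (d * b) hlam hdeligne hs) n3.of_norm⟩
  have hterm : ∀ a b : (ZMod c)ˣ, ∀ s : ℂ, ∀ mn : ℕ × ℕ,
      lamg (mn.1 + 1) * lamg (mn.2 + 1) *
            Kl ((((a : ZMod c).val : ℤ)) * (mn.1 + 1)) ((((b : ZMod c).val : ℤ)) * (mn.2 + 1)) c *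
            ((((mn.1 + 1) * (mn.2 + 1) : ℕ) : ℂ)) ^ (-s) =
      ∑ d : (ZMod c)ˣ, St9.T lamg ((d⁻¹ * a : (ZMod c)ˣ) : ZMod c) s mn.1 *
        St9.T lamg ((d * b : (ZMod c)ˣ) : ZMod c) s mn.2 := by
    intro a b s mn
    rw [St9.Kl_eq, Nat.cast_mul, Complex.natCast_mul_natCast_cpow, Finset.mul_sum, Finset.sum_mul]
    refine Finset.sum_congr rfl fun d _ => ?_
    simp only [St9.T]
    ring
  refine ⟨fun a b s => ∑ d : (ZMod c)ˣ, St9.L κ g c (d⁻¹ * a) s * St9.L κ g c (d * b) s,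
    ?_, ?_, ?_⟩
  · intro a b
    refine Differentiable.fun_sum fun d _ => ?_
    exact (St9.L_diff hκ12 hg_hol hg_mod hcg0 hg_four _).mul
      (St9.L_diff hκ12 hg_hol hg_mod hcg0 hg_four _)
  · intro a b s hs
    simp only [hterm]
    constructor
    · exact Summable.of_nonneg_of_le (fun _ => norm_nonneg _) (fun _ => norm_sum_le _ _)
        (summable_sum fun d _ => (main a b s hs d).1)
    · exact hasSum_sum fun d _ => (main a b s hs d).2
  · intro a b s hs
    simp only
    rw [Finset.mul_sum]
    refine Fintype.sum_equiv ((Equiv.inv _).trans (Equiv.neg _)) _ _ fun d => ?_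
    rw [St9.L_fe hκ12 hg_hol hg_mod hcg0 hg_four _ s hs,
      St9.L_fe hκ12 hg_hol hg_mod hcg0 hg_four (d * b) s hs]
    have hI : (Complex.I ^ κ) ^ 2 = 1 := by
      rw [← pow_mul, mul_comm, pow_mul, Complex.I_sq, hκeven.neg_one_pow]
    have hp : (((2 * Real.pi / c : ℝ)) : ℂ) ^ (4 * s - 2) =
        ((((2 * Real.pi / c : ℝ)) : ℂ) ^ (2 * s - 1)) ^ 2 := by
      rw [← Complex.cpow_nat_mul]; congr 1; push_cast; ring
    have e1 : -(d⁻¹ * a)⁻¹ = ((Equiv.inv _).trans (Equiv.neg _) d)⁻¹ * a⁻¹ := by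
      simp [mul_comm]
    have e2 : -(d * b)⁻¹ = ((Equiv.inv _).trans (Equiv.neg _) d) * b⁻¹ := by
      simp [mul_comm]
    rw [hp, ← e1, ← e2]
    linear_combination (((((2 * Real.pi / c : ℝ)) : ℂ) ^ (2 * s - 1)) ^ 2 *
      (Complex.Gamma (((κ : ℂ) + 1) / 2 - s) / Complex.Gamma (((κ : ℂ) - 1) / 2 + s)) ^ 2 *
      (St9.L κ g c (-(d⁻¹ * a)⁻¹) (1 - s) * St9.L κ g c (-(d * b)⁻¹) (1 - s))) * hI
end

section
/- Let κ ≥ 12 be an even integer and let s ∈ ℂ with 1/2 ≤ Re s ≤ 5/4 + ε₀ for some 0 < ε₀ < 1/100. Then: (1) for every real ξ with 3 − 12 − 4·Re(s) < 2ξ and ξ < min(A − 12, 10), the contour integral defining Φ_{κ,s}(x) converges absolutely for every x > 0 and its value is independent of such ξ; (2) the function Φ_{κ,s} is twice continuously differentiable on (0,∞) and Φ_{κ,s}(x) → 0 as x → 0⁺; (3) there exist δ > 0 and C′ > 0 such that |Φ_{κ,s}^{(ℓ)}(x)| ≤ C′·(1+x)^{−2−δ} for ℓ = 0, 1, 2 and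 all x > 0. -/
/-- The Mellin transform `φ̃(u) = ∫₀^∞ t^{u−1} φ(t) dt`. -/
noncomputable def mellinT (φ : ℝ → ℂ) (u : ℂ) : ℂ :=
  ∫ t in Set.Ioi (0 : ℝ), ((t : ℂ)) ^ (u - 1) * φ t

/-- The integrand of the contour integral defining `Φ_{κ,s}(x)`:
`φ̃(u)·2^{−u}·[Γ((κ+1)/2 − s − u/2)/Γ((κ−1)/2 + s + u/2)]²·(x/2)^{u+4s−2}`. -/
noncomputable def PhiIntegrand (κ : ℕ) (s : ℂ) (φ : ℝ → ℂ) (x : ℝ) (u : ℂ) : ℂ :=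
  mellinT φ u * (2 : ℂ) ^ (-u) *
    (Complex.Gamma (((κ : ℂ) + 1) / 2 - s - u / 2) /
      Complex.Gamma (((κ : ℂ) - 1) / 2 + s + u / 2)) ^ 2 *
    (((x / 2 : ℝ)) : ℂ) ^ (u + 4 * s - 2)

/-- `Φ_{κ,s}(x) = (1/2πi) ∫_{Re u = ξ} PhiIntegrand(u) du`, the contour integral over
the vertical line `Re u = ξ` parametrized as `u = ξ + it` (so `du = i dt`). -/
noncomputable def PhiFun (κ : ℕ) (s : ℂ) (φ : ℝ → ℂ) (ξ : ℝ) (x : ℝ) : ℂ :=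
  (1 / (2 * Real.pi)) * ∫ t : ℝ, PhiIntegrand κ s φ x ((ξ : ℂ) + (t : ℂ) * Complex.I)

open MeasureTheory Set Filter Topology

lemma gA1 (w : ℂ) (hw : w ≠ 0) (h : ℝ) :
    ‖w + h‖ ≤ ‖w‖ * Real.exp (h * (w.re / ‖w‖ ^ 2) + h ^ 2 / 2 * (1 / ‖w‖ ^ 2)) := by
  have hn : 0 < ‖w‖ := norm_pos_iff.mpr hw
  refine (pow_le_pow_iff_left₀ (norm_nonneg _) (by positivity) two_ne_zero).mp ?_
  rw [mul_pow, ← Real.exp_nat_mul]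
  have h1 : ‖w + h‖ ^ 2 = ‖w‖ ^ 2 * ((2 * h * w.re + h ^ 2) / ‖w‖ ^ 2 + 1) := by
    have e1 : ‖w + h‖ ^ 2 = (w.re + h) ^ 2 + w.im ^ 2 := by
      rw [← Complex.normSq_eq_norm_sq, Complex.normSq_apply]; simp; ring
    have e2 : ‖w‖ ^ 2 = w.re ^ 2 + w.im ^ 2 := by
      rw [← Complex.normSq_eq_norm_sq, Complex.normSq_apply]; ring
    field_simp
    rw [e1, e2]; ring
  rw [h1]
  gcongr
  refine (Real.add_one_le_exp _).trans (le_of_eq ?_)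
  congr 1
  push_cast
  field_simp

lemma gA_prod (z : ℂ) (hz : z.im ≠ 0) (h : ℝ) (n : ℕ) :
    ∏ k ∈ Finset.range n, ‖z + h + k‖ ≤ (∏ k ∈ Finset.range n, ‖z + k‖) *
      Real.exp (h * (∑ k ∈ Finset.range n, (z + k).re / ‖z + k‖ ^ 2) +
        h ^ 2 / 2 * ∑ k ∈ Finset.range n, 1 / ‖z + k‖ ^ 2) := by
  rw [Finset.mul_sum, Finset.mul_sum, ← Finset.sum_add_distrib, Real.exp_sum,
    ← Finset.prod_mul_distrib]
  refine Finset.prod_le_prod (fun _ _ => norm_nonneg _) fun k _ => ?_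
  have : z + k ≠ 0 := fun e => hz (by simpa using congrArg Complex.im e)
  have := gA1 (z + k) this h
  rwa [show z + h + k = z + k + h by ring]

lemma gA_up (z : ℂ) (hz : z.im ≠ 0) (n : ℕ) :
    ‖z - 1‖ ≤ ‖z + n‖ *
      Real.exp (-(∑ k ∈ Finset.range (n + 1), (z + k).re / ‖z + k‖ ^ 2) +
        (∑ k ∈ Finset.range (n + 1), 1 / ‖z + k‖ ^ 2) / 2) := by
  induction n with
  | zero =>
    have := gA1 z (fun e => hz (by simp [e])) (-1)
    simpa [sub_eq_add_neg, div_eq_inv_mul] using this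
  | succ n ih =>
    refine ih.trans ?_
    have := gA1 (z + (n + 1 : ℕ))
      (fun e => hz (by simpa using congrArg Complex.im e)) (-1)
    rw [show z + (n + 1 : ℕ) + ((-1 : ℝ) : ℂ) = z + n by push_cast; ring] at this
    refine (mul_le_mul_of_nonneg_right this (Real.exp_pos _).le).trans (le_of_eq ?_)
    rw [mul_assoc, ← Real.exp_add, Finset.sum_range_succ _ (n + 1),
      Finset.sum_range_succ (fun k : ℕ => 1 / ‖z + k‖ ^ 2) (n + 1)]
    congr 2
    ring

lemma gA_lo (z : ℂ) (hz : z.im ≠ 0) (n : ℕ) :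
    ‖z + n‖ ≤ ‖z‖ *
      Real.exp ((∑ k ∈ Finset.range n, (z + k).re / ‖z + k‖ ^ 2) +
        (∑ k ∈ Finset.range n, 1 / ‖z + k‖ ^ 2) / 2) := by
  induction n with
  | zero => simp
  | succ n ih =>
    have := gA1 (z + n)
      (fun e => hz (by simpa using congrArg Complex.im e)) 1
    rw [show z + n + ((1 : ℝ) : ℂ) = z + (n + 1 : ℕ) by push_cast; ring] at this
    refine this.trans ((mul_le_mul_of_nonneg_right ih (Real.exp_pos _).le).trans (le_of_eq ?_))
    rw [mul_assoc, ← Real.exp_add, Finset.sum_range_succ _ n,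
      Finset.sum_range_succ (fun k : ℕ => 1 / ‖z + k‖ ^ 2) n]
    congr 2
    ring

lemma gA_sq (M : ℝ) (hM : 0 ≤ M) : ∃ Q : ℝ, 0 ≤ Q ∧ ∀ z : ℂ, |z.re| ≤ M → 1 ≤ |z.im| →
    ∀ n : ℕ, ∑ k ∈ Finset.range n, 1 / ‖z + k‖ ^ 2 ≤ Q := by
  have hs : Summable (fun k : ℕ => 2 * (M + 1) ^ 2 * (1 / ((k : ℝ) + 1) ^ 2)) := by
    apply Summable.mul_left
    have := (summable_nat_add_iff 1).mpr (Real.summable_one_div_nat_pow.mpr (one_lt_two))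
    simpa using this
  refine ⟨∑' k : ℕ, 2 * (M + 1) ^ 2 * (1 / ((k : ℝ) + 1) ^ 2),
    tsum_nonneg fun k => by positivity, fun z hz hy n => ?_⟩
  refine le_trans (Finset.sum_le_sum fun k _ => ?_)
    (hs.sum_le_tsum (Finset.range n) (fun k _ => by positivity))
  have e1 : ‖z + k‖ ^ 2 = (z.re + k) ^ 2 + z.im ^ 2 := by
    rw [← Complex.normSq_eq_norm_sq, Complex.normSq_apply]; simp; ring
  have hy2 : 1 ≤ z.im ^ 2 := by rw [← sq_abs]; nlinarith
  rw [e1, mul_one_div, div_le_div_iff₀ (by positivity) (by positivity)]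
  obtain ⟨h1, h2⟩ := abs_le.mp hz
  have hk : (0 : ℝ) ≤ k := k.cast_nonneg
  have h3 : ((k : ℝ) + 1) ^ 2 ≤ 2 * (z.re + k) ^ 2 + 2 * (1 - z.re) ^ 2 := by
    nlinarith [sq_nonneg ((z.re + k) - (1 - z.re))]
  have h4 : (1 - z.re) ^ 2 ≤ (M + 1) ^ 2 := by nlinarith
  have h5 : 1 ≤ (M + 1) ^ 2 := by nlinarith
  nlinarith [sq_nonneg (z.re + k), mul_nonneg (sub_nonneg.mpr h5) (sq_nonneg (z.re + k)),
    mul_nonneg (sq_nonneg (M+1)) (sub_nonneg.mpr hy2)]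

lemma gamma_ratio (M : ℝ) (hM : 0 ≤ M) : ∃ K : ℝ, 0 < K ∧ ∀ (z : ℂ) (h : ℝ), |z.re| ≤ M →
    |h| ≤ M → 1 ≤ |z.im| →
    ‖Complex.Gamma z‖ ≤ K * |z.im| ^ (-h) * ‖Complex.Gamma (z + h)‖ := by
  obtain ⟨Q, hQ0, hQ⟩ := gA_sq M hM
  set Lc : ℝ := Real.log 2 + Real.log (M + 1) + Q / 2 with hL
  have hlog2 : 0 ≤ Real.log 2 := Real.log_nonneg (by norm_num)
  have hlogM : 0 ≤ Real.log (M + 1) := Real.log_nonneg (by linarith)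
  refine ⟨Real.exp (M * Lc + M ^ 2 / 2 * Q), Real.exp_pos _, fun z h hz hh hy => ?_⟩
  have hy0 : z.im ≠ 0 := fun e => by rw [e] at hy; norm_num at hy
  have hypos : 0 < |z.im| := by linarith
  have t1 := (Complex.GammaSeq_tendsto_Gamma z).norm
  have t2 := ((Complex.GammaSeq_tendsto_Gamma (z + h)).norm).const_mul
    (Real.exp (M * Lc + M ^ 2 / 2 * Q) * |z.im| ^ (-h))
  refine le_of_tendsto_of_tendsto t1 t2 ?_
  filter_upwards [Filter.eventually_ge_atTop (⌈2 * ‖z‖⌉₊ + 1)] with n hn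
  have hnz : 2 * ‖z‖ ≤ n := (Nat.le_ceil _).trans (by exact_mod_cast (by omega))
  have hn1 : (1 : ℝ) ≤ n := by exact_mod_cast (by omega)
  have hn0 : (0 : ℝ) < n := by linarith
  set R := ∑ k ∈ Finset.range (n + 1), (z + k).re / ‖z + k‖ ^ 2 with hR
  have hq := hQ z hz hy (n + 1)
  have hq0 : 0 ≤ ∑ k ∈ Finset.range (n + 1), 1 / ‖z + k‖ ^ 2 :=
    Finset.sum_nonneg fun _ _ => by positivity
  have hup := gA_up z hy0 n
  have hlo := gA_lo z hy0 (n + 1)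
  have hpr := gA_prod z hy0 h (n + 1)
  rw [← hR] at hup hlo hpr
  set q := ∑ k ∈ Finset.range (n + 1), 1 / ‖z + k‖ ^ 2 with hqd
  have hyz : |z.im| ≤ ‖z‖ := Complex.abs_im_le_norm z
  have hR1 : R - Real.log n ≤ - Real.log |z.im| + Lc := by
    have a1 : |z.im| ≤ ‖z - 1‖ := by simpa using Complex.abs_im_le_norm (z - 1)
    have a2 : ‖z + n‖ ≤ 2 * n := (norm_add_le _ _).trans (by
      rw [Complex.norm_natCast]; linarith)
    have a3 : |z.im| ≤ 2 * n * Real.exp (-R + q / 2) :=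
      a1.trans (hup.trans (mul_le_mul_of_nonneg_right a2 (Real.exp_pos _).le))
    have a4 := Real.log_le_log hypos a3
    rw [Real.log_mul (by positivity) (Real.exp_pos _).ne', Real.log_exp,
      Real.log_mul (by norm_num) (by positivity)] at a4
    linarith
  have hR2 : - Real.log |z.im| - Lc ≤ R - Real.log n := by
    have a1 : ‖z‖ ≤ (M + 1) * |z.im| := by
      refine (Complex.norm_le_abs_re_add_abs_im z).trans ?_
      nlinarith
    have a2 : (n : ℝ) / 2 ≤ ‖z + (n + 1 : ℕ)‖ := by
      have := norm_sub_norm_le ((n + 1 : ℕ) : ℂ) (-z)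
      rw [Complex.norm_natCast, norm_neg, sub_neg_eq_add, add_comm _ z] at this
      push_cast at this ⊢
      linarith
    have a3 : (n : ℝ) / 2 ≤ (M + 1) * |z.im| * Real.exp (R + q / 2) :=
      a2.trans (hlo.trans (mul_le_mul_of_nonneg_right a1 (Real.exp_pos _).le))
    have a4 := Real.log_le_log (by positivity) a3
    rw [Real.log_mul (by positivity) (Real.exp_pos _).ne', Real.log_exp,
      Real.log_div (by positivity) (by norm_num),
      Real.log_mul (by positivity) (by positivity)] at a4
    linarith
  have hLc : 0 ≤ Lc := by positivity
  have hRh : h * (R - Real.log n) ≤ -h * Real.log |z.im| + M * Lc := by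
    have b1 : |R - Real.log n + Real.log (|z.im|)| ≤ Lc := abs_le.mpr ⟨by linarith, by linarith⟩
    have b2 : h * (R - Real.log n + Real.log |z.im|) ≤ M * Lc :=
      (le_abs_self _).trans (by rw [abs_mul]; gcongr)
    linarith
  have hh2 : h ^ 2 / 2 * q ≤ M ^ 2 / 2 * Q := by
    have : h ^ 2 ≤ M ^ 2 := by rw [← sq_abs]; gcongr
    gcongr
  have hP : 0 < ∏ k ∈ Finset.range (n + 1), ‖z + k‖ := Finset.prod_pos fun k _ =>
    norm_pos_iff.mpr fun e => hy0 (by simpa using congrArg Complex.im e)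
  have hP' : 0 < ∏ k ∈ Finset.range (n + 1), ‖z + h + k‖ := Finset.prod_pos fun k _ =>
    norm_pos_iff.mpr fun e => hy0 (by simpa using congrArg Complex.im e)
  have hnorm : ∀ w : ℂ, ‖Complex.GammaSeq w n‖ =
      (n : ℝ) ^ w.re * (n.factorial : ℝ) / ∏ k ∈ Finset.range (n + 1), ‖w + k‖ := by
    intro w
    rw [Complex.GammaSeq, norm_div, norm_mul, Complex.norm_natCast_cpow_of_pos (by omega),
      Complex.norm_natCast, norm_prod]
  rw [hnorm, hnorm]
  have key : (∏ k ∈ Finset.range (n + 1), ‖z + h + k‖) ≤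
      (∏ k ∈ Finset.range (n + 1), ‖z + k‖) *
      (Real.exp (M * Lc + M ^ 2 / 2 * Q) * |z.im| ^ (-h) * (n : ℝ) ^ h) := by
    refine hpr.trans (mul_le_mul_of_nonneg_left ?_ hP.le)
    rw [Real.rpow_def_of_pos hypos, Real.rpow_def_of_pos hn0, ← Real.exp_add, ← Real.exp_add]
    apply Real.exp_le_exp.mpr
    linarith
  have hre : (z + h).re = z.re + h := by simp
  rw [hre, Real.rpow_add hn0, mul_div_assoc', div_le_div_iff₀ hP hP']
  have hc : 0 ≤ (n : ℝ) ^ z.re * n.factorial := by positivity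
  refine (mul_le_mul_of_nonneg_left key hc).trans (le_of_eq ?_)
  ring

lemma mB_conv (f : ℝ → ℂ) (A C b : ℝ) (hcont : ContinuousOn f (Ioi 0))
    (hb : ∀ t : ℝ, 0 < t → ‖f t‖ ≤ C * t ^ (-b))
    (ht : ∀ t : ℝ, 0 < t → ‖f t‖ ≤ C * t ^ (-A)) :
    LocallyIntegrableOn f (Ioi 0) ∧ f =O[atTop] (fun t : ℝ => t ^ (-A)) ∧
      f =O[𝓝[>] 0] (fun t : ℝ => t ^ (-b)) := by
  refine ⟨hcont.locallyIntegrableOn measurableSet_Ioi, ?_, ?_⟩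
  · refine Asymptotics.IsBigO.of_bound C ?_
    filter_upwards [eventually_gt_atTop 0] with t h
    rw [Real.norm_of_nonneg (Real.rpow_nonneg h.le _)]
    exact ht t h
  · refine Asymptotics.IsBigO.of_bound C ?_
    filter_upwards [self_mem_nhdsWithin] with t h
    rw [Real.norm_of_nonneg (Real.rpow_nonneg (le_of_lt h) _)]
    exact hb t h

lemma mB_ibp (f f' : ℝ → ℂ) (A C b : ℝ) (hcont : ContinuousOn f (Ioi 0))
    (hcont' : ContinuousOn f' (Ioi 0))
    (hder : ∀ t : ℝ, 0 < t → HasDerivAt f (f' t) t)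
    (hb : ∀ t : ℝ, 0 < t → ‖f t‖ ≤ C * t ^ (-b))
    (ht : ∀ t : ℝ, 0 < t → ‖f t‖ ≤ C * t ^ (-A))
    (hb' : ∀ t : ℝ, 0 < t → ‖f' t‖ ≤ C * t ^ (-(b+1)))
    (ht' : ∀ t : ℝ, 0 < t → ‖f' t‖ ≤ C * t ^ (-A))
    (v : ℂ) (h0 : v ≠ 0) (hv1 : b < v.re) (hv2 : v.re + 1 < A) :
    v * mellin f v = - mellin f' (v + 1) := by
  obtain ⟨l1, l2, l3⟩ := mB_conv f A C b hcont hb ht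
  obtain ⟨l1', l2', l3'⟩ := mB_conv f' A C (b+1) hcont' hb' ht'
  have c1 : MellinConvergent f v := mellinConvergent_of_isBigO_rpow l1 l2 (by linarith) l3 hv1
  have c2 : MellinConvergent f' (v + 1) :=
    mellinConvergent_of_isBigO_rpow l1' l2' (by simpa using hv2) l3' (by simpa using hv1)
  have key := integral_Ioi_mul_deriv_eq_deriv_mul (a := (0 : ℝ)) (u := fun t : ℝ => (t : ℂ) ^ v)
    (u' := fun t : ℝ => v * (t : ℂ) ^ (v - 1)) (v := f) (v' := f') (a' := 0) (b' := 0)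
    ?_ ?_ ?_ ?_ ?_ ?_
  · simp only [mellin, smul_eq_mul, add_sub_cancel_right]
    rw [key, ← integral_const_mul]
    simp [mul_assoc]
  · intro x hx
    exact hasDerivAt_ofReal_cpow_const (ne_of_gt hx) h0
  · exact fun x hx => hder x hx
  · have := c2
    simp only [MellinConvergent, smul_eq_mul, add_sub_cancel_right] at this
    exact this
  · have := Integrable.const_mul c1 v
    refine this.congr (Eventually.of_forall fun x => ?_)
    simp [mul_assoc]
  · have hlim : Tendsto (fun t : ℝ => C * t ^ (v.re - b)) (𝓝[>] 0) (𝓝 0) := by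
      have := (Real.continuousAt_rpow_const 0 (v.re - b) (Or.inr (by linarith))).tendsto.const_mul C
      rw [Real.zero_rpow (by linarith), mul_zero] at this
      exact this.mono_left nhdsWithin_le_nhds
    refine squeeze_zero_norm' ?_ hlim
    filter_upwards [self_mem_nhdsWithin] with t h
    have h' : 0 < t := h
    simp only [Pi.mul_apply, norm_mul]
    rw [Complex.norm_cpow_eq_rpow_re_of_pos h', sub_eq_add_neg, Real.rpow_add h']
    nlinarith [mul_le_mul_of_nonneg_left (hb t h') (Real.rpow_nonneg h'.le v.re)]
  · have hlim : Tendsto (fun t : ℝ => C * t ^ (-(A - v.re))) atTop (𝓝 0) := by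
      have := (tendsto_rpow_neg_atTop (y := A - v.re) (by linarith)).const_mul C
      rwa [mul_zero] at this
    refine squeeze_zero_norm' ?_ hlim
    filter_upwards [eventually_gt_atTop 0] with t h'
    simp only [Pi.mul_apply, norm_mul]
    rw [Complex.norm_cpow_eq_rpow_re_of_pos h', neg_sub, sub_eq_add_neg, Real.rpow_add h']
    nlinarith [mul_le_mul_of_nonneg_left (ht t h') (Real.rpow_nonneg h'.le v.re)]

lemma mB_iter (f : ℕ → ℝ → ℂ) (A C : ℝ)
    (hcont : ∀ j ≤ 12, ContinuousOn (f j) (Ioi 0))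
    (hder : ∀ j < 12, ∀ t : ℝ, 0 < t → HasDerivAt (f j) (f (j + 1) t) t)
    (hb : ∀ j ≤ 12, ∀ t : ℝ, 0 < t → ‖f j t‖ ≤ C * t ^ (-((j : ℝ) - 12)))
    (ht : ∀ j ≤ 12, ∀ t : ℝ, 0 < t → ‖f j t‖ ≤ C * t ^ (-A))
    (u : ℂ) (hu0 : u.im ≠ 0) (hu1 : -12 < u.re) (j : ℕ) (hj : j ≤ 12) (hu2 : u.re + j < A) :
    |u.im| ^ j * ‖mellin (f 0) u‖ ≤ ‖mellin (f j) (u + j)‖ := by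
  induction j with
  | zero => simp
  | succ j ih =>
    push_cast at hu2
    have ih := ih (by omega) (by linarith)
    have := mB_ibp (f j) (f (j + 1)) A C ((j : ℝ) - 12) (hcont j (by omega))
      (hcont _ hj) (hder j (by omega)) (hb j (by omega)) (ht j (by omega))
      (by have := hb (j + 1) hj
          push_cast at this
          rwa [show (j : ℝ) - 12 + 1 = (j : ℝ) + 1 - 12 by ring]) (ht _ hj) (u + j)
      (fun e => hu0 (by simpa using congrArg Complex.im e)) (by simp; linarith)
      (by simp; linarith)
    have h2 := congrArg norm this
    rw [norm_neg, norm_mul] at h2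
    push_cast
    rw [← add_assoc, ← h2, pow_succ]
    have h3 : |u.im| ≤ ‖u + j‖ := by simpa using Complex.abs_im_le_norm (u + j)
    calc |u.im| ^ j * |u.im| * ‖mellin (f 0) u‖ = |u.im| * (|u.im| ^ j * ‖mellin (f 0) u‖) := by ring
      _ ≤ ‖u + j‖ * ‖mellin (f j) (u + j)‖ := by gcongr

lemma mB_unif (f : ℝ → ℂ) (A C b : ℝ) (hcont : ContinuousOn f (Ioi 0))
    (hb : ∀ t : ℝ, 0 < t → ‖f t‖ ≤ C * t ^ (-b))
    (ht : ∀ t : ℝ, 0 < t → ‖f t‖ ≤ C * t ^ (-A)) (c d : ℝ) (hc : b < c) (hd : d < A)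
    (hcd : c ≤ d) :
    ∃ K : ℝ, ∀ v : ℂ, c ≤ v.re → v.re ≤ d → ‖mellin f v‖ ≤ K := by
  obtain ⟨l1, l2, l3⟩ := mB_conv f A C b hcont hb ht
  have c1 : MellinConvergent f (c : ℂ) :=
    mellinConvergent_of_isBigO_rpow l1 l2 (by simp; linarith) l3 (by simpa using hc)
  have c2 : MellinConvergent f (d : ℂ) :=
    mellinConvergent_of_isBigO_rpow l1 l2 (by simpa using hd) l3 (by simp; linarith)
  refine ⟨∫ t in Ioi (0 : ℝ), (‖(t : ℂ) ^ ((c : ℂ) - 1) • f t‖ + ‖(t : ℂ) ^ ((d : ℂ) - 1) • f t‖),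
    fun v h1 h2 => ?_⟩
  refine norm_integral_le_of_norm_le (c1.norm.add c2.norm) ?_
  refine (ae_restrict_iff' measurableSet_Ioi).mpr (Eventually.of_forall fun t h => ?_)
  have h' : 0 < t := h
  simp only [norm_smul]
  rw [Complex.norm_cpow_eq_rpow_re_of_pos h', Complex.norm_cpow_eq_rpow_re_of_pos h',
    Complex.norm_cpow_eq_rpow_re_of_pos h', ← add_mul]
  refine mul_le_mul_of_nonneg_right ?_ (norm_nonneg _)
  simp only [Complex.sub_re, Complex.one_re, Complex.ofReal_re]
  have p1 := Real.rpow_nonneg h'.le (c - 1)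
  have p2 := Real.rpow_nonneg h'.le (d - 1)
  rcases le_total 1 t with ht1 | ht1
  · have := Real.rpow_le_rpow_of_exponent_le ht1 (show v.re - 1 ≤ d - 1 by linarith)
    linarith
  · have := Real.rpow_le_rpow_of_exponent_ge h' ht1 (show c - 1 ≤ v.re - 1 by linarith)
    linarith

/-- all facts about `φ` -/
lemma mB_phi (A C : ℝ) (hA : 12 < A)
    (φ : ℝ → ℂ) (hφ : ContDiffOn ℝ (⊤ : ℕ∞) φ (Set.Ici 0))
    (hφ0 : ∀ j : ℕ, j ≤ 12 → iteratedDerivWithin j φ (Set.Ici 0) 0 = 0)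
    (hφb : ∀ j : ℕ, j ≤ 12 → ∀ x : ℝ, 0 ≤ x →
      ‖iteratedDerivWithin j φ (Set.Ici 0) x‖ ≤ C * (1 + x) ^ (-A)) :
    (∀ u : ℂ, -12 < u.re → u.re < A → DifferentiableAt ℂ (mellin φ) u) ∧
    ∀ j : ℕ, j ≤ 12 → ∀ c d : ℝ, -12 < c → d + j < A → c ≤ d →
      ∃ K : ℝ, ∀ u : ℂ, c ≤ u.re → u.re ≤ d → u.im ≠ 0 → |u.im| ^ j * ‖mellin φ u‖ ≤ K := by
  set f : ℕ → ℝ → ℂ := fun j => iteratedDerivWithin j φ (Ici 0) with hf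
  have hC : 0 ≤ C := by
    have := (norm_nonneg _).trans (hφb 0 (by omega) 0 le_rfl)
    simpa using this
  have hcont0 : ∀ j, ContinuousOn (f j) (Ici 0) := fun j =>
    hφ.continuousOn_iteratedDerivWithin (by exact_mod_cast le_top) (uniqueDiffOn_Ici 0)
  have hcont : ∀ j ≤ 12, ContinuousOn (f j) (Ioi 0) := fun j _ =>
    (hcont0 j).mono Ioi_subset_Ici_self
  have hderW : ∀ j, ∀ t : ℝ, 0 ≤ t → HasDerivWithinAt (f j) (f (j + 1) t) (Ici 0) t := by
    intro j t h
    have h1 := hφ.differentiableOn_iteratedDerivWithin (m := j)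
      (by exact_mod_cast (WithTop.coe_lt_top _)) (uniqueDiffOn_Ici 0) t h
    have h2 := h1.hasDerivWithinAt
    rwa [← iteratedDerivWithin_succ] at h2
  have hder : ∀ j < 12, ∀ t : ℝ, 0 < t → HasDerivAt (f j) (f (j + 1) t) t := fun j _ t h =>
    (hderW j t h.le).hasDerivAt (Ici_mem_nhds h)
  have hpow : ∀ m ≤ 12, ∀ t : ℝ, 0 ≤ t → ‖f (12 - m) t‖ ≤ C * t ^ m := by
    intro m
    induction m with
    | zero =>
      intro _ t h
      refine (hφb 12 le_rfl t h).trans ?_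
      rw [pow_zero]
      refine mul_le_mul_of_nonneg_left ?_ hC
      exact Real.rpow_le_one_of_one_le_of_nonpos (by linarith) (by linarith)
    | succ m ih =>
      intro hm t h
      have ih := ih (by omega)
      have e : 12 - (m + 1) + 1 = 12 - m := by omega
      have := norm_image_sub_le_of_norm_deriv_le_segment' (f := f (12 - (m + 1)))
        (f' := f (12 - m)) (a := 0) (b := t) (C := C * t ^ m)
        (fun x hx => by
          have := hderW (12 - (m + 1)) x hx.1
          rw [e] at this
          exact this.mono Icc_subset_Ici_self)
        (fun x hx => (ih x hx.1).trans (by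
          have := hx.1
          have := hx.2.le
          gcongr)) t ⟨h, le_rfl⟩
      have h0 : f (12 - (m + 1)) 0 = 0 := hφ0 _ (by omega)
      rw [h0, sub_zero, sub_zero] at this
      rw [pow_succ, ← mul_assoc]
      exact this
  have hb : ∀ j ≤ 12, ∀ t : ℝ, 0 < t → ‖f j t‖ ≤ C * t ^ (-((j : ℝ) - 12)) := by
    intro j hj t h
    have := hpow (12 - j) (by omega) t h.le
    rw [show 12 - (12 - j) = j by omega, ← Real.rpow_natCast, Nat.cast_sub hj] at this
    rwa [neg_sub]
  have ht : ∀ j ≤ 12, ∀ t : ℝ, 0 < t → ‖f j t‖ ≤ C * t ^ (-A) := by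
    intro j hj t h
    refine (hφb j hj t h.le).trans (mul_le_mul_of_nonneg_left ?_ hC)
    exact Real.rpow_le_rpow_of_nonpos h (by linarith) (by linarith)
  have hf0 : f 0 = φ := by simp [hf]
  refine ⟨fun u h1 h2 => ?_, fun j hj c d hc hd hcd => ?_⟩
  · obtain ⟨l1, l2, l3⟩ := mB_conv (f 0) A C _ (hcont 0 (by omega)) (hb 0 (by omega))
      (ht 0 (by omega))
    rw [← hf0]
    exact mellin_differentiableAt_of_isBigO_rpow l1 l2 h2 l3 (by simpa using h1)
  · obtain ⟨K, hK⟩ := mB_unif (f j) A C _ (hcont j hj) (hb j hj) (ht j hj) (c + j) (d + j)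
      (by linarith) hd (by linarith)
    refine ⟨K, fun u h1 h2 h3 => ?_⟩
    rw [← hf0]
    refine (mB_iter f A C hcont hder hb ht u h3 (by linarith) j hj (by linarith)).trans ?_
    exact hK _ (by simpa using h1) (by simpa using h2)

noncomputable def FG (G : ℝ → ℂ) (α : ℂ) (x : ℝ) : ℂ :=
  ∫ t : ℝ, G t * ((x / 2 : ℝ) : ℂ) ^ (α + t * Complex.I)

lemma fg_int_bd (p : ℝ) (hp : 1 < p) : Integrable (fun t : ℝ => (1 + |t|) ^ (-p)) := by
  have := integrable_one_add_norm (E := ℝ) (μ := volume) (r := p) (by simpa using hp)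
  simpa using this

lemma fg_norm (x : ℝ) (hx : 0 < x) (α : ℂ) (t : ℝ) :
    ‖((x / 2 : ℝ) : ℂ) ^ (α + t * Complex.I)‖ = (x / 2) ^ α.re := by
  rw [Complex.norm_cpow_eq_rpow_re_of_pos (by positivity)]
  simp

lemma fg_cont (x : ℝ) (hx : 0 < x) (α : ℂ) :
    Continuous (fun t : ℝ => ((x / 2 : ℝ) : ℂ) ^ (α + t * Complex.I)) := by
  have : ((x / 2 : ℝ) : ℂ) ≠ 0 := by exact_mod_cast (by positivity)
  exact Continuous.const_cpow (by fun_prop) (Or.inl this)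

lemma fg_integrable (G : ℝ → ℂ) (hG : Continuous G) (K p : ℝ) (hp : 1 < p)
    (hb : ∀ t, ‖G t‖ ≤ K * (1 + |t|) ^ (-p)) (α : ℂ) (x : ℝ) (hx : 0 < x) :
    Integrable (fun t : ℝ => G t * ((x / 2 : ℝ) : ℂ) ^ (α + t * Complex.I)) := by
  refine (((fg_int_bd p hp).const_mul K).mul_const ((x / 2) ^ α.re)).mono'
    (hG.mul (fg_cont x hx α)).aestronglyMeasurable (Eventually.of_forall fun t => ?_)
  rw [norm_mul, fg_norm x hx]
  exact mul_le_mul_of_nonneg_right (hb t) (by positivity)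

lemma fg_bound (G : ℝ → ℂ) (K p : ℝ) (hp : 1 < p)
    (hb : ∀ t, ‖G t‖ ≤ K * (1 + |t|) ^ (-p)) (α : ℂ) :
    ∃ K' : ℝ, 0 ≤ K' ∧ ∀ x : ℝ, 0 < x → ‖FG G α x‖ ≤ K' * (x / 2) ^ α.re := by
  refine ⟨|∫ t : ℝ, K * (1 + |t|) ^ (-p)|, abs_nonneg _, fun x hx => ?_⟩
  have h1 : ‖FG G α x‖ ≤ ∫ t : ℝ, K * (1 + |t|) ^ (-p) * (x / 2) ^ α.re := by
    refine norm_integral_le_of_norm_le (((fg_int_bd p hp).const_mul K).mul_const _)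
      (Eventually.of_forall fun t => ?_)
    rw [norm_mul, fg_norm x hx]
    exact mul_le_mul_of_nonneg_right (hb t) (by positivity)
  rw [integral_mul_const] at h1
  exact h1.trans (mul_le_mul_of_nonneg_right (le_abs_self _) (by positivity))

/-- local bound of powers -/
lemma fg_pow_bd (x y e : ℝ) (hx : 0 < x) (hy : y ∈ Ioo (x / 2) (2 * x)) :
    (y / 2) ^ e ≤ (x / 4) ^ e + x ^ e := by
  obtain ⟨h1, h2⟩ := hy
  rcases le_total 0 e with he | he
  · have : (y / 2) ^ e ≤ x ^ e := Real.rpow_le_rpow (by linarith) (by linarith) he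
    have : 0 ≤ (x / 4) ^ e := by positivity
    linarith
  · have : (y / 2) ^ e ≤ (x / 4) ^ e :=
      Real.rpow_le_rpow_of_nonpos (by linarith) (by linarith) he
    have : 0 ≤ x ^ e := by positivity
    linarith

lemma fg_continuousAt (G : ℝ → ℂ) (hG : Continuous G) (K p : ℝ) (hp : 1 < p)
    (hb : ∀ t, ‖G t‖ ≤ K * (1 + |t|) ^ (-p)) (α : ℂ) (x : ℝ) (hx : 0 < x) :
    ContinuousAt (FG G α) x := by
  have hn : Ioo (x / 2) (2 * x) ∈ 𝓝 x := Ioo_mem_nhds (by linarith) (by linarith)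
  refine continuousAt_of_dominated (bound := fun t => K * (1 + |t|) ^ (-p) *
    ((x / 4) ^ α.re + x ^ α.re)) ?_ ?_ (((fg_int_bd p hp).const_mul K).mul_const _) ?_
  · filter_upwards [hn] with y hy
    exact (hG.mul (fg_cont y (by linarith [hy.1]) α)).aestronglyMeasurable
  · filter_upwards [hn] with y hy
    refine Eventually.of_forall fun t => ?_
    rw [norm_mul, fg_norm y (by linarith [hy.1])]
    exact mul_le_mul (hb t) (fg_pow_bd x y _ hx hy)
      (Real.rpow_nonneg (by linarith [hy.1]) _) ((norm_nonneg _).trans (hb t))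
  · refine Eventually.of_forall fun t => ?_
    refine continuousAt_const.mul ?_
    refine ContinuousAt.cpow (by fun_prop) continuousAt_const ?_
    left
    rw [Complex.ofReal_re]; positivity

noncomputable def GD (G : ℝ → ℂ) (α : ℂ) (t : ℝ) : ℂ := (1 / 2) * (α + t * Complex.I) * G t

lemma gd_cont (G : ℝ → ℂ) (hG : Continuous G) (α : ℂ) : Continuous (GD G α) := by
  unfold GD; fun_prop

lemma gd_bound (G : ℝ → ℂ) (K p : ℝ)
    (hb : ∀ t, ‖G t‖ ≤ K * (1 + |t|) ^ (-p)) (α : ℂ) (t : ℝ) :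
    ‖GD G α t‖ ≤ ((‖α‖ + 1) * K) * (1 + |t|) ^ (-(p - 1)) := by
  have h1 : ‖(1 / 2 : ℂ) * (α + t * Complex.I)‖ ≤ (‖α‖ + 1) * (1 + |t|) := by
    rw [norm_mul]
    have : ‖α + t * Complex.I‖ ≤ ‖α‖ + |t| := (norm_add_le _ _).trans (by simp)
    have h2 : ‖(1 / 2 : ℂ)‖ = 1 / 2 := by norm_num
    rw [h2]
    nlinarith [norm_nonneg α, abs_nonneg t, mul_nonneg (norm_nonneg α) (abs_nonneg t)]
  have h0 : 0 < 1 + |t| := by positivity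
  rw [GD, norm_mul]
  refine (mul_le_mul h1 (hb t) (norm_nonneg _) (by positivity)).trans (le_of_eq ?_)
  rw [show -(p - 1) = 1 + -p by ring, Real.rpow_add h0, Real.rpow_one]
  ring

lemma fg_hasDerivAt (G : ℝ → ℂ) (hG : Continuous G) (K p : ℝ) (hp : 2 < p)
    (hb : ∀ t, ‖G t‖ ≤ K * (1 + |t|) ^ (-p)) (α : ℂ) (x : ℝ) (hx : 0 < x) :
    HasDerivAt (FG G α) (FG (GD G α) (α - 1) x) x := by
  have hn : Ioo (x / 2) (2 * x) ∈ 𝓝 x := Ioo_mem_nhds (by linarith) (by linarith)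
  have hb' := gd_bound G K p hb α
  refine (hasDerivAt_integral_of_dominated_loc_of_deriv_le
    (F := fun (x : ℝ) (t : ℝ) => G t * ((x / 2 : ℝ) : ℂ) ^ (α + t * Complex.I))
    (F' := fun (x : ℝ) (t : ℝ) => GD G α t * ((x / 2 : ℝ) : ℂ) ^ (α - 1 + t * Complex.I))
    (bound := fun t => ((‖α‖ + 1) * K) * (1 + |t|) ^ (-(p - 1)) *
    ((x / 4) ^ (α - 1).re + x ^ (α - 1).re)) hn ?_
    (fg_integrable G hG K p (by linarith) hb α x hx) ?_ ?_
    (((fg_int_bd (p - 1) (by linarith)).const_mul _).mul_const _) ?_).2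
  · filter_upwards [hn] with y hy
    exact (hG.mul (fg_cont y (by linarith [hy.1]) α)).aestronglyMeasurable
  · exact ((gd_cont G hG α).mul (fg_cont x hx (α - 1))).aestronglyMeasurable
  · refine Eventually.of_forall fun t y hy => ?_
    rw [norm_mul, fg_norm y (by linarith [hy.1])]
    exact mul_le_mul (hb' t) (fg_pow_bd x y _ hx hy)
      (Real.rpow_nonneg (by linarith [hy.1]) _) ((norm_nonneg _).trans (hb' t))
  · refine Eventually.of_forall fun t y hy => ?_
    have hy0 : 0 < y := by linarith [hy.1]
    have h1 : HasDerivAt (fun y : ℝ => ((y / 2 : ℝ) : ℂ)) (1 / 2) y := by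
      have := ((hasDerivAt_id y).div_const 2).ofReal_comp
      simpa using this
    have hsl : ((y / 2 : ℝ) : ℂ) ∈ Complex.slitPlane := by
      left; rw [Complex.ofReal_re]; positivity
    have h3 : HasDerivAt (fun z : ℂ => z ^ (α + t * Complex.I))
        ((α + t * Complex.I) * ((y / 2 : ℝ) : ℂ) ^ (α + t * Complex.I - 1) * 1)
        ((y / 2 : ℝ) : ℂ) := (hasDerivAt_id _).cpow_const hsl
    have h2 := (HasDerivAt.comp y h3 h1).const_mul (G t)
    refine h2.congr_deriv ?_
    rw [GD, show α + t * Complex.I - 1 = α - 1 + t * Complex.I by ring]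
    ring

/-- rectangle shift -/
lemma contour_shift (H : ℂ → ℂ) (c d K p : ℝ) (hcd : c ≤ d) (hp : 1 < p)
    (hH : ∀ u : ℂ, c ≤ u.re → u.re ≤ d → DifferentiableAt ℂ H u)
    (hb : ∀ u : ℂ, c ≤ u.re → u.re ≤ d → ‖H u‖ ≤ K * (1 + |u.im|) ^ (-p)) :
    (∀ ξ ∈ Icc c d, Integrable (fun t : ℝ => H ((ξ : ℂ) + t * Complex.I))) ∧
    ∫ t : ℝ, H ((c : ℂ) + t * Complex.I) = ∫ t : ℝ, H ((d : ℂ) + t * Complex.I) := by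
  have hint : ∀ ξ ∈ Icc c d, Integrable (fun t : ℝ => H ((ξ : ℂ) + t * Complex.I)) := by
    intro ξ hξ
    have hc : Continuous (fun t : ℝ => H ((ξ : ℂ) + t * Complex.I)) := by
      rw [continuous_iff_continuousAt]
      intro t
      have h1 : ContinuousAt H ((ξ : ℂ) + t * Complex.I) :=
        (hH _ (by simpa using hξ.1) (by simpa using hξ.2)).continuousAt
      exact ContinuousAt.comp (f := fun t : ℝ => (ξ : ℂ) + t * Complex.I) h1 (by fun_prop)
    refine ((fg_int_bd p hp).const_mul K).mono' hc.aestronglyMeasurable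
      (Eventually.of_forall fun t => ?_)
    have := hb ((ξ : ℂ) + t * Complex.I) (by simpa using hξ.1) (by simpa using hξ.2)
    simpa using this
  refine ⟨hint, ?_⟩
  have hK : 0 ≤ K := by
    have := (norm_nonneg _).trans (hb (c : ℂ) (by simp) (by simpa using hcd))
    simpa using this
  have tc := intervalIntegral_tendsto_integral (hint c ⟨le_rfl, hcd⟩)
    tendsto_neg_atTop_atBot tendsto_id
  have td := intervalIntegral_tendsto_integral (hint d ⟨hcd, le_rfl⟩)
    tendsto_neg_atTop_atBot tendsto_id
  have hlim : Tendsto (fun T : ℝ => K * (1 + |T|) ^ (-p) * |d - c|) atTop (𝓝 0) := by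
    have h1 : Tendsto (fun T : ℝ => 1 + |T|) atTop atTop :=
      tendsto_atTop_add_const_left _ _ tendsto_abs_atTop_atTop
    have := (((tendsto_rpow_neg_atTop (by linarith : 0 < p)).comp h1).const_mul K).mul_const |d - c|
    simpa using this
  have hor : ∀ T : ℝ, ‖∫ x : ℝ in c..d, H (x + T * Complex.I)‖ ≤
      K * (1 + |T|) ^ (-p) * |d - c| := by
    intro T
    refine intervalIntegral.norm_integral_le_of_norm_le_const fun x hx => ?_
    rw [uIoc_of_le hcd] at hx
    have := hb (x + T * Complex.I) (by simpa using hx.1.le) (by simpa using hx.2)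
    simpa using this
  have h1 : Tendsto (fun T : ℝ => ∫ x : ℝ in c..d, H (x + (T : ℝ) * Complex.I)) atTop (𝓝 0) :=
    squeeze_zero_norm hor hlim
  have h2 : Tendsto (fun T : ℝ => ∫ x : ℝ in c..d, H (x + ((-T : ℝ) : ℂ) * Complex.I))
      atTop (𝓝 0) :=
    squeeze_zero_norm (fun T => by simpa using hor (-T)) hlim
  have hz := ((h2.sub h1).add (td.const_mul Complex.I)).sub (tc.const_mul Complex.I)
  have hzero : ∀ T : ℝ, (∫ x : ℝ in c..d, H (x + ((-T : ℝ) : ℂ) * Complex.I)) -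
      (∫ x : ℝ in c..d, H (x + (T : ℝ) * Complex.I)) +
      Complex.I * (∫ y : ℝ in -T..id T, H (d + y * Complex.I)) -
      Complex.I * (∫ y : ℝ in -T..id T, H (c + y * Complex.I)) = 0 := by
    intro T
    have := Complex.integral_boundary_rect_eq_zero_of_differentiableOn H
      ⟨c, -T⟩ ⟨d, T⟩ (fun u hu => by
        have h := hu.1
        simp only [mem_preimage, uIcc_of_le hcd] at h
        exact (hH u h.1 h.2).differentiableWithinAt)
    simpa using this
  have hz' := hz.congr hzero
  have := tendsto_nhds_unique hz' tendsto_const_nhds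
  have h4 : Complex.I * ((∫ t : ℝ, H ((d : ℂ) + t * Complex.I)) -
      ∫ t : ℝ, H ((c : ℂ) + t * Complex.I)) = 0 := by
    linear_combination this
  have h5 := (mul_eq_zero.mp h4).resolve_left Complex.I_ne_zero
  exact (sub_eq_zero.mp h5).symm

lemma iter_deriv (f D1 D2 : ℝ → ℂ) (h1 : ∀ x, 0 < x → HasDerivAt f (D1 x) x)
    (h2 : ∀ x, 0 < x → HasDerivAt D1 (D2 x) x) (h3 : ∀ x, 0 < x → ContinuousAt D2 x) :
    (∀ x, 0 < x → iteratedDerivWithin 1 f (Ioi 0) x = D1 x) ∧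
    (∀ x, 0 < x → iteratedDerivWithin 2 f (Ioi 0) x = D2 x) ∧ ContDiffOn ℝ 2 f (Ioi 0) := by
  have e1 : ∀ x, 0 < x → iteratedDerivWithin 1 f (Ioi 0) x = D1 x := fun x hx => by
    rw [iteratedDerivWithin_one, derivWithin_of_isOpen isOpen_Ioi hx]
    exact (h1 x hx).deriv
  have e2 : ∀ x, 0 < x → iteratedDerivWithin 2 f (Ioi 0) x = D2 x := fun x hx => by
    rw [iteratedDerivWithin_succ, derivWithin_congr (s := Ioi 0) (f := D1) (fun y hy => e1 y hy) (e1 x hx),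
      derivWithin_of_isOpen isOpen_Ioi hx]
    exact (h2 x hx).deriv
  refine ⟨e1, e2, ?_⟩
  refine contDiffOn_of_continuousOn_differentiableOn_deriv (n := 2) ?_ ?_
  · intro m hm
    have hm' : m ≤ 2 := by exact_mod_cast hm
    interval_cases m
    · rw [iteratedDerivWithin_zero]
      exact fun x hx => (h1 x hx).continuousAt.continuousWithinAt
    · exact ContinuousOn.congr (f := D1)
        (fun x hx => (h2 x hx).continuousAt.continuousWithinAt) (fun x hx => e1 x hx)
    · exact ContinuousOn.congr (f := D2)
        (fun x hx => (h3 x hx).continuousWithinAt) (fun x hx => e2 x hx)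
  · intro m hm
    have hm' : m < 2 := by exact_mod_cast hm
    interval_cases m
    · rw [iteratedDerivWithin_zero]
      exact fun x hx => (h1 x hx).differentiableAt.differentiableWithinAt
    · exact DifferentiableOn.congr (f := D1)
        (fun x hx => (h2 x hx).differentiableAt.differentiableWithinAt) (fun x hx => e1 x hx)

noncomputable def Gk (κ : ℕ) (s : ℂ) (φ : ℝ → ℂ) (u : ℂ) : ℂ :=
  mellinT φ u * (2 : ℂ) ^ (-u) *
    (Complex.Gamma (((κ : ℂ) + 1) / 2 - s - u / 2) /
      Complex.Gamma (((κ : ℂ) - 1) / 2 + s + u / 2)) ^ 2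

lemma mellinT_eq (φ : ℝ → ℂ) : mellinT φ = mellin φ := by
  funext u; simp [mellinT, mellin]

lemma gk_diff (φ : ℝ → ℂ) (κ : ℕ) (hκ12 : 12 ≤ κ) (s : ℂ) (hs2 : s.re ≤ 5 / 4 + 1 / 100)
    (u : ℂ) (hu : u.re < 10) (hm : DifferentiableAt ℂ (mellin φ) u) :
    DifferentiableAt ℂ (Gk κ s φ) u := by
  have hk : (12 : ℝ) ≤ κ := by exact_mod_cast hκ12
  have h2 : DifferentiableAt ℂ (fun u : ℂ => (2 : ℂ) ^ (-u)) u :=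
    DifferentiableAt.const_cpow (by fun_prop) (Or.inl two_ne_zero)
  have h3 : DifferentiableAt ℂ (fun u : ℂ => Complex.Gamma (((κ : ℂ) + 1) / 2 - s - u / 2)) u := by
    have : DifferentiableAt ℂ Complex.Gamma (((κ : ℂ) + 1) / 2 - s - u / 2) := by
      refine Complex.differentiableAt_Gamma _ fun m e => ?_
      have := congrArg Complex.re e
      simp at this
      have hm : (0 : ℝ) ≤ m := m.cast_nonneg
      linarith
    exact DifferentiableAt.comp (f := fun u : ℂ => ((κ : ℂ) + 1) / 2 - s - u / 2) u this
      (by fun_prop)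
  have h4 : DifferentiableAt ℂ
      (fun u : ℂ => (Complex.Gamma (((κ : ℂ) - 1) / 2 + s + u / 2))⁻¹) u := by
    exact DifferentiableAt.comp (f := fun u : ℂ => ((κ : ℂ) - 1) / 2 + s + u / 2) u
      (Complex.differentiable_one_div_Gamma _) (by fun_prop)
  unfold Gk
  simp only [div_eq_mul_inv] at h3 h4 ⊢
  rw [mellinT_eq]
  exact (hm.mul h2).mul ((h3.mul h4).pow 2)

lemma rpow_compare (a b e L : ℝ) (hL : 1 ≤ L) (hb : 0 < b) (h1 : b ≤ L * a) (h2 : a ≤ L * b) :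
    a ^ e ≤ L ^ |e| * b ^ e := by
  have ha : 0 < a := by
    by_contra h
    push Not at h
    nlinarith
  have hL0 : 0 < L := by linarith
  rcases le_total 0 e with he | he
  · rw [abs_of_nonneg he, ← Real.mul_rpow hL0.le hb.le]
    exact Real.rpow_le_rpow ha.le h2 he
  · rw [abs_of_nonpos he, Real.rpow_neg hL0.le, ← Real.inv_rpow hL0.le,
      ← Real.mul_rpow (by positivity) hb.le]
    refine Real.rpow_le_rpow_of_nonpos (by positivity) ?_ he
    rw [inv_mul_le_iff₀ hL0]
    exact h1

lemma gk_ratio (κ : ℕ) (s : ℂ) (c d : ℝ) : ∃ K : ℝ, 0 < K ∧ ∀ u : ℂ, c ≤ u.re → u.re ≤ d →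
    2 + 4 * |s.im| ≤ |u.im| →
    ‖Complex.Gamma (((κ : ℂ) + 1) / 2 - s - u / 2) /
      Complex.Gamma (((κ : ℂ) - 1) / 2 + s + u / 2)‖ ≤ K * |u.im| ^ (1 - 2 * s.re - u.re) := by
  set M : ℝ := κ + 1 + 2 * |s.re| + |c| + |d| with hM
  have hM0 : 0 ≤ M := by positivity
  obtain ⟨K, hK, hG⟩ := gamma_ratio M hM0
  refine ⟨K * 4 ^ M, by positivity, fun u h1 h2 h3 => ?_⟩
  have hk : (0 : ℝ) ≤ κ := κ.cast_nonneg
  have c1 := neg_abs_le c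
  have d1 := le_abs_self d
  have c0 := abs_nonneg c
  have d0 := abs_nonneg d
  have s1 := neg_abs_le s.re
  have s2 := le_abs_self s.re
  have y1 := neg_abs_le s.im
  have y2 := le_abs_self s.im
  set z : ℂ := (starRingEnd ℂ) (((κ : ℂ) + 1) / 2 - s - u / 2) with hz
  set h : ℝ := 2 * s.re + u.re - 1 with hh
  have zre : z.re = ((κ : ℝ) + 1) / 2 - s.re - u.re / 2 := by
    rw [hz, Complex.conj_re]; simp
  have zim : z.im = s.im + u.im / 2 := by
    rw [hz, Complex.conj_im]; simp; ring
  have zh : z + h = ((κ : ℂ) - 1) / 2 + s + u / 2 := by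
    apply Complex.ext
    · rw [Complex.add_re, zre]; simp [hh]; ring
    · rw [Complex.add_im, zim]; simp
  have hhM : |h| ≤ M := by rw [abs_le]; constructor <;> simp only [hh, hM] <;> linarith
  have hzM : |z.re| ≤ M := by
    rw [zre, abs_le]; constructor <;> simp only [hM] <;> linarith
  have hlow : |u.im| ≤ 4 * |z.im| := by
    rw [zim]
    have := abs_sub_abs_le_abs_sub (u.im / 2) (-s.im)
    rw [abs_neg, abs_div, abs_two, sub_neg_eq_add, add_comm] at this
    have h5 : |s.im + u.im / 2| = |s.im + u.im / 2| := rfl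
    rw [add_comm] at this
    rw [add_comm (u.im / 2)] at this
    linarith
  have hup : |z.im| ≤ 4 * |u.im| := by
    rw [zim]
    have := abs_add_le s.im (u.im / 2)
    rw [abs_div, abs_two] at this
    linarith [abs_nonneg s.im]
  have hu0 : 0 < |u.im| := by linarith [abs_nonneg s.im]
  have hz1 : 1 ≤ |z.im| := by
    rw [zim]
    have := abs_sub_abs_le_abs_sub (u.im / 2) (-s.im)
    rw [abs_neg, abs_div, abs_two, sub_neg_eq_add, add_comm (u.im / 2)] at this
    linarith [abs_nonneg s.im]
  have key := hG z h hzM hhM hz1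
  rw [zh, hz, Complex.Gamma_conj, Complex.norm_conj, ← hz] at key
  rw [norm_div]
  have hcmp := rpow_compare |z.im| |u.im| (-h) 4 (by norm_num) hu0 hlow hup
  rw [abs_neg] at hcmp
  have hcmp2 : |z.im| ^ (-h) ≤ 4 ^ M * |u.im| ^ (-h) := by
    refine hcmp.trans (mul_le_mul_of_nonneg_right ?_ (by positivity))
    exact Real.rpow_le_rpow_of_exponent_le (by norm_num) hhM
  refine div_le_of_le_mul₀ (norm_nonneg _) (by positivity) (key.trans ?_)
  refine mul_le_mul_of_nonneg_right ?_ (norm_nonneg _)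
  rw [show 1 - 2 * s.re - u.re = -h by simp only [hh]; ring, mul_assoc]
  exact mul_le_mul_of_nonneg_left hcmp2 hK.le

lemma gk_bound (φ : ℝ → ℂ) (κ : ℕ) (s : ℂ) (c d : ℝ) (j : ℕ)
    (hdiff : ∀ u : ℂ, c ≤ u.re → u.re ≤ d → DifferentiableAt ℂ (Gk κ s φ) u)
    (hm : ∃ K : ℝ, ∀ u : ℂ, c ≤ u.re → u.re ≤ d → u.im ≠ 0 → |u.im| ^ j * ‖mellin φ u‖ ≤ K) :
    ∃ K : ℝ, ∀ u : ℂ, c ≤ u.re → u.re ≤ d →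
      ‖Gk κ s φ u‖ ≤ K * (1 + |u.im|) ^ (-((j : ℝ) - 2 + 4 * s.re + 2 * c)) := by
  obtain ⟨K1, hK1⟩ := hm
  obtain ⟨K2, hK2, hR⟩ := gk_ratio κ s c d
  set T : ℝ := 2 + 4 * |s.im| with hT
  have hT2 : 2 ≤ T := by linarith [abs_nonneg s.im]
  set P : ℝ := (j : ℝ) - 2 + 4 * s.re + 2 * c with hP
  have hcpt : IsCompact (Icc c d ×ℂ Icc (-T) T) := isCompact_Icc.reProdIm isCompact_Icc
  obtain ⟨K3, hK3⟩ := hcpt.exists_bound_of_continuousOn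
    (f := fun u : ℂ => Gk κ s φ u * (((1 + |u.im|) ^ P : ℝ) : ℂ)) (by
      intro u hu
      have hu1 := hu.1
      refine ContinuousAt.continuousWithinAt ?_
      refine (hdiff u hu1.1 hu1.2).continuousAt.mul ?_
      refine Complex.continuous_ofReal.continuousAt.comp ?_
      refine ContinuousAt.rpow_const ?_ (Or.inl (by positivity))
      have : Continuous (fun u : ℂ => 1 + |u.im|) := by fun_prop
      exact this.continuousAt)
  refine ⟨max K3 (|K1| * 2 ^ (-c) * K2 ^ 2 * 2 ^ |-P|), fun u h1 h2 => ?_⟩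
  have hpos : 0 < 1 + |u.im| := by positivity
  have hpp : 0 < (1 + |u.im|) ^ (-P) := by positivity
  rcases le_total |u.im| T with hle | hge
  · refine le_trans ?_ (mul_le_mul_of_nonneg_right (le_max_left _ _) hpp.le)
    have := hK3 u ⟨⟨h1, h2⟩, abs_le.mp hle⟩
    rw [norm_mul, Complex.norm_real, Real.norm_of_nonneg (by positivity)] at this
    rw [Real.rpow_neg hpos.le, ← div_eq_mul_inv, le_div_iff₀ (by positivity)]
    exact this
  · refine le_trans ?_ (mul_le_mul_of_nonneg_right (le_max_right _ _) hpp.le)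
    have hu1 : 1 ≤ |u.im| := by linarith
    have hu0 : 0 < |u.im| := by linarith
    have hune : u.im ≠ 0 := abs_pos.mp hu0
    have a1 : ‖mellinT φ u‖ ≤ |K1| * |u.im| ^ (-(j : ℝ)) := by
      rw [mellinT_eq, Real.rpow_neg hu0.le, Real.rpow_natCast, ← div_eq_mul_inv,
        le_div_iff₀ (by positivity), mul_comm]
      exact (hK1 u h1 h2 hune).trans (le_abs_self _)
    have a2 : ‖(2 : ℂ) ^ (-u)‖ ≤ 2 ^ (-c) := by
      have := Complex.norm_cpow_eq_rpow_re_of_pos (x := 2) (by norm_num) (-u)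
      rw [Complex.ofReal_ofNat] at this
      rw [this, Complex.neg_re]
      exact Real.rpow_le_rpow_of_exponent_le (by norm_num) (by linarith)
    have a3 : ‖(Complex.Gamma (((κ : ℂ) + 1) / 2 - s - u / 2) /
      Complex.Gamma (((κ : ℂ) - 1) / 2 + s + u / 2)) ^ 2‖ ≤
        K2 ^ 2 * |u.im| ^ (2 - 4 * s.re - 2 * c) := by
      rw [norm_pow]
      have := pow_le_pow_left₀ (norm_nonneg _) (hR u h1 h2 hge) 2
      refine this.trans ?_
      rw [mul_pow, ← Real.rpow_mul_natCast hu0.le]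
      refine mul_le_mul_of_nonneg_left ?_ (by positivity)
      exact Real.rpow_le_rpow_of_exponent_le hu1 (by push_cast; linarith)
    have a4 : |u.im| ^ (-P) ≤ 2 ^ |-P| * (1 + |u.im|) ^ (-P) :=
      rpow_compare _ _ _ _ (by norm_num) hpos (by linarith) (by linarith)
    have e : |u.im| ^ (-P) = |u.im| ^ (-(j : ℝ)) * |u.im| ^ (2 - 4 * s.re - 2 * c) := by
      rw [← Real.rpow_add hu0]; congr 1; simp only [hP]; ring
    rw [Gk, norm_mul, norm_mul]
    calc _ ≤ (|K1| * |u.im| ^ (-(j : ℝ))) * 2 ^ (-c) *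
          (K2 ^ 2 * |u.im| ^ (2 - 4 * s.re - 2 * c)) := by gcongr
      _ = |K1| * 2 ^ (-c) * K2 ^ 2 * |u.im| ^ (-P) := by rw [e]; ring
      _ ≤ |K1| * 2 ^ (-c) * K2 ^ 2 * (2 ^ |-P| * (1 + |u.im|) ^ (-P)) := by gcongr
      _ = _ := by ring

lemma phi_calc (φ : ℝ → ℂ) (κ : ℕ) (s : ℂ) (ξ K p : ℝ) (hp : 3 < p)
    (hdiff : ∀ u : ℂ, u.re = ξ → DifferentiableAt ℂ (Gk κ s φ) u)
    (hb : ∀ u : ℂ, u.re = ξ → ‖Gk κ s φ u‖ ≤ K * (1 + |u.im|) ^ (-p)) :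
    ContDiffOn ℝ 2 (PhiFun κ s φ ξ) (Ioi 0) ∧
    ∃ K' : ℝ, 0 ≤ K' ∧ ∀ ℓ : ℕ, ℓ ≤ 2 → ∀ x : ℝ, 0 < x →
      ‖iteratedDerivWithin ℓ (PhiFun κ s φ ξ) (Ioi 0) x‖ ≤
        K' * (x / 2) ^ (ξ + 4 * s.re - 2 - ℓ) := by
  set G : ℝ → ℂ := fun t => (1 / (2 * Real.pi)) * Gk κ s φ ((ξ : ℂ) + t * Complex.I) with hG
  set α : ℂ := (ξ : ℂ) + 4 * s - 2 with hα
  have hare : α.re = ξ + 4 * s.re - 2 := by simp [hα]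
  have hF : PhiFun κ s φ ξ = FG G α := by
    funext x
    rw [PhiFun, FG, ← integral_const_mul]
    congr 1
    funext t
    simp only [hG, PhiIntegrand, Gk]
    rw [show (ξ : ℂ) + t * Complex.I + 4 * s - 2 = α + t * Complex.I by rw [hα]; ring]
    ring
  have hGc : Continuous G := by
    refine continuous_const.mul ?_
    rw [continuous_iff_continuousAt]
    intro t
    have h1 : ContinuousAt (Gk κ s φ) ((ξ : ℂ) + t * Complex.I) :=
      (hdiff _ (by simp)).continuousAt
    exact ContinuousAt.comp (f := fun t : ℝ => (ξ : ℂ) + t * Complex.I) h1 (by fun_prop)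
  have hGb : ∀ t, ‖G t‖ ≤ (‖(1 / (2 * Real.pi) : ℂ)‖ * K) * (1 + |t|) ^ (-p) := by
    intro t
    have := hb ((ξ : ℂ) + t * Complex.I) (by simp)
    simp only [hG, norm_mul, mul_assoc]
    refine mul_le_mul_of_nonneg_left ?_ (norm_nonneg _)
    simpa using this
  set K0 := ‖(1 / (2 * Real.pi) : ℂ)‖ * K
  have hGb1 := gd_bound G K0 p hGb α
  have hGc1 := gd_cont G hGc α
  have hGb2 := gd_bound _ _ _ hGb1 (α - 1)
  have hGc2 := gd_cont _ hGc1 (α - 1)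
  obtain ⟨e1, e2, hcd⟩ := iter_deriv (FG G α) (FG (GD G α) (α - 1))
    (FG (GD (GD G α) (α - 1)) (α - 1 - 1))
    (fun x hx => fg_hasDerivAt G hGc K0 p (by linarith) hGb α x hx)
    (fun x hx => fg_hasDerivAt _ hGc1 _ _ (by linarith) hGb1 _ x hx)
    (fun x hx => fg_continuousAt _ hGc2 _ _ (by linarith) hGb2 _ x hx)
  obtain ⟨k0, k0p, hk0⟩ := fg_bound G K0 p (by linarith) hGb α
  obtain ⟨k1, k1p, hk1⟩ := fg_bound _ _ _ (by linarith) hGb1 (α - 1)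
  obtain ⟨k2, k2p, hk2⟩ := fg_bound _ _ _ (by linarith) hGb2 (α - 1 - 1)
  rw [hF]
  refine ⟨hcd, k0 + k1 + k2, by positivity, fun ℓ hℓ x hx => ?_⟩
  have aux : ∀ k e : ℝ, k ≤ k0 + k1 + k2 → k * (x / 2) ^ e ≤ (k0 + k1 + k2) * (x / 2) ^ e :=
    fun k e h => mul_le_mul_of_nonneg_right h (by positivity)
  interval_cases ℓ
  · rw [iteratedDerivWithin_zero]
    refine (hk0 x hx).trans ((aux _ _ (by linarith)).trans (le_of_eq ?_))
    rw [hare]; simp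
  · rw [e1 x hx]
    refine (hk1 x hx).trans ((aux _ _ (by linarith)).trans (le_of_eq ?_))
    rw [Complex.sub_re, hare]; simp
  · rw [e2 x hx]
    refine (hk2 x hx).trans ((aux _ _ (by linarith)).trans (le_of_eq ?_))
    rw [Complex.sub_re, Complex.sub_re, hare]
    congr 2
    simp; ring

lemma phi_shift (φ : ℝ → ℂ) (κ : ℕ) (s : ℂ) (c d K p : ℝ) (hcd : c ≤ d) (hp : 1 < p)
    (hdiff : ∀ u : ℂ, c ≤ u.re → u.re ≤ d → DifferentiableAt ℂ (Gk κ s φ) u)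
    (hb : ∀ u : ℂ, c ≤ u.re → u.re ≤ d → ‖Gk κ s φ u‖ ≤ K * (1 + |u.im|) ^ (-p))
    (x : ℝ) (hx : 0 < x) :
    (∀ ξ ∈ Icc c d, Integrable (fun t : ℝ => PhiIntegrand κ s φ x ((ξ : ℂ) + t * Complex.I))) ∧
    PhiFun κ s φ c x = PhiFun κ s φ d x := by
  have hx2 : 0 < x / 2 := by positivity
  have := contour_shift (PhiIntegrand κ s φ x) c d
    (K * ((x / 2) ^ (c + 4 * s.re - 2) + (x / 2) ^ (d + 4 * s.re - 2))) p hcd hp ?_ ?_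
  · exact ⟨this.1, by rw [PhiFun, PhiFun, this.2]⟩
  · intro u h1 h2
    have hne : ((x / 2 : ℝ) : ℂ) ≠ 0 := by exact_mod_cast hx2.ne'
    have h3 : DifferentiableAt ℂ (fun u : ℂ => ((x / 2 : ℝ) : ℂ) ^ (u + 4 * s - 2)) u :=
      DifferentiableAt.const_cpow (by fun_prop) (Or.inl hne)
    exact (hdiff u h1 h2).mul h3
  · intro u h1 h2
    have e : PhiIntegrand κ s φ x u = Gk κ s φ u * ((x / 2 : ℝ) : ℂ) ^ (u + 4 * s - 2) := rfl
    rw [e, norm_mul, Complex.norm_cpow_eq_rpow_re_of_pos hx2]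
    have hre : (u + 4 * s - 2).re = u.re + 4 * s.re - 2 := by simp
    rw [hre, mul_right_comm]
    refine mul_le_mul (hb u h1 h2) ?_ (by positivity) ((norm_nonneg _).trans (hb u h1 h2))
    have p1 := Real.rpow_nonneg hx2.le (c + 4 * s.re - 2)
    have p2 := Real.rpow_nonneg hx2.le (d + 4 * s.re - 2)
    rcases le_total 1 (x / 2) with ht1 | ht1
    · have := Real.rpow_le_rpow_of_exponent_le ht1
        (show u.re + 4 * s.re - 2 ≤ d + 4 * s.re - 2 by linarith)
      linarith
    · have := Real.rpow_le_rpow_of_exponent_ge hx2 ht1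
        (show c + 4 * s.re - 2 ≤ u.re + 4 * s.re - 2 by linarith)
      linarith

/-- Analytic properties of `Φ_{κ,s}`: for `1/2 ≤ Re s ≤ 5/4 + ε₀`, the contour
integral converges absolutely for admissible `ξ` and is independent of `ξ`;
`Φ_{κ,s}` is `C²` on `(0,∞)`, vanishes as `x → 0⁺`, and its derivatives of order
`ℓ = 0,1,2` are `≤ C′(1+x)^{−2−δ}`. -/
theorem stmt_13 (A C : ℝ) (hA : 12 < A)
    (φ : ℝ → ℂ) (hφ : ContDiffOn ℝ (⊤ : ℕ∞) φ (Set.Ici 0))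
    (hφ0 : ∀ j : ℕ, j ≤ 12 → iteratedDerivWithin j φ (Set.Ici 0) 0 = 0)
    (hφb : ∀ j : ℕ, j ≤ 12 → ∀ x : ℝ, 0 ≤ x →
      ‖iteratedDerivWithin j φ (Set.Ici 0) x‖ ≤ C * (1 + x) ^ (-A))
    (κ : ℕ) (hκeven : Even κ) (hκ12 : 12 ≤ κ)
    (ε₀ : ℝ) (hε₀ : 0 < ε₀) (hε₀' : ε₀ < 1 / 100)
    (s : ℂ) (hs1 : 1 / 2 ≤ s.re) (hs2 : s.re ≤ 5 / 4 + ε₀) :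
    (∀ ξ : ℝ, 3 - 12 - 4 * s.re < 2 * ξ → ξ < min (A - 12) 10 →
      ∀ x : ℝ, 0 < x →
        MeasureTheory.Integrable
          (fun t : ℝ => PhiIntegrand κ s φ x ((ξ : ℂ) + (t : ℂ) * Complex.I))) ∧
    (∀ ξ₁ ξ₂ : ℝ, 3 - 12 - 4 * s.re < 2 * ξ₁ → ξ₁ < min (A - 12) 10 →
      3 - 12 - 4 * s.re < 2 * ξ₂ → ξ₂ < min (A - 12) 10 →
      ∀ x : ℝ, 0 < x → PhiFun κ s φ ξ₁ x = PhiFun κ s φ ξ₂ x) ∧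
    (∀ ξ : ℝ, 3 - 12 - 4 * s.re < 2 * ξ → ξ < min (A - 12) 10 →
      ContDiffOn ℝ 2 (PhiFun κ s φ ξ) (Set.Ioi 0) ∧
      Filter.Tendsto (PhiFun κ s φ ξ) (nhdsWithin 0 (Set.Ioi 0)) (nhds 0) ∧
      ∃ δ : ℝ, 0 < δ ∧ ∃ C' : ℝ, 0 < C' ∧
        ∀ ℓ : ℕ, ℓ ≤ 2 → ∀ x : ℝ, 0 < x →
          ‖iteratedDerivWithin ℓ (PhiFun κ s φ ξ) (Set.Ioi 0) x‖
            ≤ C' * (1 + x) ^ (-2 - δ)) := by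
  
  have hσ : s.re ≤ 5 / 4 + 1 / 100 := by linarith
  obtain ⟨hmd, hmb⟩ := mB_phi A C hA φ hφ hφ0 hφb
  have hd : ∀ u : ℂ, -12 < u.re → u.re < 10 → DifferentiableAt ℂ (Gk κ s φ) u :=
    fun u h1 h2 => gk_diff φ κ hκ12 s hσ u h2 (hmd u h1 (by linarith))
  have bnd : ∀ j : ℕ, j ≤ 12 → ∀ c d : ℝ, -12 < c → d < 10 → d + j < A → c ≤ d →
      ∃ K : ℝ, ∀ u : ℂ, c ≤ u.re → u.re ≤ d →
      ‖Gk κ s φ u‖ ≤ K * (1 + |u.im|) ^ (-((j : ℝ) - 2 + 4 * s.re + 2 * c)) :=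
    fun j hj c d hc hd1 hdA hcd => gk_bound φ κ s c d j
      (fun u h1 h2 => hd u (by linarith) (by linarith)) (hmb j hj c d hc hdA hcd)
  have shift : ∀ ξ : ℝ, 3 - 12 - 4 * s.re < 2 * ξ → ξ < 10 → ∀ x : ℝ, 0 < x →
      Integrable (fun t : ℝ => PhiIntegrand κ s φ x ((ξ : ℂ) + t * Complex.I)) ∧
      PhiFun κ s φ ξ x = PhiFun κ s φ 0 x := by
    intro ξ h1 h2 x hx
    rcases le_total ξ 0 with h | h
    · obtain ⟨K, hK⟩ := bnd 12 le_rfl ξ 0 (by linarith) (by linarith) (by push_cast; linarith) h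
      have := phi_shift φ κ s ξ 0 K _ h (by push_cast; linarith)
        (fun u h3 h4 => hd u (by linarith) (by linarith)) hK x hx
      exact ⟨this.1 ξ ⟨le_rfl, h⟩, this.2⟩
    · obtain ⟨K, hK⟩ := bnd 2 (by norm_num) 0 ξ (by linarith) (by linarith)
        (by push_cast; linarith) h
      have := phi_shift φ κ s 0 ξ K _ h (by push_cast; linarith)
        (fun u h3 h4 => hd u (by linarith) (by linarith)) hK x hx
      exact ⟨this.1 ξ ⟨h, le_rfl⟩, this.2.symm⟩
  refine ⟨fun ξ h1 h2 x hx => (shift ξ h1 (lt_of_lt_of_le h2 (min_le_right _ _)) x hx).1,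
    fun ξ₁ ξ₂ h1 h2 h3 h4 x hx => ?_, fun ξ h1 h2 => ?_⟩
  · rw [(shift ξ₁ h1 (lt_of_lt_of_le h2 (min_le_right _ _)) x hx).2,
      (shift ξ₂ h3 (lt_of_lt_of_le h4 (min_le_right _ _)) x hx).2]
  have h2' : ξ < 10 := lt_of_lt_of_le h2 (min_le_right _ _)
  have heq : ∀ η : ℝ, 3 - 12 - 4 * s.re < 2 * η → η < 10 →
      EqOn (PhiFun κ s φ ξ) (PhiFun κ s φ η) (Ioi 0) := fun η e1 e2 x hx => by
    rw [(shift ξ h1 h2' x hx).2, (shift η e1 e2 x hx).2]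
  -- left contour
  set ξ₁ : ℝ := -(17 / 5) - 2 * s.re with hξ₁
  obtain ⟨Ka, hKa⟩ := bnd 12 le_rfl ξ₁ ξ₁ (by linarith) (by linarith)
    (by push_cast; linarith) le_rfl
  obtain ⟨-, L1, hL1, hleft⟩ := phi_calc φ κ s ξ₁ Ka _ (by push_cast; linarith)
    (fun u e => hd u (by linarith) (by linarith)) (fun u e => hKa u e.ge e.le)
  -- right contour
  obtain ⟨Kb, hKb⟩ := bnd 2 (by norm_num) 3 3 (by linarith) (by linarith)
    (by push_cast; linarith) le_rfl
  obtain ⟨hC2, R1, hR1, hright⟩ := phi_calc φ κ s 3 Kb _ (by push_cast; linarith)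
    (fun u e => hd u (by linarith) (by linarith)) (fun u e => hKb u e.ge e.le)
  have heq1 := heq ξ₁ (by linarith) (by linarith)
  have heq3 := heq 3 (by linarith) (by linarith)
  refine ⟨hC2.congr heq3, ?_, 1 / 2, by norm_num, ?_⟩
  · have hlim : Tendsto (fun x : ℝ => R1 * (x / 2) ^ (1 + 4 * s.re)) (𝓝[>] 0) (𝓝 0) := by
      have h0 : Tendsto (fun x : ℝ => x / 2) (𝓝 0) (𝓝 0) := by
        have : Continuous (fun x : ℝ => x / 2) := by fun_prop
        simpa using this.tendsto 0
      have := ((Real.continuousAt_rpow_const 0 (1 + 4 * s.re)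
        (Or.inr (by linarith))).tendsto.comp h0).const_mul R1
      rw [Real.zero_rpow (by linarith), mul_zero] at this
      exact this.mono_left nhdsWithin_le_nhds
    refine squeeze_zero_norm' ?_ hlim
    filter_upwards [self_mem_nhdsWithin] with x hx
    have := hright 0 (by norm_num) x hx
    rw [iteratedDerivWithin_zero] at this
    rw [heq3 hx]
    refine this.trans (le_of_eq ?_)
    congr 2
    push_cast; ring
  · have hexp : (-2 - 1 / 2 : ℝ) = -(5 / 2) := by norm_num
    refine ⟨(R1 + L1 * 2 ^ (10 : ℝ) + 1) * 2 ^ (5 / 2 : ℝ), by positivity, fun ℓ hℓ x hx => ?_⟩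
    have hℓ' : (ℓ : ℝ) ≤ 2 := by exact_mod_cast hℓ
    have hℓ0 : (0 : ℝ) ≤ ℓ := ℓ.cast_nonneg
    have hL2 : 0 ≤ L1 * 2 ^ (10 : ℝ) := by positivity
    rw [hexp]
    rcases le_total x 1 with hx1 | hx1
    · rw [iteratedDerivWithin_congr heq3 hx]
      have a1 : (x / 2) ^ (3 + 4 * s.re - 2 - ℓ) ≤ 1 :=
        Real.rpow_le_one (by positivity) (by linarith) (by linarith)
      have a2 : (2 : ℝ) ^ (-(5 / 2) : ℝ) ≤ (1 + x) ^ (-(5 / 2) : ℝ) :=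
        Real.rpow_le_rpow_of_nonpos (by linarith) (by linarith) (by norm_num)
      have a3 : (2 : ℝ) ^ (5 / 2 : ℝ) * 2 ^ (-(5 / 2) : ℝ) = 1 := by
        rw [← Real.rpow_add (by norm_num)]; norm_num
      calc _ ≤ R1 * (x / 2) ^ (3 + 4 * s.re - 2 - ℓ) := hright ℓ hℓ x hx
        _ ≤ R1 * 1 := by gcongr
        _ ≤ (R1 + L1 * 2 ^ (10 : ℝ) + 1) * 1 := by linarith
        _ = (R1 + L1 * 2 ^ (10 : ℝ) + 1) * (2 ^ (5 / 2 : ℝ) * 2 ^ (-(5 / 2) : ℝ)) := by rw [a3]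
        _ ≤ (R1 + L1 * 2 ^ (10 : ℝ) + 1) * (2 ^ (5 / 2 : ℝ) * (1 + x) ^ (-(5 / 2) : ℝ)) := by
            gcongr
        _ = _ := by ring
    · rw [iteratedDerivWithin_congr heq1 hx]
      have a1 : (x / 2) ^ (ξ₁ + 4 * s.re - 2 - ℓ) ≤ 2 ^ (10 : ℝ) * x ^ (-(5 / 2) : ℝ) := by
        rw [Real.div_rpow hx.le (by norm_num), div_eq_mul_inv,
          ← Real.rpow_neg (by norm_num : (0 : ℝ) ≤ 2), mul_comm]
        have b1 : (2 : ℝ) ^ (-(ξ₁ + 4 * s.re - 2 - ℓ)) ≤ 2 ^ (10 : ℝ) :=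
          Real.rpow_le_rpow_of_exponent_le (by norm_num) (by linarith)
        have b2 : x ^ (ξ₁ + 4 * s.re - 2 - ℓ) ≤ x ^ (-(5 / 2) : ℝ) :=
          Real.rpow_le_rpow_of_exponent_le hx1 (by linarith)
        gcongr
      have a2 : x ^ (-(5 / 2) : ℝ) ≤ 2 ^ (5 / 2 : ℝ) * (1 + x) ^ (-(5 / 2) : ℝ) := by
        have := rpow_compare x (1 + x) (-(5 / 2)) 2 (by norm_num) (by linarith) (by linarith)
          (by linarith)
        rwa [show |(-(5 / 2) : ℝ)| = 5 / 2 by rw [abs_neg, abs_of_pos (by norm_num)]] at this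
      calc _ ≤ L1 * (x / 2) ^ (ξ₁ + 4 * s.re - 2 - ℓ) := hleft ℓ hℓ x hx
        _ ≤ L1 * (2 ^ (10 : ℝ) * x ^ (-(5 / 2) : ℝ)) := by gcongr
        _ = (L1 * 2 ^ (10 : ℝ)) * x ^ (-(5 / 2) : ℝ) := by ring
        _ ≤ (R1 + L1 * 2 ^ (10 : ℝ) + 1) * (2 ^ (5 / 2 : ℝ) * (1 + x) ^ (-(5 / 2) : ℝ)) := by
            gcongr
            linarith
        _ = _ := by ring
end
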